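/- arXiv:1206.3926 — 2 statements merged into one kernel-verified Lean document; each statement's English description precedes it below -/
import Mathlib

section
/- Let Ω be an open ball or annulus centered at the origin in ℝ^N, N ≥ 2, and let U ∈ C^{3,α}(Ω̄;ℝ^m) be a solution of −Δu_i = f_i(|x|,U) in Ω, u_i = 0 on ∂Ω, satisfying hypotheses (i)–(iii) of the main symmetry theorem: (i) the system is fully coupled along U in Ω(e) for every e ∈ S^{N−1}; (ii) each (∂f_i/∂u_j)(|x|,u_1,…,u_m) is nondecreasing in each variable u_k; (iii) if m ≥ 3, each f_i(|x|,u_1,…,u_m) = Σ_{k≠i} g_{ik}(|x|,u_i,u_k) with g_{ik} ∈ C^{1,α}. If U has Morse index exactly one and is not radial (hence it is foliated Schwarz symmetric with some axis p and can be written as U = U(r,θ)), then for every i = 1,…,m and all (r,θ): Σ_{j=1}^m (∂f_i/∂u_j)(r,U(r,θ)) · (∂u_j/∂θ)(r,θ) = Σ_{j=1}^m (∂f_j/∂u_i)(r,U(r,θ)) · (∂u_j/∂θ)(r,θ). In particular, if m = 2 then (∂f_1/∂u_2)(|x|,U(x)) = (∂f_2/∂u_1)(|x|,U(x)) for all x ∈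 Ω. -/
open MeasureTheory Real Set
open scoped RealInnerProductSpace ENNReal

noncomputable section

/-- Euclidean space `ℝ^N`. -/
abbrev EuclN (N : ℕ) := EuclideanSpace ℝ (Fin N)

/-- The Laplacian of a scalar function on `ℝ^N`. -/
def lap {N : ℕ} (u : EuclN N → ℝ) (x : EuclN N) : ℝ :=
  ∑ i : Fin N, iteratedFDeriv ℝ 2 u x ![EuclideanSpace.single i 1, EuclideanSpace.single i 1]

/-- Partial derivative `∂f/∂u_j` of `f(r, u)` with respect to the `j`-th `u`-variable. -/
def pd {m : ℕ} (f : ℝ → (Fin m → ℝ) → ℝ) (j : Fin m) (r : ℝ) (s : Fin m → ℝ) : ℝ :=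
  fderiv ℝ (f r) s (Pi.single j 1)

/-- `Ψ ∈ C^1_c(Ω'; ℝ^m)`. -/
def IsTestFun {N m : ℕ} (Ω' : Set (EuclN N)) (Ψ : Fin m → EuclN N → ℝ) : Prop :=
  ∀ i, ContDiff ℝ 1 (Ψ i) ∧ HasCompactSupport (Ψ i) ∧ tsupport (Ψ i) ⊆ Ω'

/-- The quadratic form `Q_U(Ψ; Ω')` of the linearized operator at a solution `U`. -/
def Qform {N m : ℕ} (f : Fin m → ℝ → (Fin m → ℝ) → ℝ) (U : Fin m → EuclN N → ℝ)
    (Ω' : Set (EuclN N)) (Ψ : Fin m → EuclN N → ℝ) : ℝ :=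
  ∫ x in Ω', ((∑ i, ‖gradient (Ψ i) x‖ ^ 2) -
    ∑ i, ∑ j, pd (f i) j ‖x‖ (fun k => U k x) * Ψ i x * Ψ j x)

/-- There is a `k`-dimensional subspace of `C^1_c(Ω'; ℝ^m)` on which `Q_U(·; Ω')`
is negative definite. -/
def NegDefFamily {N m : ℕ} (f : Fin m → ℝ → (Fin m → ℝ) → ℝ) (U : Fin m → EuclN N → ℝ)
    (Ω' : Set (EuclN N)) (k : ℕ) : Prop :=
  ∃ Ψ : Fin k → Fin m → EuclN N → ℝ,
    (∀ l, IsTestFun Ω' (Ψ l)) ∧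
    ∀ c : Fin k → ℝ, c ≠ 0 → Qform f U Ω' (fun i x => ∑ l, c l * Ψ l i x) < 0

/-- The semilinear system is cooperative (weakly coupled) in `Ω'`. -/
def CoopAlong {N m : ℕ} (f : Fin m → ℝ → (Fin m → ℝ) → ℝ) (Ω' : Set (EuclN N)) : Prop :=
  ∀ i j, i ≠ j → ∀ x ∈ Ω', ∀ s : Fin m → ℝ, 0 ≤ pd (f i) j ‖x‖ s

/-- The semilinear system is fully coupled along the solution `U` in `Ω'`. -/
def FullyCoupledAlong {N m : ℕ} (f : Fin m → ℝ → (Fin m → ℝ) → ℝ)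
    (U : Fin m → EuclN N → ℝ) (Ω' : Set (EuclN N)) : Prop :=
  CoopAlong f Ω' ∧
  ∀ I J : Finset (Fin m), I.Nonempty → J.Nonempty → Disjoint I J → I ∪ J = Finset.univ →
    ∃ i₀ ∈ I, ∃ j₀ ∈ J,
      0 < volume {x ∈ Ω' | 0 < pd (f i₀) j₀ ‖x‖ (fun k => U k x)}

/-- `Ω` is an open ball or annulus centered at the origin. -/
def IsBallOrAnnulus {N : ℕ} (Ω : Set (EuclN N)) : Prop :=
  (∃ R : ℝ, 0 < R ∧ Ω = Metric.ball (0 : EuclN N) R) ∨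
  (∃ r R : ℝ, 0 < r ∧ r < R ∧ Ω = {x : EuclN N | r < ‖x‖ ∧ ‖x‖ < R})

/-- The half-domain `Ω(e) = {x ∈ Ω : x·e > 0}`. -/
def halfDom {N : ℕ} (Ω : Set (EuclN N)) (e : EuclN N) : Set (EuclN N) :=
  {x ∈ Ω | 0 < ⟪x, e⟫}

/-- Reflection through the hyperplane `T(e) = {x : x·e = 0}`. -/
def reflPt {N : ℕ} (e x : EuclN N) : EuclN N := x - (2 * ⟪x, e⟫) • e

/-- `U` is foliated Schwarz symmetric on `Ω` with respect to the axis `p`. -/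
def FoliatedSchwarzWith {N m : ℕ} (Ω : Set (EuclN N)) (U : Fin m → EuclN N → ℝ)
    (p : EuclN N) : Prop :=
  ‖p‖ = 1 ∧ ∀ i, ∀ x ∈ Ω, ∀ y ∈ Ω, ‖x‖ = ‖y‖ → ⟪y, p⟫ ≤ ⟪x, p⟫ → U i y ≤ U i x

/-- `U` is foliated Schwarz symmetric on `Ω`. -/
def FoliatedSchwarz {N m : ℕ} (Ω : Set (EuclN N)) (U : Fin m → EuclN N → ℝ) : Prop :=
  ∃ p : EuclN N, FoliatedSchwarzWith Ω U p

/-- `U` is radial on `Ω`. -/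
def IsRadial {N m : ℕ} (Ω : Set (EuclN N)) (U : Fin m → EuclN N → ℝ) : Prop :=
  ∀ i, ∀ x ∈ Ω, ∀ y ∈ Ω, ‖x‖ = ‖y‖ → U i x = U i y

/-- `U` is a classical solution of `-Δu_i = f_i(|x|, U)` in `Ω`, `u_i = 0` on `∂Ω`. -/
def IsSolution {N m : ℕ} (Ω : Set (EuclN N)) (f : Fin m → ℝ → (Fin m → ℝ) → ℝ)
    (U : Fin m → EuclN N → ℝ) : Prop :=
  (∀ i, ∀ x ∈ Ω, -lap (U i) x = f i ‖x‖ (fun k => U k x)) ∧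
  (∀ i, ∀ x ∈ frontier Ω, U i x = 0)

/-- The bilinear form of the linear system `-ΔU + C(x) U`. -/
def BformL {N m : ℕ} (Ω' : Set (EuclN N)) (C : Fin m → Fin m → EuclN N → ℝ)
    (V Φ : Fin m → EuclN N → ℝ) : ℝ :=
  ∫ x in Ω', ((∑ i, ⟪gradient (V i) x, gradient (Φ i) x⟫) +
    ∑ i, ∑ j, C i j x * V i x * Φ j x)

/-- `-ΔU + D U ≥ 0` weakly in `Ω'`. -/
def WeakSuperSol {N m : ℕ} (Ω' : Set (EuclN N)) (D : Fin m → Fin m → EuclN N → ℝ)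
    (U : Fin m → EuclN N → ℝ) : Prop :=
  ∀ Ψ : Fin m → EuclN N → ℝ, IsTestFun Ω' Ψ → (∀ i x, 0 ≤ Ψ i x) →
    0 ≤ BformL Ω' D U Ψ

/-- `-ΔU + D U ≤ 0` weakly in `Ω'`. -/
def WeakSubSol {N m : ℕ} (Ω' : Set (EuclN N)) (D : Fin m → Fin m → EuclN N → ℝ)
    (U : Fin m → EuclN N → ℝ) : Prop :=
  ∀ Ψ : Fin m → EuclN N → ℝ, IsTestFun Ω' Ψ → (∀ i x, 0 ≤ Ψ i x) →
    BformL Ω' D U Ψ ≤ 0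

/-- The linear system with matrix `D` is cooperative in `Ω`: `d_ij ≤ 0` a.e. for `i ≠ j`. -/
def LinCoop {N m : ℕ} (Ω : Set (EuclN N)) (D : Fin m → Fin m → EuclN N → ℝ) : Prop :=
  ∀ i j, i ≠ j → ∀ᵐ x ∂(volume : Measure (EuclN N)), x ∈ Ω → D i j x ≤ 0

/-- The linear system with matrix `D` is fully coupled in `Ω`. -/
def LinFullyCoupled {N m : ℕ} (Ω : Set (EuclN N)) (D : Fin m → Fin m → EuclN N → ℝ) : Prop :=
  LinCoop Ω D ∧
  ∀ I J : Finset (Fin m), I.Nonempty → J.Nonempty → Disjoint I J → I ∪ J = Finset.univ →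
    ∃ i₀ ∈ I, ∃ j₀ ∈ J, 0 < volume {x ∈ Ω | D i₀ j₀ x < 0}

/-- First symmetric eigenvalue on `Ω'`: the infimum of the Rayleigh quotient of the
symmetric matrix `C` over nontrivial test functions. -/
def lamOneSym {N m : ℕ} (Ω' : Set (EuclN N)) (C : Fin m → Fin m → EuclN N → ℝ) : ℝ :=
  sInf {r : ℝ | ∃ Ψ : Fin m → EuclN N → ℝ, IsTestFun Ω' Ψ ∧ (∃ i x, Ψ i x ≠ 0) ∧
    r = BformL Ω' C Ψ Ψ / ∫ x in Ω', ∑ i, (Ψ i x) ^ 2}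

end

namespace SC
open Topology Filter

noncomputable section

variable {N m : ℕ}

/-- directional derivative -/
def DD (a : EuclN N) (u : EuclN N → ℝ) (x : EuclN N) : ℝ := fderiv ℝ u x a

/-- basis vector -/
abbrev bv (k : Fin N) : EuclN N := EuclideanSpace.single k 1

lemma DD_contDiffOn {D : Set (EuclN N)} (hD : IsOpen D) {n : ℕ} {u : EuclN N → ℝ}
    (hu : ContDiffOn ℝ (n + 1 : ℕ) u D) (a : EuclN N) : ContDiffOn ℝ n (DD a u) D := by
  have h := hu.fderiv_of_isOpen (m := n) hD (by norm_cast)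
  exact h.clm_apply contDiffOn_const

lemma DD_DD_apply {u : EuclN N → ℝ} {x : EuclN N} (hu : ContDiffAt ℝ 2 u x) (a b : EuclN N) :
    DD a (DD b u) x = fderiv ℝ (fderiv ℝ u) x a b := by
  have h1 : DifferentiableAt ℝ (fderiv ℝ u) x :=
    (hu.fderiv_right (m := 1) (by norm_num)).differentiableAt (by norm_num)
  unfold DD
  rw [fderiv_clm_apply h1 (differentiableAt_const b)]
  simp

lemma DD_comm {u : EuclN N → ℝ} {x : EuclN N} (hu : ContDiffAt ℝ 2 u x) (a b : EuclN N) :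
    DD a (DD b u) x = DD b (DD a u) x := by
  rw [DD_DD_apply hu, DD_DD_apply hu]
  exact (hu.isSymmSndFDerivAt (by simp)).eq a b

lemma lap_eq {u : EuclN N → ℝ} {x : EuclN N} (hu : ContDiffAt ℝ 2 u x) :
    lap u x = ∑ k, DD (bv k) (DD (bv k) u) x := by
  unfold lap
  refine Finset.sum_congr rfl fun k _ => ?_
  rw [DD_DD_apply hu, iteratedFDeriv_two_apply]
  rfl

lemma lap_congr {u v : EuclN N → ℝ} {x : EuclN N} (h : u =ᶠ[𝓝 x] v) : lap u x = lap v x := by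
  unfold lap
  refine Finset.sum_congr rfl fun k _ => ?_
  rw [h.iteratedFDeriv ℝ 2 |>.eq_of_nhds]

lemma DD_congr {u v : EuclN N → ℝ} {x : EuclN N} (h : u =ᶠ[𝓝 x] v) (a : EuclN N) :
    DD a u x = DD a v x := by
  unfold DD; rw [h.fderiv_eq]

lemma lap_sub {u v : EuclN N → ℝ} {x : EuclN N} (hu : ContDiffAt ℝ 2 u x)
    (hv : ContDiffAt ℝ 2 v x) : lap (fun y => u y - v y) x = lap u x - lap v x := by
  unfold lap
  rw [← Finset.sum_sub_distrib]
  refine Finset.sum_congr rfl fun k _ => ?_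
  have := iteratedFDeriv_sub_apply (𝕜 := ℝ) (i := 2) hu hv
  have h2 : (fun y => u y - v y) = u - v := rfl
  rw [h2, this]; rfl

lemma lap_comp (L : EuclN N ≃ₗᵢ[ℝ] EuclN N) (u : EuclN N → ℝ) (x : EuclN N) :
    lap (fun y => u (L y)) x = lap u (L x) := by
  have h1 : lap u (L x) = (Laplacian.laplacian u) (L x) := by
    rw [InnerProductSpace.laplacian_eq_iteratedFDeriv_orthonormalBasis u
      (EuclideanSpace.basisFun (Fin N) ℝ)]
    simp [lap]
  rw [h1, InnerProductSpace.laplacian_eq_iteratedFDeriv_orthonormalBasis u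
      ((EuclideanSpace.basisFun (Fin N) ℝ).map L)]
  unfold lap
  refine Finset.sum_congr rfl fun k _ => ?_
  have h2 : iteratedFDeriv ℝ 2 (u ∘ L) x =
      (iteratedFDeriv ℝ 2 u (L x)).compContinuousLinearMap
        fun _ => (L.toContinuousLinearEquiv : EuclN N →L[ℝ] EuclN N) := by
    simp only [← iteratedFDerivWithin_univ]
    have := L.toContinuousLinearEquiv.iteratedFDerivWithin_comp_right u uniqueDiffOn_univ
      (x := x) (mem_univ _) 2
    simpa using this
  change iteratedFDeriv ℝ 2 (u ∘ L) x _ = _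
  rw [h2]
  simp only [ContinuousMultilinearMap.compContinuousLinearMap_apply]
  congr 1
  ext j
  fin_cases j <;> simp

lemma norm_grad_sq (u : EuclN N → ℝ) (x : EuclN N) :
    ‖gradient u x‖ ^ 2 = ∑ k, (DD (bv k) u x) ^ 2 := by
  rw [EuclideanSpace.norm_sq_eq]
  refine Finset.sum_congr rfl fun k _ => ?_
  have : DD (bv k) u x = (gradient u x) k := by
    have h : ⟪gradient u x, bv k⟫ = fderiv ℝ u x (bv k) := by
      simp [gradient]
    unfold DD
    rw [← h, EuclideanSpace.inner_single_right]
    simp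
  rw [this]
  simp

lemma cont_mul_of_tsupport {D : Set (EuclN N)} (hD : IsOpen D) {φ g : EuclN N → ℝ}
    (hφ : Continuous φ) (hs : tsupport φ ⊆ D) (hg : ContinuousOn g D) :
    Continuous (fun x => φ x * g x) := by
  rw [continuous_iff_continuousAt]
  intro x
  by_cases hx : x ∈ D
  · exact hφ.continuousAt.mul (hg.continuousAt (hD.mem_nhds hx))
  · have h1 : x ∉ tsupport φ := fun h => hx (hs h)
    have h2 : (fun x => φ x * g x) =ᶠ[𝓝 x] fun _ => 0 := by
      filter_upwards [notMem_tsupport_iff_eventuallyEq.1 h1] with y hy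
      simp [hy]
    exact h2.continuousAt

lemma tsupport_DD (φ : EuclN N → ℝ) (a : EuclN N) : tsupport (DD a φ) ⊆ tsupport φ :=
  tsupport_fderiv_apply_subset ℝ a

lemma DD_continuous {φ : EuclN N → ℝ} (h : ContDiff ℝ 1 φ) (a : EuclN N) :
    Continuous (DD a φ) := (h.continuous_fderiv (by norm_num)).clm_apply continuous_const

lemma DD_hcs {φ : EuclN N → ℝ} (h : HasCompactSupport φ) (a : EuclN N) :
    HasCompactSupport (DD a φ) := h.fderiv_apply ℝ a

/-- integration by parts -/
lemma ibp {D : Set (EuclN N)} (hD : IsOpen D) {φ g : EuclN N → ℝ}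
    (hφ : ContDiff ℝ 1 φ) (hc : HasCompactSupport φ) (hs : tsupport φ ⊆ D)
    (hg : ContDiffOn ℝ 1 g D) (a : EuclN N) :
    Integrable (fun x => φ x * DD a g x) ∧ Integrable (fun x => DD a φ x * g x) ∧
    ∫ x, φ x * DD a g x = - ∫ x, DD a φ x * g x := by
  have i1 : Integrable (fun x => φ x * DD a g x) :=
    (cont_mul_of_tsupport hD hφ.continuous hs
      (DD_contDiffOn hD (n := 0) (by simpa using hg) a).continuousOn).integrable_of_hasCompactSupport
      hc.mul_right
  have i2 : Integrable (fun x => DD a φ x * g x) :=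
    (cont_mul_of_tsupport hD (DD_continuous hφ a) ((tsupport_DD φ a).trans hs)
      hg.continuousOn).integrable_of_hasCompactSupport (DD_hcs hc a).mul_right
  have i3 : Integrable (fun x => φ x * g x) :=
    (cont_mul_of_tsupport hD hφ.continuous hs
      hg.continuousOn).integrable_of_hasCompactSupport hc.mul_right
  refine ⟨i1, i2, ?_⟩
  exact integral_mul_fderiv_eq_neg_fderiv_mul_of_integrable i2 i1 i3
    (fun x _ => hφ.differentiable (by norm_num) x)
    (fun x hx => (hg.contDiffAt (hD.mem_nhds (hs hx))).differentiableAt (by norm_num))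

/-- Green identity: `∫ ∇φ·∇g = ∫ φ (-Δ g)` -/
lemma green {D : Set (EuclN N)} (hD : IsOpen D) {φ g : EuclN N → ℝ}
    (hφ : ContDiff ℝ 1 φ) (hc : HasCompactSupport φ) (hs : tsupport φ ⊆ D)
    (hg : ContDiffOn ℝ 2 g D) :
    Integrable (fun x => ∑ k, DD (bv k) φ x * DD (bv k) g x) ∧
    Integrable (fun x => φ x * (- lap g x)) ∧
    ∫ x, ∑ k, DD (bv k) φ x * DD (bv k) g x = ∫ x, φ x * (- lap g x) := by
  have H : ∀ k : Fin N, _ := fun k =>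
    ibp hD hφ hc hs (DD_contDiffOn hD (n := 1) (by simpa using hg) (bv k)) (bv k)
  have e : (fun x => φ x * (- lap g x)) =
      fun x => - ∑ k, φ x * DD (bv k) (DD (bv k) g) x := by
    ext x
    by_cases hx : x ∈ D
    · rw [lap_eq (hg.contDiffAt (hD.mem_nhds hx)), ← Finset.mul_sum]; ring
    · have : φ x = 0 := image_eq_zero_of_notMem_tsupport fun h => hx (hs h)
      simp [this]
  refine ⟨integrable_finsetSum _ fun k _ => (H k).2.1, ?_, ?_⟩
  · rw [e]
    exact (integrable_finsetSum _ fun k _ => (H k).1).neg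
  · rw [e, integral_neg, integral_finsetSum _ fun k _ => (H k).2.1,
      integral_finsetSum _ fun k _ => (H k).1, ← Finset.sum_neg_distrib]
    refine Finset.sum_congr rfl fun k _ => ?_
    rw [(H k).2.2, neg_neg]

end
end SC

namespace SC
open Topology Filter

noncomputable section

variable {N m : ℕ}

lemma prim {χ : ℝ → ℝ} (hc : Continuous χ) {ε : ℝ} (hε : 0 < ε) (h0 : ∀ t, 0 ≤ χ t)
    (h1 : ∀ t, χ t ≤ 1) (hz : ∀ t, t ≤ ε → χ t = 0) (ho : ∀ t, 2 * ε ≤ t → χ t = 1) :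
    ∃ P : ℝ → ℝ, ContDiff ℝ 1 P ∧ (∀ t, deriv P t = χ t) ∧ (∀ t, t ≤ ε → P t = 0) ∧
      ∀ t, |P t - max t 0| ≤ 2 * ε := by
  have hd : ∀ t, HasDerivAt (fun t => ∫ s in (0:ℝ)..t, χ s) (χ t) t := fun t =>
    intervalIntegral.integral_hasDerivAt_right (hc.intervalIntegrable _ _)
      hc.stronglyMeasurable.stronglyMeasurableAtFilter hc.continuousAt
  have hde : deriv (fun t => ∫ s in (0:ℝ)..t, χ s) = χ := funext fun t => (hd t).deriv
  have hP0 : ∀ t, t ≤ ε → (∫ s in (0:ℝ)..t, χ s) = 0 := by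
    intro t ht
    apply intervalIntegral.integral_zero_ae
    refine Eventually.of_forall fun s hs => hz s ?_
    rcases hs with ⟨_, h2⟩
    exact h2.trans (max_le hε.le ht)
  refine ⟨fun t => ∫ s in (0:ℝ)..t, χ s, ?_, fun t => (hd t).deriv, hP0, ?_⟩
  · rw [contDiff_one_iff_deriv, hde]
    exact ⟨fun t => (hd t).differentiableAt, hc⟩
  · intro t
    rcases le_total t ε with ht | ht
    · simp only [hP0 t ht]
      rw [zero_sub, abs_neg, abs_of_nonneg (le_max_right _ _)]
      exact max_le (by linarith) (by linarith)
    · have ht0 : 0 ≤ t := hε.le.trans ht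
      rw [max_eq_left ht0]
      have hle : (∫ s in (0:ℝ)..t, χ s) ≤ t := by
        have := intervalIntegral.integral_mono_on ht0 (hc.intervalIntegrable (μ := volume) 0 t)
          ((continuous_const (y := (1:ℝ))).intervalIntegrable 0 t) (fun s _ => h1 s)
        simpa using this
      have hge : t - 2 * ε ≤ (∫ s in (0:ℝ)..t, χ s) := by
        rcases le_total t (2 * ε) with h | h
        · have := intervalIntegral.integral_nonneg (μ := volume) ht0 (fun s _ => h0 s)
          linarith
        · rw [← intervalIntegral.integral_add_adjacent_intervals
            (hc.intervalIntegrable 0 (2 * ε)) (hc.intervalIntegrable (2 * ε) t)]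
          have a1 := intervalIntegral.integral_nonneg (μ := volume) (a := 0) (b := 2 * ε)
            (by linarith) (fun s _ => h0 s)
          have a2 : (∫ s in (2*ε)..t, χ s) = t - 2 * ε := by
            rw [intervalIntegral.integral_congr (g := fun _ => (1:ℝ))]
            · simp
            · intro s hs
              rw [uIcc_of_le h] at hs
              exact ho s hs.1
          linarith
      rw [abs_le]; constructor <;> linarith

lemma cutoff {ε : ℝ} (hε : 0 < ε) : ∃ φ ψ : ℝ → ℝ, ContDiff ℝ 1 φ ∧ ContDiff ℝ 1 ψ ∧
    (∀ t, deriv ψ t = deriv φ t ^ 2) ∧ (∀ t, t ≤ ε → φ t = 0) ∧ (∀ t, t ≤ ε → ψ t = 0) ∧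
    (∀ t, |φ t - max t 0| ≤ 2 * ε) ∧ (∀ t, |ψ t - max t 0| ≤ 2 * ε) := by
  let χ : ℝ → ℝ := fun s => max 0 (min 1 ((s - ε) / ε))
  have hc : Continuous χ := by fun_prop
  have h0 : ∀ t, 0 ≤ χ t := fun t => le_max_left _ _
  have h1 : ∀ t, χ t ≤ 1 := fun t => max_le zero_le_one (min_le_left _ _)
  have hz : ∀ t, t ≤ ε → χ t = 0 := fun t ht => by
    apply max_eq_left
    exact (min_le_right _ _).trans (div_nonpos_of_nonpos_of_nonneg (by linarith) hε.le)
  have ho : ∀ t, 2 * ε ≤ t → χ t = 1 := fun t ht => by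
    have : 1 ≤ (t - ε) / ε := by rw [le_div_iff₀ hε]; linarith
    simp [χ, min_eq_left this]
  obtain ⟨φ, a1, a2, a3, a4⟩ := prim hc hε h0 h1 hz ho
  obtain ⟨ψ, b1, b2, b3, b4⟩ := prim (χ := fun t => χ t ^ 2) (hc.pow 2) hε (fun t => sq_nonneg _)
    (fun t => pow_le_one₀ (h0 t) (h1 t)) (fun t ht => by simp [hz t ht])
    (fun t ht => by simp [ho t ht])
  exact ⟨φ, ψ, a1, b1, fun t => by rw [a2, b2], a3, b3, a4, b4⟩

/-- the quadratic form on the whole space -/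
def QQ (c : Fin m → Fin m → EuclN N → ℝ) (Ψ : Fin m → EuclN N → ℝ) : ℝ :=
  ∫ x, ((∑ i, ∑ k, DD (bv k) (Ψ i) x ^ 2) - ∑ i, ∑ j, c i j x * Ψ i x * Ψ j x)

lemma integrable_of_bdd {D : Set (EuclN N)} (hb : Bornology.IsBounded D)
    {F : EuclN N → ℝ} (hF : Measurable F) {K : ℝ} (hK : ∀ x, |F x| ≤ K)
    (h0 : ∀ x, x ∉ D → F x = 0) : Integrable F := by
  have : IntegrableOn F D :=
    Measure.integrableOn_of_bounded hb.measure_lt_top.ne hF.aestronglyMeasurable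
      (M := K) (Eventually.of_forall fun x => by simpa using hK x)
  rwa [integrableOn_iff_integrable_of_support_subset] at this
  intro x hx
  by_contra h
  exact hx (h0 x h)

lemma tendsto_of_bdd {D : Set (EuclN N)} (hD : IsOpen D) (hb : Bornology.IsBounded D)
    {F : ℕ → EuclN N → ℝ} {G : EuclN N → ℝ} (hF : ∀ n, Measurable (F n)) {K : ℝ}
    (hK : ∀ n x, |F n x| ≤ K)
    (h0 : ∀ n x, x ∉ D → F n x = 0) (hl : ∀ x, Tendsto (fun n => F n x) atTop (𝓝 (G x))) :
    Tendsto (fun n => ∫ x, F n x) atTop (𝓝 (∫ x, G x)) := by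
  refine tendsto_integral_of_dominated_convergence (D.indicator fun _ => K)
    (fun n => (hF n).aestronglyMeasurable) ?_ ?_ (Eventually.of_forall hl)
  · rw [integrable_indicator_iff hD.measurableSet]
    exact integrableOn_const hb.measure_lt_top.ne
  · intro n
    refine Eventually.of_forall fun x => ?_
    by_cases hx : x ∈ D
    · simpa [hx] using hK n x
    · simp [hx, h0 n x hx]

/-- uniform boundedness of families -/
def UB {ι : Type*} (F : ι → EuclN N → ℝ) : Prop := ∃ K, ∀ n x, |F n x| ≤ K

lemma UB.add {ι : Type*} {F G : ι → EuclN N → ℝ} (hF : UB F) (hG : UB G) :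
    UB (fun n x => F n x + G n x) := by
  obtain ⟨K, hK⟩ := hF
  obtain ⟨L, hL⟩ := hG
  exact ⟨K + L, fun n x => (abs_add_le _ _).trans (add_le_add (hK n x) (hL n x))⟩

lemma UB.mul {ι : Type*} {F G : ι → EuclN N → ℝ} (hF : UB F) (hG : UB G) :
    UB (fun n x => F n x * G n x) := by
  obtain ⟨K, hK⟩ := hF
  obtain ⟨L, hL⟩ := hG
  refine ⟨K * L, fun n x => ?_⟩
  rw [abs_mul]
  exact mul_le_mul (hK n x) (hL n x) (abs_nonneg _) ((abs_nonneg _).trans (hK n x))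

lemma UB.neg {ι : Type*} {F : ι → EuclN N → ℝ} (hF : UB F) : UB (fun n x => - F n x) := by
  obtain ⟨K, hK⟩ := hF
  exact ⟨K, fun n x => by rw [abs_neg]; exact hK n x⟩

lemma UB.sub {ι : Type*} {F G : ι → EuclN N → ℝ} (hF : UB F) (hG : UB G) :
    UB (fun n x => F n x - G n x) := by
  simpa only [sub_eq_add_neg] using hF.add hG.neg

lemma UB.const {ι : Type*} (a : ℝ) : UB (fun (_ : ι) (_ : EuclN N) => a) :=
  ⟨|a|, fun _ _ => le_rfl⟩

lemma UB.sum {ι κ : Type*} {s : Finset κ} {F : κ → ι → EuclN N → ℝ} (h : ∀ k, UB (F k)) :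
    UB (fun n x => ∑ k ∈ s, F k n x) := by
  choose K hK using h
  exact ⟨∑ k ∈ s, K k, fun n x => (Finset.abs_sum_le_sum_abs _ _).trans
    (Finset.sum_le_sum fun k _ => hK k n x)⟩

lemma bdd_of_hcs {g : EuclN N → ℝ} (hg : Continuous g) (hc : HasCompactSupport g) :
    ∃ K, ∀ x, |g x| ≤ K := by
  obtain ⟨K, hK⟩ := hc.exists_bound_of_continuous hg
  exact ⟨K, fun x => by simpa using hK x⟩

lemma UB.of_hcs {ι : Type*} {g : EuclN N → ℝ} (hg : Continuous g) (hc : HasCompactSupport g) :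
    UB (fun (_ : ι) x => g x) := by
  obtain ⟨K, hK⟩ := bdd_of_hcs hg hc
  exact ⟨K, fun _ x => hK x⟩

lemma hcs_of_zero {D : Set (EuclN N)} (hb : Bornology.IsBounded D) {w : EuclN N → ℝ}
    (h0 : ∀ x, x ∉ D → w x = 0) : HasCompactSupport w := by
  refine HasCompactSupport.of_support_subset_isCompact (K := closure D) ?_ ?_
  · exact hb.isCompact_closure
  · intro x hx
    by_contra h
    exact hx (h0 x fun h' => h (subset_closure h'))

lemma comp_test {D : Set (EuclN N)} (hD : IsOpen D) (hb : Bornology.IsBounded D)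
    {w : EuclN N → ℝ} (hw : Continuous w) (hw0 : ∀ x, x ∉ D → w x = 0)
    (hw2 : ContDiffOn ℝ 2 w D) {φ : ℝ → ℝ} (hφ : ContDiff ℝ 1 φ) {ε : ℝ} (hε : 0 < ε)
    (hz : ∀ t, t ≤ ε → φ t = 0) :
    ContDiff ℝ 1 (fun x => φ (w x)) ∧ HasCompactSupport (fun x => φ (w x)) ∧
    tsupport (fun x => φ (w x)) ⊆ D ∧
    (∀ x ∈ D, ∀ a, DD a (fun x => φ (w x)) x = deriv φ (w x) * DD a w x) := by
  have hcl : IsClosed {x | ε ≤ w x} := isClosed_le continuous_const hw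
  have hsub : {x | ε ≤ w x} ⊆ D := by
    intro x hx
    by_contra h
    have : ε ≤ w x := hx
    rw [hw0 x h] at this
    linarith
  have hts : tsupport (fun x => φ (w x)) ⊆ {x | ε ≤ w x} := by
    refine closure_minimal ?_ hcl
    intro x hx
    by_contra h
    exact hx (hz _ (not_le.1 h).le)
  refine ⟨?_, ?_, hts.trans hsub, ?_⟩
  · rw [contDiff_iff_contDiffAt]
    intro x
    by_cases hx : x ∈ D
    · exact hφ.contDiffAt.comp x ((hw2.contDiffAt (hD.mem_nhds hx)).of_le (by norm_num))
    · have h1 : x ∉ tsupport (fun x => φ (w x)) := fun h => hx (hsub (hts h))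
      exact contDiffAt_const.congr_of_eventuallyEq (notMem_tsupport_iff_eventuallyEq.1 h1)
  · exact hcs_of_zero hb fun x hx => hz _ (by rw [hw0 x hx]; exact hε.le)
  · intro x hx a
    unfold DD
    have h1 : HasDerivAt φ (deriv φ (w x)) (w x) :=
      (hφ.differentiable (by norm_num) _).hasDerivAt
    have h2 : HasFDerivAt w (fderiv ℝ w x) x :=
      ((hw2.contDiffAt (hD.mem_nhds hx)).differentiableAt (by norm_num)).hasFDerivAt
    have := (h1.comp_hasFDerivAt x h2).fderiv
    have e : (φ ∘ w) = fun x => φ (w x) := rfl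
    rw [e] at this
    rw [this]; simp

lemma DD_zero_of_notMem {D : Set (EuclN N)} {φ : EuclN N → ℝ} (hs : tsupport φ ⊆ D)
    {x : EuclN N} (hx : x ∉ D) (a : EuclN N) : DD a φ x = 0 :=
  image_eq_zero_of_notMem_tsupport fun h => hx (hs (tsupport_DD φ a h))

lemma zero_of_notMem {D : Set (EuclN N)} {φ : EuclN N → ℝ} (hs : tsupport φ ⊆ D)
    {x : EuclN N} (hx : x ∉ D) : φ x = 0 :=
  image_eq_zero_of_notMem_tsupport fun h => hx (hs h)

lemma lap_continuous {Φ : EuclN N → ℝ} (h : ContDiff ℝ 2 Φ) : Continuous (lap Φ) := by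
  have : lap Φ = fun x => ∑ k, DD (bv k) (DD (bv k) Φ) x :=
    funext fun x => lap_eq h.contDiffAt
  rw [this]
  refine continuous_finsetSum _ fun k _ => ?_
  refine DD_continuous ?_ _
  rw [← contDiffOn_univ]
  exact DD_contDiffOn isOpen_univ (n := 1) (by simpa using h.contDiffOn) _

lemma lap_tsupport {Φ : EuclN N → ℝ} {D : Set (EuclN N)} (hs : tsupport Φ ⊆ D) {x : EuclN N}
    (hx : x ∉ D) : lap Φ x = 0 := by
  have : Φ =ᶠ[𝓝 x] fun _ => 0 := notMem_tsupport_iff_eventuallyEq.1 fun h => hx (hs h)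
  rw [lap_congr this]
  simp [lap]

end
end SC

namespace SC
open Topology Filter

noncomputable section

variable {N m : ℕ}

lemma quad_lin {b c : ℝ} (h : ∀ t : ℝ, 0 ≤ t * b + t ^ 2 * c) : b = 0 := by
  by_contra hb
  have h1 := h (-b / (|c| + 1))
  have hc : 0 < |c| + 1 := by positivity
  have e : -b / (|c| + 1) * b + (-b / (|c| + 1)) ^ 2 * c
      = b ^ 2 / (|c| + 1) ^ 2 * (c - |c| - 1) := by
    field_simp; ring
  rw [e] at h1
  have h2 : 0 < b ^ 2 / (|c| + 1) ^ 2 := by positivity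
  have h3 : c - |c| - 1 < 0 := by linarith [le_abs_self c]
  nlinarith [mul_neg_of_pos_of_neg h2 h3]

lemma QQ_perturb {D : Set (EuclN N)} (hD : IsOpen D) (hb : Bornology.IsBounded D)
    {c : Fin m → Fin m → EuclN N → ℝ} (hcm : ∀ i j, Measurable (c i j))
    {C : ℝ} (hC : ∀ i j x, |c i j x| ≤ C)
    {w h : Fin m → EuclN N → ℝ} (hw : ∀ i, Continuous (w i))
    (hw0 : ∀ i x, x ∉ D → w i x = 0)
    (hw2 : ∀ i, ContDiffOn ℝ 2 (w i) D)
    (hlap : ∀ i, ∀ x ∈ D, - lap (w i) x = h i x)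
    {Φ : Fin m → EuclN N → ℝ} (hΦ2 : ∀ i, ContDiff ℝ 2 (Φ i)) (hΦc : ∀ i, HasCompactSupport (Φ i))
    (hΦs : ∀ i, tsupport (Φ i) ⊆ D) (τ : ℝ)
    {φ ψ : ℝ → ℝ} (hφ : ContDiff ℝ 1 φ) (hψ : ContDiff ℝ 1 ψ)
    (hψφ : ∀ t, deriv ψ t = deriv φ t ^ 2) {ε : ℝ} (hε : 0 < ε) (hφ0 : ∀ t, t ≤ ε → φ t = 0)
    (hψ0 : ∀ t, t ≤ ε → ψ t = 0) :
    IsTestFun D (fun i x => φ (w i x) + τ * Φ i x) ∧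
    QQ c (fun i x => φ (w i x) + τ * Φ i x) =
      ∫ x, ((∑ i, (ψ (w i x) * h i x + 2 * τ * (φ (w i x) * (- lap (Φ i) x)) +
        τ ^ 2 * (Φ i x * (- lap (Φ i) x)))) -
        ∑ i, ∑ j, c i j x * (φ (w i x) + τ * Φ i x) * (φ (w j x) + τ * Φ j x)) := by
  have Tφ := fun i => comp_test hD hb (hw i) (hw0 i) (hw2 i) hφ hε hφ0
  have Tψ := fun i => comp_test hD hb (hw i) (hw0 i) (hw2 i) hψ hε hψ0
  have hΦ1 : ∀ i, ContDiff ℝ 1 (Φ i) := fun i => (hΦ2 i).of_le (by norm_num)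
  have hz : ∀ i x, x ∉ D → φ (w i x) + τ * Φ i x = 0 := by
    intro i x hx
    rw [hw0 i x hx, hφ0 0 hε.le, zero_of_notMem (hΦs i) hx]; simp
  have htest : IsTestFun D (fun i x => φ (w i x) + τ * Φ i x) := by
    intro i
    refine ⟨(Tφ i).1.add (contDiff_const.mul (hΦ1 i)), hcs_of_zero hb (hz i), ?_⟩
    refine (tsupport_add (fun x => φ (w i x)) (fun x => τ * Φ i x)).trans ?_
    refine union_subset (Tφ i).2.2.1 ?_
    exact (tsupport_mul_subset_right (f := fun _ => τ) (g := Φ i)).trans (hΦs i)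
  refine ⟨htest, ?_⟩
  have G1 := fun i => green hD (Tψ i).1 (Tψ i).2.1 (Tψ i).2.2.1 (hw2 i)
  have G2 := fun i => green hD (Tφ i).1 (Tφ i).2.1 (Tφ i).2.2.1 (hΦ2 i).contDiffOn
  have G3 := fun i => green hD (hΦ1 i) (hΦc i) (hΦs i) (hΦ2 i).contDiffOn
  have hDD : ∀ i a x, DD a (fun x => φ (w i x) + τ * Φ i x) x =
      DD a (fun x => φ (w i x)) x + τ * DD a (Φ i) x := by
    intro i a x
    have d1 : DifferentiableAt ℝ (fun x => φ (w i x)) x := (Tφ i).1.differentiable (by norm_num) x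
    have d2 : DifferentiableAt ℝ (Φ i) x := (hΦ1 i).differentiable (by norm_num) x
    unfold DD
    rw [fderiv_fun_add d1 (d2.const_mul τ), fderiv_const_mul d2]
    simp
  have hsq : ∀ i k x, DD (bv k) (fun x => φ (w i x)) x ^ 2 =
      DD (bv k) (fun x => ψ (w i x)) x * DD (bv k) (w i) x := by
    intro i k x
    by_cases hx : x ∈ D
    · rw [(Tφ i).2.2.2 x hx, (Tψ i).2.2.2 x hx, hψφ]; ring
    · rw [DD_zero_of_notMem (Tφ i).2.2.1 hx, DD_zero_of_notMem (Tψ i).2.2.1 hx]; ring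
  have hpt : ∀ x, (∑ i, ∑ k, DD (bv k) (fun x => φ (w i x) + τ * Φ i x) x ^ 2) =
      ∑ i, ((∑ k, DD (bv k) (fun x => ψ (w i x)) x * DD (bv k) (w i) x) +
        2 * τ * (∑ k, DD (bv k) (fun x => φ (w i x)) x * DD (bv k) (Φ i) x) +
        τ ^ 2 * ∑ k, DD (bv k) (Φ i) x * DD (bv k) (Φ i) x) := by
    intro x
    refine Finset.sum_congr rfl fun i _ => ?_
    rw [Finset.mul_sum, Finset.mul_sum, ← Finset.sum_add_distrib, ← Finset.sum_add_distrib]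
    refine Finset.sum_congr rfl fun k _ => ?_
    rw [hDD, ← hsq]; ring
  have hcI : Integrable (fun x =>
      ∑ i, ∑ j, c i j x * (φ (w i x) + τ * Φ i x) * (φ (w j x) + τ * Φ j x)) := by
    refine integrable_finsetSum _ fun i _ => integrable_finsetSum _ fun j _ => ?_
    have h1 : Integrable (fun x => (φ (w i x) + τ * Φ i x) * (φ (w j x) + τ * Φ j x)) :=
      ((htest i).1.continuous.mul (htest j).1.continuous).integrable_of_hasCompactSupport
        (htest i).2.1.mul_right
    have := h1.bdd_mul (c := C) (hcm i j).aestronglyMeasurable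
      (Eventually.of_forall fun x => by simpa using hC i j x)
    simpa only [mul_assoc] using this
  have hψh : ∀ i, (fun x => ψ (w i x) * h i x) = fun x => ψ (w i x) * (- lap (w i) x) := by
    intro i; ext x
    by_cases hx : x ∈ D
    · rw [hlap i x hx]
    · rw [hw0 i x hx, hψ0 0 hε.le]; simp
  have I1 : ∀ i, Integrable (fun x => ψ (w i x) * h i x) := fun i => by
    rw [hψh]; exact (G1 i).2.1
  unfold QQ
  rw [integral_sub _ hcI, integral_sub _ hcI]
  · congr 1
    simp only [hpt]
    rw [integral_finsetSum, integral_finsetSum]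
    · refine Finset.sum_congr rfl fun i _ => ?_
      rw [integral_add, integral_add, integral_add, integral_add, integral_const_mul,
        integral_const_mul, integral_const_mul, integral_const_mul, (G1 i).2.2, (G2 i).2.2,
        (G3 i).2.2, hψh]
      · exact I1 i
      · exact ((G2 i).2.1).const_mul _
      · exact (I1 i).add (((G2 i).2.1).const_mul _)
      · exact ((G3 i).2.1).const_mul _
      · exact (G1 i).1
      · exact ((G2 i).1).const_mul _
      · exact (G1 i).1.add (((G2 i).1).const_mul _)
      · exact ((G3 i).1).const_mul _
    · exact fun i _ => ((I1 i).add (((G2 i).2.1).const_mul _)).add (((G3 i).2.1).const_mul _)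
    · exact fun i _ => ((G1 i).1.add (((G2 i).1).const_mul _)).add (((G3 i).1).const_mul _)
  · exact integrable_finsetSum _ fun i _ =>
      ((I1 i).add (((G2 i).2.1).const_mul _)).add (((G3 i).2.1).const_mul _)
  · simp only [hpt]
    exact integrable_finsetSum _ fun i _ =>
      ((G1 i).1.add (((G2 i).1).const_mul _)).add (((G3 i).1).const_mul _)

theorem core {D : Set (EuclN N)} (hD : IsOpen D) (hb : Bornology.IsBounded D)
    {c : Fin m → Fin m → EuclN N → ℝ} (hcm : ∀ i j, Measurable (c i j))
    {C : ℝ} (hC : ∀ i j x, |c i j x| ≤ C)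
    (hQ : ∀ Ψ, IsTestFun D Ψ → 0 ≤ QQ c Ψ)
    {w h : Fin m → EuclN N → ℝ} (hw : ∀ i, Continuous (w i))
    (hw0 : ∀ i x, x ∉ D → w i x = 0)
    (hw2 : ∀ i, ContDiffOn ℝ 2 (w i) D) (hhm : ∀ i, Measurable (h i))
    {K : ℝ} (hK : ∀ i x, |h i x| ≤ K)
    (hlap : ∀ i, ∀ x ∈ D, - lap (w i) x = h i x)
    (hineq : ∀ x ∈ D, ∑ i, max (w i x) 0 * h i x ≤
      ∑ i, ∑ j, c i j x * max (w i x) 0 * max (w j x) 0)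
    {Φ : Fin m → EuclN N → ℝ} (hΦ2 : ∀ i, ContDiff ℝ 2 (Φ i)) (hΦc : ∀ i, HasCompactSupport (Φ i))
    (hΦs : ∀ i, tsupport (Φ i) ⊆ D) :
    ∫ x, ((∑ i, 2 * (max (w i x) 0 * (- lap (Φ i) x))) -
      ∑ i, ∑ j, c i j x * (max (w i x) 0 * Φ j x + Φ i x * max (w j x) 0)) = 0 := by
  have hεn : ∀ n : ℕ, (0:ℝ) < 1 / ((n:ℝ) + 1) := fun n => by positivity
  choose φ ψ p1 p2 p3 p4 p5 p6 p7 using fun n : ℕ => cutoff (hεn n)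
  have hlapc : ∀ i, Continuous (lap (Φ i)) := fun i => lap_continuous (hΦ2 i)
  have hlaps : ∀ i, HasCompactSupport (lap (Φ i)) := fun i =>
    hcs_of_zero hb fun x hx => lap_tsupport (hΦs i) hx
  have hε0 : Tendsto (fun n : ℕ => 2 * (1 / ((n:ℝ) + 1))) atTop (𝓝 0) := by
    simpa using (tendsto_one_div_add_atTop_nhds_zero_nat (𝕜 := ℝ)).const_mul 2
  have lim : ∀ {F : ℕ → ℝ → ℝ}, (∀ n t, |F n t - max t 0| ≤ 2 * (1 / ((n:ℝ) + 1))) → ∀ t,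
      Tendsto (fun n => F n t) atTop (𝓝 (max t 0)) := by
    intro F hF t
    rw [tendsto_iff_norm_sub_tendsto_zero]
    exact squeeze_zero (fun n => norm_nonneg _) (fun n => hF n t) hε0
  have ubF : ∀ {F : ℕ → ℝ → ℝ}, (∀ n t, |F n t - max t 0| ≤ 2 * (1 / ((n:ℝ) + 1))) → ∀ i,
      UB (fun n x => F n (w i x)) := by
    intro F hF i
    obtain ⟨M, hM⟩ := bdd_of_hcs (hw i) (hcs_of_zero hb (hw0 i))
    refine ⟨M + 2, fun n x => ?_⟩
    have h1 := hF n (w i x)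
    have h2 : 2 * (1 / ((n:ℝ) + 1)) ≤ 2 := by
      have : 1 / ((n:ℝ) + 1) ≤ 1 := by
        rw [div_le_one (by positivity)]; linarith [Nat.cast_nonneg (α := ℝ) n]
      linarith
    have h3 : |max (w i x) 0| ≤ M := by
      rw [abs_of_nonneg (le_max_right _ _)]
      exact max_le ((le_abs_self _).trans (hM x)) ((abs_nonneg _).trans (hM x))
    have h4 : F n (w i x) = (F n (w i x) - max (w i x) 0) + max (w i x) 0 := by ring
    change |F n (w i x)| ≤ M + 2
    rw [h4]
    exact (abs_add_le _ _).trans (by linarith)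
  have ubmax : ∀ i, UB (fun (_ : ℕ) x => max (w i x) 0) := fun i =>
    ubF (F := fun _ t => max t 0) (fun n t => by simp; positivity) i
  have ubh : ∀ i, UB (fun (_ : ℕ) x => h i x) := fun i => ⟨K, fun _ x => hK i x⟩
  have ubc : ∀ i j, UB (fun (_ : ℕ) x => c i j x) := fun i j => ⟨C, fun _ x => hC i j x⟩
  have ubΦ : ∀ i, UB (fun (_ : ℕ) x => Φ i x) := fun i =>
    UB.of_hcs (hΦ2 i).continuous (hΦc i)
  have ubl : ∀ i, UB (fun (_ : ℕ) x => - lap (Φ i) x) := fun i =>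
    (UB.of_hcs (hlapc i) (hlaps i)).neg
  have mw : ∀ i, Measurable (w i) := fun i => (hw i).measurable
  have mΦ : ∀ i, Measurable (Φ i) := fun i => (hΦ2 i).continuous.measurable
  have ml : ∀ i, Measurable (lap (Φ i)) := fun i => (hlapc i).measurable
  have mφ : ∀ n, Measurable (φ n) := fun n => (p1 n).continuous.measurable
  have mψ : ∀ n, Measurable (ψ n) := fun n => (p2 n).continuous.measurable
  have key : ∀ τ : ℝ, 0 ≤ ∫ x, ((∑ i, (max (w i x) 0 * h i x +
        2 * τ * (max (w i x) 0 * (- lap (Φ i) x)) +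
        τ ^ 2 * (Φ i x * (- lap (Φ i) x)))) -
        ∑ i, ∑ j, c i j x * (max (w i x) 0 + τ * Φ i x) * (max (w j x) 0 + τ * Φ j x)) := by
    intro τ
    have T := fun n => QQ_perturb hD hb hcm hC hw hw0 hw2 hlap hΦ2 hΦc hΦs τ
      (p1 n) (p2 n) (p3 n) (hεn n) (p4 n) (p5 n)
    have ub : UB (fun n x => ((∑ i, (ψ n (w i x) * h i x +
        2 * τ * (φ n (w i x) * (- lap (Φ i) x)) +
        τ ^ 2 * (Φ i x * (- lap (Φ i) x)))) -
        ∑ i, ∑ j, c i j x * (φ n (w i x) + τ * Φ i x) * (φ n (w j x) + τ * Φ j x))) := by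
      refine UB.sub (UB.sum fun i => ?_) (UB.sum fun i => UB.sum fun j => ?_)
      · exact (((ubF p7 i).mul (ubh i)).add ((UB.const _).mul ((ubF p6 i).mul (ubl i)))).add
          ((UB.const _).mul ((ubΦ i).mul (ubl i)))
      · exact ((ubc i j).mul ((ubF p6 i).add ((UB.const _).mul (ubΦ i)))).mul
          ((ubF p6 j).add ((UB.const _).mul (ubΦ j)))
    obtain ⟨L, hL⟩ := ub
    refine ge_of_tendsto' (tendsto_of_bdd hD hb ?_ hL ?_ ?_) (fun n => ?_)
    · intro n
      fun_prop
    · intro n x hx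
      have a1 : ∀ i, φ n (w i x) = 0 := fun i => by rw [hw0 i x hx]; exact p4 n 0 (hεn n).le
      have a2 : ∀ i, ψ n (w i x) = 0 := fun i => by rw [hw0 i x hx]; exact p5 n 0 (hεn n).le
      have a3 : ∀ i, Φ i x = 0 := fun i => zero_of_notMem (hΦs i) hx
      simp [a1, a2, a3]
    · intro x
      refine Tendsto.sub (tendsto_finsetSum _ fun i _ => ?_)
        (tendsto_finsetSum _ fun i _ => tendsto_finsetSum _ fun j _ => ?_)
      · exact (((lim p7 _).mul_const _).add (((lim p6 _).mul_const _).const_mul _)).add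
          tendsto_const_nhds
      · exact (((lim p6 _).add_const _).const_mul _).mul ((lim p6 _).add_const _)
    · rw [← (T n).2]
      exact hQ _ (T n).1
  have zM : ∀ x, x ∉ D → ∀ i, max (w i x) 0 = 0 := fun x hx i => by simp [hw0 i x hx]
  have zΦ : ∀ x, x ∉ D → ∀ i, Φ i x = 0 := fun x hx i => zero_of_notMem (hΦs i) hx
  set A : EuclN N → ℝ := fun x => (∑ i, max (w i x) 0 * h i x) -
      ∑ i, ∑ j, c i j x * max (w i x) 0 * max (w j x) 0 with hA
  set B : EuclN N → ℝ := fun x => (∑ i, 2 * (max (w i x) 0 * (- lap (Φ i) x))) -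
      ∑ i, ∑ j, c i j x * (max (w i x) 0 * Φ j x + Φ i x * max (w j x) 0) with hB
  set G : EuclN N → ℝ := fun x => (∑ i, Φ i x * (- lap (Φ i) x)) -
      ∑ i, ∑ j, c i j x * Φ i x * Φ j x with hG
  have iA : Integrable A := by
    have : UB (fun (_ : ℕ) x => A x) := by
      refine UB.sub (UB.sum fun i => ?_) (UB.sum fun i => UB.sum fun j => ?_)
      · exact (ubmax i).mul (ubh i)
      · exact ((ubc i j).mul (ubmax i)).mul (ubmax j)
    obtain ⟨L, hL⟩ := this
    refine integrable_of_bdd hb ?_ (hL 0) ?_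
    · fun_prop
    · intro x hx; simp [hA, zM x hx]
  have iB : Integrable B := by
    have : UB (fun (_ : ℕ) x => B x) := by
      refine UB.sub (UB.sum fun i => ?_) (UB.sum fun i => UB.sum fun j => ?_)
      · exact (UB.const _).mul ((ubmax i).mul (ubl i))
      · exact (ubc i j).mul (((ubmax i).mul (ubΦ j)).add ((ubΦ i).mul (ubmax j)))
    obtain ⟨L, hL⟩ := this
    refine integrable_of_bdd hb ?_ (hL 0) ?_
    · fun_prop
    · intro x hx; simp [hB, zM x hx]
  have iG : Integrable G := by
    have : UB (fun (_ : ℕ) x => G x) := by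
      refine UB.sub (UB.sum fun i => ?_) (UB.sum fun i => UB.sum fun j => ?_)
      · exact (ubΦ i).mul (ubl i)
      · exact ((ubc i j).mul (ubΦ i)).mul (ubΦ j)
    obtain ⟨L, hL⟩ := this
    refine integrable_of_bdd hb ?_ (hL 0) ?_
    · fun_prop
    · intro x hx; simp [hG, zΦ x hx]
  have hA0 : ∫ x, A x ≤ 0 := by
    apply integral_nonpos
    intro x
    by_cases hx : x ∈ D
    · simpa [hA] using hineq x hx
    · simp [hA, zM x hx]
  apply quad_lin (c := ∫ x, G x)
  intro τ
  have h1 := key τ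
  have h2 : ∀ x, ((∑ i, (max (w i x) 0 * h i x +
        2 * τ * (max (w i x) 0 * (- lap (Φ i) x)) +
        τ ^ 2 * (Φ i x * (- lap (Φ i) x)))) -
        ∑ i, ∑ j, c i j x * (max (w i x) 0 + τ * Φ i x) * (max (w j x) 0 + τ * Φ j x)) =
      A x + τ * B x + τ ^ 2 * G x := by
    intro x
    simp only [hA, hB, hG, mul_sub, Finset.mul_sum]
    rw [← sub_eq_zero]
    simp only [← Finset.sum_add_distrib, ← Finset.sum_sub_distrib]
    have : ∀ a b d p q r s u : ℝ, a - b + (d - p) + (q - r) - (s - u) = 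
      (a + d + q - s) - (b + p + r - u) := by intros; ring
    simp only [Finset.sum_add_distrib, Finset.sum_sub_distrib]
    have e1 : ∀ i j, c i j x * (max (w i x) 0 + τ * Φ i x) * (max (w j x) 0 + τ * Φ j x) =
        c i j x * max (w i x) 0 * max (w j x) 0 +
        τ * (c i j x * (max (w i x) 0 * Φ j x + Φ i x * max (w j x) 0)) +
        τ ^ 2 * (c i j x * Φ i x * Φ j x) := by intros; ring
    have e2 : ∀ i, 2 * τ * (max (w i x) 0 * -lap (Φ i) x) =
        τ * (2 * (max (w i x) 0 * -lap (Φ i) x)) := by intros; ring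
    simp only [e1, e2, Finset.sum_add_distrib]
    ring
  simp only [h2] at h1
  have iAB : Integrable (fun x => A x + τ * B x) := iA.add (iB.const_mul τ)
  rw [integral_add iAB (iG.const_mul _), integral_add iA (iB.const_mul τ), integral_const_mul, integral_const_mul] at h1
  linarith

end
end SC

namespace SC
open Topology Filter

noncomputable section

variable {N m : ℕ}

lemma posPow_hasDerivAt {n : ℕ} (hn : 1 ≤ n) (t : ℝ) :
    HasDerivAt (fun t : ℝ => max t 0 ^ (n + 1)) (((n:ℝ) + 1) * max t 0 ^ n) t := by
  rcases lt_trichotomy t 0 with h | h | h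
  · have e : (fun t : ℝ => max t 0 ^ (n + 1)) =ᶠ[𝓝 t] fun _ => 0 := by
      filter_upwards [gt_mem_nhds h] with s hs
      simp [max_eq_right hs.le]
    have h2 : ((n:ℝ) + 1) * max t 0 ^ n = 0 := by
      rw [max_eq_right h.le, zero_pow (by omega)]; simp
    rw [h2]
    exact (hasDerivAt_const t (0:ℝ)).congr_of_eventuallyEq e
  · subst h
    have h2 : ((n:ℝ) + 1) * max (0:ℝ) 0 ^ n = 0 := by
      rw [max_self, zero_pow (by omega)]; simp
    rw [h2]
    have : (fun t : ℝ => max t 0 ^ (n + 1)) =O[𝓝 0] fun x => ‖x - 0‖ ^ (n + 1) := by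
      refine Asymptotics.IsBigO.of_bound 1 (Eventually.of_forall fun x => ?_)
      rw [norm_pow, one_mul, norm_pow, norm_norm, sub_zero]
      refine pow_le_pow_left₀ (norm_nonneg _) ?_ _
      rw [Real.norm_of_nonneg (le_max_right _ _)]
      exact max_le (le_abs_self _) (abs_nonneg _)
    have h3 := this.hasFDerivAt (𝕜 := ℝ) (by omega)
    simpa using h3.hasDerivAt
  · have e : (fun t : ℝ => max t 0 ^ (n + 1)) =ᶠ[𝓝 t] fun t => t ^ (n + 1) := by
      filter_upwards [lt_mem_nhds h] with s hs
      simp [max_eq_left (le_of_lt hs)]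
    rw [max_eq_left h.le]
    have := (hasDerivAt_pow (n + 1) t).congr_of_eventuallyEq e
    simpa using this

lemma posPow_deriv {n : ℕ} (hn : 1 ≤ n) :
    deriv (fun t : ℝ => max t 0 ^ (n + 1)) = fun t => ((n:ℝ) + 1) * max t 0 ^ n :=
  funext fun t => (posPow_hasDerivAt hn t).deriv

lemma posPow_contDiff {n : ℕ} (hn : 1 ≤ n) : ContDiff ℝ 2 (fun t : ℝ => max t 0 ^ (n + 2)) := by
  have h1 : ContDiff ℝ 1 (fun t : ℝ => max t 0 ^ (n + 1)) := by
    rw [contDiff_one_iff_deriv, posPow_deriv hn]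
    exact ⟨fun t => (posPow_hasDerivAt hn t).differentiableAt, by fun_prop⟩
  have h2 : (2 : WithTop ℕ∞) = 1 + 1 := by norm_num
  rw [h2, contDiff_succ_iff_deriv]
  refine ⟨fun t => (posPow_hasDerivAt (n := n + 1) (by omega) t).differentiableAt, by simp, ?_⟩
  rw [posPow_deriv (n := n + 1) (by omega)]
  exact contDiff_const.mul h1

/-- bump -/
def bump (r : ℝ) (y : EuclN N) (n : ℕ) (x : EuclN N) : ℝ := max (r ^ 2 - ‖x - y‖ ^ 2) 0 ^ n

lemma s_hasFDerivAt (r : ℝ) (y x : EuclN N) : HasFDerivAt (fun x => r ^ 2 - ‖x - y‖ ^ 2)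
    (-(2 • (innerSL ℝ (x - y)))) x := by
  have h1 : HasFDerivAt (fun x : EuclN N => x - y) (ContinuousLinearMap.id ℝ _) x :=
    (hasFDerivAt_id x).sub_const y
  have h2 := h1.norm_sq
  have h3 := h2.const_sub (r ^ 2)
  simpa using h3

lemma DD_bump {n : ℕ} (hn : 1 ≤ n) (r : ℝ) (y : EuclN N) (a : EuclN N) :
    DD a (bump r y (n + 1)) = fun x => (((n:ℝ) + 1) * bump r y n x) * (-2 * ⟪x - y, a⟫) := by
  ext x
  have h := (posPow_hasDerivAt hn (r ^ 2 - ‖x - y‖ ^ 2)).comp_hasFDerivAt x (s_hasFDerivAt r y x)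
  have e : ((fun t : ℝ => max t 0 ^ (n + 1)) ∘ fun x : EuclN N => r ^ 2 - ‖x - y‖ ^ 2)
    = bump r y (n + 1) := rfl
  rw [e] at h
  unfold DD
  rw [h.fderiv]
  simp [bump, inner_sub_left]

lemma bump_contDiff {n : ℕ} (hn : 1 ≤ n) (r : ℝ) (y : EuclN N) :
    ContDiff ℝ 2 (bump r y (n + 2)) := by
  have : ContDiff ℝ 2 (fun x : EuclN N => r ^ 2 - ‖x - y‖ ^ 2) :=
    contDiff_const.sub ((contDiff_id.sub contDiff_const).norm_sq ℝ)
  exact (posPow_contDiff hn).comp this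

lemma bump_continuous (n : ℕ) (r : ℝ) (y : EuclN N) : Continuous (bump r y n) := by
  unfold bump; fun_prop

lemma lap_bump {n : ℕ} (hn : 1 ≤ n) (r : ℝ) (y x : EuclN N) :
    lap (bump r y (n + 2)) x = 4 * ((n:ℝ) + 2) * (n + 1) * bump r y n x * ‖x - y‖ ^ 2
      - 2 * N * (n + 2) * bump r y (n + 1) x := by
  rw [lap_eq (bump_contDiff hn r y).contDiffAt]
  have h1 : ∀ k : Fin N, DD (bv k) (DD (bv k) (bump r y (n + 2))) x =
      4 * ((n:ℝ) + 2) * (n + 1) * bump r y n x * ((x - y) k) ^ 2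
      - 2 * (n + 2) * bump r y (n + 1) x := by
    intro k
    rw [DD_bump (n := n + 1) (by omega)]
    have hd1 : HasFDerivAt (bump r y (n + 1)) (fderiv ℝ (bump r y (n + 1)) x) x := by
      refine DifferentiableAt.hasFDerivAt ?_
      exact ((posPow_hasDerivAt hn (r ^ 2 - ‖x - y‖ ^ 2)).comp_hasFDerivAt x
        (s_hasFDerivAt r y x)).differentiableAt
    have hd2 : HasFDerivAt (fun x : EuclN N => ⟪x - y, bv k⟫) (innerSL ℝ (bv k)) x := by
      have : (fun x : EuclN N => ⟪x - y, bv k⟫) = fun x => innerSL ℝ (bv k) x - ⟪y, bv k⟫ := by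
        ext z; rw [inner_sub_left, innerSL_apply_apply, real_inner_comm z]
      rw [this]
      exact (innerSL ℝ (bv k)).hasFDerivAt.sub_const _
    have h := (hd1.const_mul ((((n + 1 : ℕ) : ℝ)) + 1)).mul (hd2.const_mul (-2))
    have e2 : fderiv ℝ (bump r y (n + 1)) x (bv k) = DD (bv k) (bump r y (n + 1)) x := rfl
    have e3 : ⟪x - y, bv k⟫ = (x - y) k := by
      rw [EuclideanSpace.inner_single_right]; simp
    unfold DD
    erw [h.fderiv]
    simp only [_root_.add_apply, _root_.smul_apply, smul_eq_mul, e2,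
      DD_bump hn, e3, innerSL_apply_apply]
    have e4 : ⟪bv k, bv k⟫ = (1:ℝ) := by
      rw [EuclideanSpace.inner_single_right]; simp [bv]
    rw [e4]; push_cast; ring
  simp only [h1, Finset.sum_sub_distrib, ← Finset.mul_sum]
  rw [EuclideanSpace.norm_sq_eq (x - y)]
  simp
  ring

lemma ucp {D : Set (EuclN N)} {w : EuclN N → ℝ} (hw : Continuous w)
    (hw0 : ∀ x, 0 ≤ w x) {C : ℝ} (hC : 0 ≤ C)
    (hsup : ∀ φ : EuclN N → ℝ, ContDiff ℝ 2 φ → HasCompactSupport φ → tsupport φ ⊆ D →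
      (∀ x, 0 ≤ φ x) → 0 ≤ ∫ x, w x * (- lap φ x + C * φ x))
    {y : EuclN N} {δ r : ℝ} (hδ : 0 < δ) (hball : Metric.closedBall y r ⊆ D) (hr : 0 < r)
    (hz : ∀ x ∈ Metric.ball y δ, w x = 0) : ∀ x ∈ Metric.ball y r, w x = 0 := by
  obtain ⟨n, hn⟩ := exists_nat_ge (max 1 ((2 * N * r ^ 2 + C * r ^ 4 + 1) / (4 * δ ^ 2)))
  have hn1 : 1 ≤ n := by exact_mod_cast (le_max_left _ _).trans hn
  have hn2 : 2 * N * r ^ 2 + C * r ^ 4 + 1 ≤ 4 * n * δ ^ 2 := by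
    have := (le_max_right _ _).trans hn
    rw [div_le_iff₀ (by positivity)] at this
    linarith
  have hsupp : ∀ k : ℕ, 1 ≤ k → ∀ x, x ∉ Metric.closedBall y r → bump r y k x = 0 := by
    intro k hk x hx
    rw [Metric.mem_closedBall, dist_eq_norm, not_le] at hx
    unfold bump
    rw [max_eq_right (by nlinarith), zero_pow (by omega)]
  have hts : ∀ k : ℕ, 1 ≤ k → tsupport (bump r y k) ⊆ Metric.closedBall y r := by
    intro k hk
    refine closure_minimal ?_ Metric.isClosed_closedBall
    intro x hx
    by_contra h
    exact hx (hsupp k hk x h)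
  have hcs : ∀ k : ℕ, 1 ≤ k → HasCompactSupport (bump r y k) := fun k hk =>
    HasCompactSupport.of_support_subset_isCompact (isCompact_closedBall y r)
      (subset_closure.trans (hts k hk))
  have bnn : ∀ k x, 0 ≤ bump r y k x := fun k x => pow_nonneg (le_max_right _ _) _
  have h1 := hsup (bump r y (n + 2)) (bump_contDiff hn1 r y) (hcs _ (by omega))
    ((hts _ (by omega)).trans hball) (bnn _)
  have hpt : ∀ x, w x * (- lap (bump r y (n + 2)) x + C * bump r y (n + 2) x) ≤
      - (bump r y n x * w x) := by
    intro x
    by_cases hx : x ∈ Metric.ball y δ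
    · simp [hz x hx]
    rw [Metric.mem_ball, dist_eq_norm, not_lt] at hx
    rw [lap_bump hn1]
    set s := max (r ^ 2 - ‖x - y‖ ^ 2) 0 with hs
    have e0 : bump r y n x = s ^ n := rfl
    have e1 : bump r y (n + 1) x = s ^ n * s := by rw [← pow_succ]; rfl
    have e2 : bump r y (n + 2) x = s ^ n * s ^ 2 := by rw [← pow_add]; rfl
    rw [e0, e1, e2]
    have s0 : 0 ≤ s := le_max_right _ _
    have s1 : s ≤ r ^ 2 := max_le (by nlinarith [sq_nonneg ‖x - y‖]) (sq_nonneg _)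
    have hd : δ ^ 2 ≤ ‖x - y‖ ^ 2 := pow_le_pow_left₀ hδ.le hx 2
    have hs2 : s ^ 2 ≤ r ^ 4 := by nlinarith
    have hbr : -(4 * ((n:ℝ) + 2) * (n + 1) * ‖x - y‖ ^ 2) + 2 * N * (n + 2) * s + C * s ^ 2
        ≤ -1 := by
      have n0 : (0:ℝ) ≤ n := Nat.cast_nonneg n
      have N0 : (0:ℝ) ≤ N := Nat.cast_nonneg N
      have a1 : C * s ^ 2 ≤ C * r ^ 4 := mul_le_mul_of_nonneg_left hs2 hC
      have a2 : 2 * N * ((n:ℝ) + 2) * s ≤ 2 * N * ((n:ℝ) + 2) * r ^ 2 :=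
        mul_le_mul_of_nonneg_left s1 (by positivity)
      have a3 : 4 * ((n:ℝ) + 2) * (n + 1) * δ ^ 2 ≤ 4 * ((n:ℝ) + 2) * (n + 1) * ‖x - y‖ ^ 2 :=
        mul_le_mul_of_nonneg_left hd (by positivity)
      have a4 : ((n:ℝ) + 2) * (2 * N * r ^ 2 + C * r ^ 4 + 1) ≤ (n + 2) * (4 * n * δ ^ 2) :=
        mul_le_mul_of_nonneg_left hn2 (by positivity)
      have a5 : 0 ≤ (n:ℝ) * (C * r ^ 4) := by positivity
      have a6 : 0 ≤ C * r ^ 4 := by positivity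
      have a7 : 0 ≤ ((n:ℝ) + 2) * δ ^ 2 := by positivity
      nlinarith
    have hsw : 0 ≤ s ^ n * w x := mul_nonneg (pow_nonneg s0 n) (hw0 x)
    calc _ = (s ^ n * w x) * (-(4 * ((n:ℝ) + 2) * (n + 1) * ‖x - y‖ ^ 2) +
          2 * N * (n + 2) * s + C * s ^ 2) := by ring
      _ ≤ (s ^ n * w x) * (-1) := mul_le_mul_of_nonneg_left hbr hsw
      _ = _ := by ring
  have cb : Continuous (fun x => bump r y n x * w x) := (bump_continuous n r y).mul hw
  have sb : HasCompactSupport (fun x => bump r y n x * w x) := (hcs n hn1).mul_right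
  have ib : Integrable (fun x => bump r y n x * w x) := cb.integrable_of_hasCompactSupport sb
  have il : Integrable (fun x => w x * (- lap (bump r y (n + 2)) x + C * bump r y (n + 2) x)) := by
    refine Continuous.integrable_of_hasCompactSupport ?_ ?_
    · exact hw.mul ((lap_continuous (bump_contDiff hn1 r y)).neg.add
        (continuous_const.mul (bump_continuous _ r y)))
    · refine HasCompactSupport.of_support_subset_isCompact (isCompact_closedBall y r) ?_
      intro x hx
      by_contra h
      apply hx
      simp [lap_tsupport (hts (n + 2) (by omega)) h, hsupp (n + 2) (by omega) x h]
  have h2 : _ ≤ ∫ x, -(bump r y n x * w x) := integral_mono il ib.neg hpt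
  rw [integral_neg] at h2
  have h3 : ∫ x, bump r y n x * w x = 0 := by
    have := integral_nonneg (μ := volume) (f := fun x => bump r y n x * w x)
      (fun x => mul_nonneg (bnn n x) (hw0 x))
    linarith
  have h4 : (fun x => bump r y n x * w x) = fun _ => 0 := by
    rw [integral_eq_zero_iff_of_nonneg (fun x => mul_nonneg (bnn n x) (hw0 x)) ib] at h3
    exact (cb.ae_eq_iff_eq volume continuous_const).1 h3
  intro x hx
  rw [Metric.mem_ball, dist_eq_norm] at hx
  have h5 := congrFun h4 x
  rcases mul_eq_zero.1 h5 with h | h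
  · exfalso
    have : 0 < bump r y n x := pow_pos (lt_max_of_lt_left (by nlinarith [norm_nonneg (x - y)])) n
    linarith
  · exact h

/-- dichotomy on a connected set -/
lemma ucp_conn {D : Set (EuclN N)} (hD : IsOpen D) (hconn : IsPreconnected D)
    {w : EuclN N → ℝ} (hw : Continuous w)
    (hw0 : ∀ x, 0 ≤ w x) {C : ℝ} (hC : 0 ≤ C)
    (hsup : ∀ φ : EuclN N → ℝ, ContDiff ℝ 2 φ → HasCompactSupport φ → tsupport φ ⊆ D →
      (∀ x, 0 ≤ φ x) → 0 ≤ ∫ x, w x * (- lap φ x + C * φ x)) :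
    (∀ x ∈ D, w x = 0) ∨ ∀ O : Set (EuclN N), IsOpen O → O ⊆ D → O.Nonempty →
      ∃ x ∈ O, w x ≠ 0 := by
  by_cases hcase : ∀ O : Set (EuclN N), IsOpen O → O ⊆ D → O.Nonempty → ∃ x ∈ O, w x ≠ 0
  · exact Or.inr hcase
  left
  push Not at hcase
  obtain ⟨O, hO, hOD, ⟨x0, hx0⟩, hOz⟩ := hcase
  set G := interior {x | w x = 0} with hG
  have hsub : D ⊆ G := by
    refine hconn.subset_of_closure_inter_subset isOpen_interior ⟨x0, hOD hx0, ?_⟩ ?_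
    · exact mem_interior.2 ⟨O, hOz, hO, hx0⟩
    · rintro x ⟨hxG, hxD⟩
      obtain ⟨ρ, hρ, hρD⟩ := Metric.isOpen_iff.1 hD x hxD
      obtain ⟨y, hyG, hxy⟩ := Metric.mem_closure_iff.1 hxG (ρ / 4) (by positivity)
      obtain ⟨δ, hδ, hδG⟩ := Metric.isOpen_iff.1 isOpen_interior y hyG
      have := ucp hw hw0 hC hsup hδ (y := y) (r := ρ / 2) (by
        intro z hz
        apply hρD
        rw [Metric.mem_closedBall] at hz
        rw [Metric.mem_ball]
        have := dist_triangle z y x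
        rw [dist_comm y x] at this
        linarith) (by positivity) (fun z hz => (interior_subset (hδG hz) : z ∈ {x | w x = 0}))
      refine mem_interior.2 ⟨Metric.ball y (ρ / 2), this, Metric.isOpen_ball, ?_⟩
      rw [Metric.mem_ball]; linarith
  exact fun x hx => (interior_subset (hsub hx) : x ∈ {x | w x = 0})

end
end SC

namespace SC
open Topology Filter

noncomputable section

variable {N m : ℕ}

lemma core_single {D : Set (EuclN N)} 
    {c : Fin m → Fin m → EuclN N → ℝ} {W : Fin m → EuclN N → ℝ}
    (hcore : ∀ Φ : Fin m → EuclN N → ℝ, (∀ i, ContDiff ℝ 2 (Φ i)) →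
      (∀ i, HasCompactSupport (Φ i)) → (∀ i, tsupport (Φ i) ⊆ D) →
      ∫ x, ((∑ i, 2 * (W i x * (- lap (Φ i) x))) -
        ∑ i, ∑ j, c i j x * (W i x * Φ j x + Φ i x * W j x)) = 0)
    (i : Fin m) {φ : EuclN N → ℝ} (h2 : ContDiff ℝ 2 φ) (hc : HasCompactSupport φ)
    (hs : tsupport φ ⊆ D) :
    ∫ x, (2 * (W i x * (- lap φ x)) - (∑ j, (c i j x + c j i x) * W j x) * φ x) = 0 := by
  have h := hcore (fun j => if j = i then φ else fun _ => 0) ?_ ?_ ?_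
  · rw [← h]
    congr 1
    ext x
    congr 1
    · rw [Finset.sum_eq_single i]
      · simp
      · intro j _ hj
        have : lap (fun _ : EuclN N => (0:ℝ)) x = 0 := by simp [lap]
        simp [hj, this]
      · simp
    · have e1 : ∀ j, (if j = i then φ else fun _ => 0) x = if j = i then φ x else 0 := by
        intro j; split_ifs <;> rfl
      simp only [e1, mul_add, Finset.sum_add_distrib]
      simp [add_mul, Finset.sum_add_distrib, Finset.sum_mul]
      rw [add_comm]
      congr 1
      · refine Finset.sum_congr rfl fun j _ => by ring
      · refine Finset.sum_congr rfl fun j _ => by ring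
  · intro j; split_ifs
    · exact h2
    · exact contDiff_const
  · intro j; split_ifs
    · exact hc
    · exact HasCompactSupport.zero
  · intro j; split_ifs
    · exact hs
    · intro x hx
      have : tsupport (fun _ : EuclN N => (0:ℝ)) = ∅ := tsupport_eq_empty_iff.2 rfl
      rw [this] at hx; exact hx.elim

lemma dichotomy {D : Set (EuclN N)} (hD : IsOpen D) (hb : Bornology.IsBounded D)
    (hconn : IsPreconnected D)
    {c : Fin m → Fin m → EuclN N → ℝ} (hcm : ∀ i j, Measurable (c i j))
    {C : ℝ} (hC : ∀ i j x, |c i j x| ≤ C) (hcc : ∀ i j, ContinuousOn (c i j) D)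
    (hoff : ∀ i j, i ≠ j → ∀ x ∈ D, 0 ≤ c i j x)
    (hfull : ∀ I J : Finset (Fin m), I.Nonempty → J.Nonempty → Disjoint I J →
      I ∪ J = Finset.univ → ∃ i₀ ∈ I, ∃ j₀ ∈ J, ∃ x ∈ D, 0 < c i₀ j₀ x)
    {W : Fin m → EuclN N → ℝ} (hW : ∀ i, Continuous (W i)) (hWn : ∀ i x, 0 ≤ W i x)
    (hW0 : ∀ i x, x ∉ D → W i x = 0)
    (hcore : ∀ i, ∀ φ : EuclN N → ℝ, ContDiff ℝ 2 φ → HasCompactSupport φ → tsupport φ ⊆ D →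
      ∫ x, (2 * (W i x * (- lap φ x)) - (∑ j, (c i j x + c j i x) * W j x) * φ x) = 0) :
    (∀ i, ∀ x ∈ D, W i x = 0) ∨ ∀ i, ∀ O : Set (EuclN N), IsOpen O → O ⊆ D → O.Nonempty →
      ∃ x ∈ O, W i x ≠ 0 := by
  rcases isEmpty_or_nonempty (Fin m) with hem | ⟨⟨i00⟩⟩
  · exact Or.inl fun i => (hem.false i).elim
  have hC0 : 0 ≤ C := (abs_nonneg _).trans (hC i00 i00 0)
  have iW : ∀ i, ∀ φ : EuclN N → ℝ, ContDiff ℝ 2 φ → 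
      HasCompactSupport φ → tsupport φ ⊆ D → Integrable (fun x => W i x * (- lap φ x)) := by
    intro i φ h2 hc hs
    refine Continuous.integrable_of_hasCompactSupport ((hW i).mul (lap_continuous h2).neg) ?_
    refine hcs_of_zero hb fun x hx => ?_
    rw [hW0 i x hx, zero_mul]
  have iS : ∀ i, ∀ φ : EuclN N → ℝ, ContDiff ℝ 2 φ → HasCompactSupport φ → tsupport φ ⊆ D →
      Integrable (fun x => (∑ j, (c i j x + c j i x) * W j x) * φ x) := by
    intro i φ h2 hc hs
    have hu : UB (fun (_ : Unit) x => (∑ j, (c i j x + c j i x) * W j x) * φ x) := by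
      refine UB.mul (UB.sum fun j => UB.mul (UB.add ⟨C, fun _ x => hC i j x⟩ ⟨C, fun _ x => hC j i x⟩)
        (UB.of_hcs (hW j) (hcs_of_zero hb (hW0 j)))) (UB.of_hcs h2.continuous hc)
    obtain ⟨K, hK⟩ := hu
    refine integrable_of_bdd hb ?_ (hK ()) (fun x hx => by rw [zero_of_notMem hs hx, mul_zero])
    have := fun j => (hW j).measurable
    have := h2.continuous.measurable
    fun_prop
  have hd : ∀ i, (∀ x ∈ D, W i x = 0) ∨ ∀ O : Set (EuclN N), IsOpen O → O ⊆ D → O.Nonempty →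
      ∃ x ∈ O, W i x ≠ 0 := by
    intro i
    refine ucp_conn hD hconn (hW i) (hWn i) hC0 ?_
    intro φ h2 hc hs hn
    have h := hcore i φ h2 hc hs
    have i1 := iW i φ h2 hc hs
    have i2 := iS i φ h2 hc hs
    have i3 : Integrable (fun x => W i x * (C * φ x)) :=
      Continuous.integrable_of_hasCompactSupport ((hW i).mul (continuous_const.mul h2.continuous))
        (hcs_of_zero hb fun x hx => by rw [hW0 i x hx, zero_mul])
    rw [integral_sub (i1.const_mul 2) i2, integral_const_mul] at h
    have e : ∫ x, W i x * (- lap φ x + C * φ x) =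
      (∫ x, W i x * (- lap φ x)) + ∫ x, W i x * (C * φ x) := by
      rw [← integral_add i1 i3]; congr 1; ext x; ring
    have hn2 : 0 ≤ (∫ x, (∑ j, (c i j x + c j i x) * W j x) * φ x)
        + 2 * ∫ x, W i x * (C * φ x) := by
      rw [← integral_const_mul, ← integral_add i2 (i3.const_mul 2)]
      refine integral_nonneg fun x => ?_
      by_cases hx : x ∈ D
      · have e1 : (∑ j, (c i j x + c j i x) * W j x) * φ x + 2 * (W i x * (C * φ x)) =
          (2 * (c i i x + C) * W i x +
            ∑ j ∈ Finset.univ.erase i, (c i j x + c j i x) * W j x) * φ x := by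
          rw [← Finset.add_sum_erase _ _ (Finset.mem_univ i)]; ring
        show 0 ≤ (∑ j, (c i j x + c j i x) * W j x) * φ x + 2 * (W i x * (C * φ x))
        rw [e1]
        refine mul_nonneg (add_nonneg (mul_nonneg ?_ (hWn i x)) ?_) (hn x)
        · have := (abs_le.1 (hC i i x)).1; linarith
        · refine Finset.sum_nonneg fun j hj => mul_nonneg ?_ (hWn j x)
          have hji := Finset.ne_of_mem_erase hj
          exact add_nonneg (hoff i j hji.symm x hx) (hoff j i hji x hx)
      · show 0 ≤ (∑ j, (c i j x + c j i x) * W j x) * φ x + 2 * (W i x * (C * φ x))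
        rw [zero_of_notMem hs hx]; simp
    linarith
  classical
  by_cases hI : ∃ i, ∀ x ∈ D, W i x = 0
  swap
  · right; intro i
    exact (hd i).resolve_left fun h => hI ⟨i, h⟩
  left
  by_contra hJ
  push Not at hJ
  obtain ⟨j1, x1, hx1, hj1⟩ := hJ
  obtain ⟨i1, hi1⟩ := hI
  obtain ⟨i0, hi0, j0, hj0, z, hz, hcz⟩ := hfull (Finset.univ.filter fun i => ∀ x ∈ D, W i x = 0)
    (Finset.univ.filter fun i => ¬ ∀ x ∈ D, W i x = 0) ⟨i1, by simpa using hi1⟩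
    ⟨j1, by simp only [Finset.mem_filter, Finset.mem_univ, true_and]; exact fun h => hj1 (h x1 hx1)⟩
    (Finset.disjoint_filter_filter_not _ _ _) (Finset.filter_union_filter_not_eq _ _)
  simp only [Finset.mem_filter, Finset.mem_univ, true_and] at hi0 hj0
  have hO : IsOpen (D ∩ c i0 j0 ⁻¹' Ioi 0) := (hcc i0 j0).isOpen_inter_preimage hD isOpen_Ioi
  obtain ⟨y, hy, hyW⟩ := (hd j0).resolve_left hj0 _ hO inter_subset_left ⟨z, hz, hcz⟩
  have hO2 : IsOpen ((D ∩ c i0 j0 ⁻¹' Ioi 0) ∩ W j0 ⁻¹' Ioi 0) :=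
    hO.inter (isOpen_Ioi.preimage (hW j0))
  obtain ⟨ρ, hρ, hρs⟩ := Metric.isOpen_iff.1 hO2 y ⟨hy, lt_of_le_of_ne (hWn _ _) hyW.symm⟩
  have hsub : Metric.closedBall y (ρ / 2) ⊆ D := fun x hx =>
    (hρs (Metric.closedBall_subset_ball (by linarith) hx)).1.1
  have hne : i0 ≠ j0 := by rintro rfl; exact hj0 hi0
  have hts : tsupport (bump (ρ/2) y 3) ⊆ Metric.closedBall y (ρ/2) := by
    refine closure_minimal ?_ Metric.isClosed_closedBall
    intro x hx
    by_contra h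
    apply hx
    rw [Metric.mem_closedBall, dist_eq_norm, not_le] at h
    unfold bump
    rw [max_eq_right (by nlinarith), zero_pow (by omega)]
  have hbc : HasCompactSupport (bump (ρ/2) y 3) :=
    HasCompactSupport.of_support_subset_isCompact (isCompact_closedBall y (ρ/2))
      (subset_closure.trans hts)
  have b2 : ContDiff ℝ 2 (bump (ρ/2) y 3) := bump_contDiff (n := 1) le_rfl _ _
  have h := hcore i0 _ b2 hbc (hts.trans hsub)
  have j2 := iS i0 _ b2 hbc (hts.trans hsub)
  rw [integral_sub ((iW i0 _ b2 hbc (hts.trans hsub)).const_mul 2) j2] at h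
  have e0 : ∀ x, W i0 x = 0 := fun x => by
    by_cases hx : x ∈ D
    · exact hi0 x hx
    · exact hW0 _ _ hx
  simp only [e0, zero_mul, mul_zero, integral_zero, zero_sub, neg_eq_zero] at h
  have hnn : ∀ x, 0 ≤ (∑ j, (c i0 j x + c j i0 x) * W j x) * bump (ρ/2) y 3 x := by
    intro x
    by_cases hx : x ∈ D
    · refine mul_nonneg (Finset.sum_nonneg fun j _ => ?_) (pow_nonneg (le_max_right _ _) _)
      by_cases hj : j = i0
      · rw [hj, e0, mul_zero]
      · exact mul_nonneg (add_nonneg (hoff _ _ (Ne.symm hj) x hx) (hoff _ _ hj x hx)) (hWn _ _)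
    · rw [zero_of_notMem (hts.trans hsub) hx, mul_zero]
  rw [integral_eq_zero_iff_of_nonneg hnn j2] at h
  have hpos : 0 < volume (Metric.ball y (ρ/2)) := Metric.measure_ball_pos _ _ (by positivity)
  have : Metric.ball y (ρ/2) ⊆ {x | ¬ ((∑ j, (c i0 j x + c j i0 x) * W j x) * bump (ρ/2) y 3 x = 0)} := by
    intro x hx
    have hx' := hρs (Metric.ball_subset_ball (by linarith) hx)
    refine (mul_pos (Finset.sum_pos' (fun j _ => ?_) ⟨j0, Finset.mem_univ _, ?_⟩) ?_).ne'
    · by_cases hj : j = i0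
      · rw [hj, e0, mul_zero]
      · exact mul_nonneg (add_nonneg (hoff _ _ (Ne.symm hj) x hx'.1.1)
          (hoff _ _ hj x hx'.1.1)) (hWn _ _)
    · exact mul_pos (add_pos_of_pos_of_nonneg hx'.1.2 (hoff _ _ hne.symm x hx'.1.1)) hx'.2
    · rw [Metric.mem_ball, dist_eq_norm] at hx
      exact pow_pos (lt_max_of_lt_left (by nlinarith [norm_nonneg (x - y)])) _
  have h3 : volume {x | ¬ ((∑ j, (c i0 j x + c j i0 x) * W j x) * bump (ρ/2) y 3 x = 0)} = 0 := h
  exact (hpos.trans_le (measure_mono this)).ne' h3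

end
end SC

namespace SC
open Topology Filter

noncomputable section

variable {N m : ℕ}

lemma dom_form {Ω : Set (EuclN N)} (hΩ : IsBallOrAnnulus Ω) : ∃ a R : ℝ,
    Ω = {x : EuclN N | a < ‖x‖ ∧ ‖x‖ < R} ∧ (a = -1 ∨ 0 < a) ∧ max a 0 < R := by
  rcases hΩ with ⟨R, hR, h⟩ | ⟨r, R, hr, hR, h⟩
  · refine ⟨-1, R, ?_, Or.inl rfl, by simpa using hR⟩
    rw [h]; ext x
    simp only [mem_ball_zero_iff, mem_ofPred_eq]
    exact ⟨fun h => ⟨by linarith [norm_nonneg x], h⟩, fun h => h.2⟩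
  · exact ⟨r, R, h, Or.inr hr, by rw [max_eq_left hr.le]; exact hR⟩

lemma dom_open {Ω : Set (EuclN N)} (hΩ : IsBallOrAnnulus Ω) : IsOpen Ω := by
  obtain ⟨a, R, h, -⟩ := dom_form hΩ
  rw [h]
  exact (isOpen_lt continuous_const continuous_norm).inter (isOpen_lt continuous_norm continuous_const)

lemma dom_bdd {Ω : Set (EuclN N)} (hΩ : IsBallOrAnnulus Ω) : Bornology.IsBounded Ω := by
  obtain ⟨a, R, h, -⟩ := dom_form hΩ
  refine Metric.isBounded_ball (x := (0 : EuclN N)) (r := R) |>.subset ?_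
  rw [h]; intro x hx; simpa using hx.2

lemma dom_norm {Ω : Set (EuclN N)} (hΩ : IsBallOrAnnulus Ω) {x y : EuclN N} (h : ‖x‖ = ‖y‖)
    (hx : x ∈ Ω) : y ∈ Ω := by
  obtain ⟨a, R, h1, -⟩ := dom_form hΩ
  rw [h1] at hx ⊢
  simpa [← h] using hx

lemma dom_iso {Ω : Set (EuclN N)} (hΩ : IsBallOrAnnulus Ω) (L : EuclN N ≃ₗᵢ[ℝ] EuclN N) :
    L '' Ω = Ω := by
  ext x; constructor
  · rintro ⟨y, hy, rfl⟩; exact dom_norm hΩ (L.norm_map y).symm hy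
  · intro hx; exact ⟨L.symm x, dom_norm hΩ (L.symm.norm_map x).symm hx, by simp⟩

/-- reflection in the hyperplane orthogonal to `e` -/
def refl (e : EuclN N) : EuclN N ≃ₗᵢ[ℝ] EuclN N := (ℝ ∙ e)ᗮ.reflection

lemma refl_apply {e : EuclN N} (he : ‖e‖ = 1) (x : EuclN N) :
    refl e x = x - (2 * ⟪x, e⟫) • e := by
  unfold refl
  rw [Submodule.reflection_orthogonal_apply, Submodule.reflection_singleton_apply, he, real_inner_comm]
  simp [mul_smul, two_smul]

lemma refl_refl (e x : EuclN N) : refl e (refl e x) = x := Submodule.reflection_reflection _ _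

lemma refl_inner {e : EuclN N} (he : ‖e‖ = 1) (x : EuclN N) : ⟪refl e x, e⟫ = -⟪x, e⟫ := by
  rw [refl_apply he, inner_sub_left, real_inner_smul_left, real_inner_self_eq_norm_sq, he]; ring

lemma refl_sub {x y : EuclN N} (h : ‖x‖ = ‖y‖) : refl (x - y) x = y :=
  Submodule.reflection_sub h

lemma refl_smul (e : EuclN N) {t : ℝ} (ht : t ≠ 0) : refl (t • e) = refl e := by
  unfold refl
  have : (ℝ ∙ (t • e)) = (ℝ ∙ e) := Submodule.span_singleton_smul_eq (IsUnit.mk0 t ht) e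
  ext x : 1
  simp only [this]

lemma frontier_norm {Ω : Set (EuclN N)} (hΩ : IsBallOrAnnulus Ω) {x y : EuclN N} (h : ‖x‖ = ‖y‖)
    (hx : x ∈ frontier Ω) : y ∈ frontier Ω := by
  have h1 := (refl (x - y)).toHomeomorph.image_frontier Ω
  have h2 : (refl (x - y)).toHomeomorph '' Ω = Ω := dom_iso hΩ _
  rw [h2] at h1
  rw [← h1]
  exact ⟨x, hx, refl_sub h⟩

lemma half_open {Ω : Set (EuclN N)} (hΩ : IsBallOrAnnulus Ω) (e : EuclN N) :
    IsOpen (halfDom Ω e) := by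
  have h : IsOpen {x : EuclN N | 0 < ⟪x, e⟫} := isOpen_lt continuous_const (by fun_prop)
  exact (dom_open hΩ).inter h

lemma half_sub (Ω : Set (EuclN N)) (e : EuclN N) : halfDom Ω e ⊆ Ω := fun _ h => h.1

lemma half_conn {Ω : Set (EuclN N)} (hΩ : IsBallOrAnnulus Ω) (e : EuclN N) :
    IsPreconnected (halfDom Ω e) := by
  obtain ⟨a, R, h1, ha, hR⟩ := dom_form hΩ
  have e1 : halfDom Ω e = (fun q : ℝ × EuclN N => (q.1 / ‖q.2‖) • q.2) ''
      (Ioo (max a 0) R ×ˢ {v | 0 < ⟪v, e⟫}) := by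
    ext x; constructor
    · rintro ⟨hx, hxe⟩
      have hx0 : x ≠ 0 := by rintro rfl; simp at hxe
      have hn : 0 < ‖x‖ := norm_pos_iff.2 hx0
      rw [h1] at hx
      refine ⟨(‖x‖, x), ⟨⟨max_lt hx.1 hn, hx.2⟩, hxe⟩, ?_⟩
      simp [div_self hn.ne']
    · rintro ⟨⟨ρ, v⟩, ⟨⟨h2, h3⟩, hv⟩, rfl⟩
      simp only [mem_ofPred_eq] at hv h2 h3
      have hv0 : v ≠ 0 := by rintro rfl; simp at hv
      have hn : 0 < ‖v‖ := norm_pos_iff.2 hv0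
      have hρ : 0 < ρ := (le_max_right _ _).trans_lt h2
      have hnn : ‖(ρ / ‖v‖) • v‖ = ρ := by
        rw [norm_smul, Real.norm_of_nonneg (by positivity)]; field_simp
      refine ⟨?_, ?_⟩
      · rw [h1]; simp only [mem_ofPred_eq]; rw [hnn]; exact ⟨(le_max_left _ _).trans_lt h2, h3⟩
      · show 0 < ⟪(ρ / ‖v‖) • v, e⟫
        rw [real_inner_smul_left]; positivity
  rw [e1]
  refine IsPreconnected.image ?_ _ ?_
  · refine (Convex.prod (convex_Ioo _ _) ?_).isPreconnected
    intro u hu v hv s t hs ht hst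
    simp only [mem_ofPred_eq] at *
    rw [inner_add_left, real_inner_smul_left, real_inner_smul_left]
    rcases hs.eq_or_lt with rfl | hs'
    · have : t = 1 := by linarith
      subst this; simpa using hv
    · have := mul_pos hs' hu
      have := mul_nonneg ht hv.le
      linarith
  · refine ContinuousOn.smul (ContinuousOn.div continuousOn_fst ?_ ?_) continuousOn_snd
    · exact continuousOn_snd.norm
    · rintro ⟨ρ, v⟩ ⟨-, hv⟩
      have hv0 : v ≠ 0 := by rintro rfl; simp at hv
      simpa using hv0

/-- hypotheses -/
structure St (Ω : Set (EuclN N)) (f : Fin m → ℝ → (Fin m → ℝ) → ℝ)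
    (U : Fin m → EuclN N → ℝ) : Prop where
  hΩ : IsBallOrAnnulus Ω
  hf : ∀ i, ContDiff ℝ 1 (fun q : ℝ × (Fin m → ℝ) => f i q.1 q.2)
  hU : ∀ i, ContDiffOn ℝ 3 (U i) (closure Ω)
  hsol : IsSolution Ω f U
  hcoup : ∀ e : EuclN N, ‖e‖ = 1 → FullyCoupledAlong f U (halfDom Ω e)
  hmono : ∀ i j (r : ℝ) (s t : Fin m → ℝ), (∀ k, s k ≤ t k) →
      pd (f i) j r s ≤ pd (f i) j r t
  hM : ¬ NegDefFamily f U Ω 2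

lemma pd_eq {g : ℝ → (Fin m → ℝ) → ℝ} (hg : ContDiff ℝ 1 (fun q : ℝ × (Fin m → ℝ) => g q.1 q.2))
    (j : Fin m) (r : ℝ) (s : Fin m → ℝ) : pd g j r s =
    fderiv ℝ (fun q : ℝ × (Fin m → ℝ) => g q.1 q.2) (r, s) (0, Pi.single j 1) := by
  have h1 : HasFDerivAt (fun q : ℝ × (Fin m → ℝ) => g q.1 q.2) _ (r, s) :=
    (hg.differentiable (by norm_num) (r, s)).hasFDerivAt
  have h2 := h1.comp s (hasFDerivAt_prodMk_right (𝕜 := ℝ) r s)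
  unfold pd
  have e : (fun q : ℝ × (Fin m → ℝ) => g q.1 q.2) ∘ (fun s => (r, s)) = g r := rfl
  rw [e] at h2
  rw [h2.fderiv]
  simp

lemma pd_cont {g : ℝ → (Fin m → ℝ) → ℝ} (hg : ContDiff ℝ 1 (fun q : ℝ × (Fin m → ℝ) => g q.1 q.2))
    (j : Fin m) : Continuous (fun q : ℝ × (Fin m → ℝ) => pd g j q.1 q.2) := by
  simp only [pd_eq hg]
  exact (hg.continuous_fderiv (by norm_num)).clm_apply continuous_const

section
variable {Ω : Set (EuclN N)} {f : Fin m → ℝ → (Fin m → ℝ) → ℝ} {U : Fin m → EuclN N → ℝ}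

/-- coefficients -/
def cc (Ω : Set (EuclN N)) (f : Fin m → ℝ → (Fin m → ℝ) → ℝ) (U : Fin m → EuclN N → ℝ)
    (i j : Fin m) : EuclN N → ℝ := Ω.indicator (fun x => pd (f i) j ‖x‖ (fun k => U k x))

lemma cc_apply {x : EuclN N} (hx : x ∈ Ω) (i j : Fin m) :
    cc Ω f U i j x = pd (f i) j ‖x‖ (fun k => U k x) := indicator_of_mem hx _

lemma St.U_cont (S : St Ω f U) (i : Fin m) : ContinuousOn (U i) (closure Ω) := (S.hU i).continuousOn

/-- zero extension -/
def UU (Ω : Set (EuclN N)) (U : Fin m → EuclN N → ℝ) (i : Fin m) : EuclN N → ℝ := Ω.indicator (U i)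

lemma St.UU_cont (S : St Ω f U) (i : Fin m) : Continuous (UU Ω U i) :=
  continuous_indicator (S.hsol.2 i) (S.U_cont i)

lemma St.comp_cont (S : St Ω f U) {g : ℝ × (Fin m → ℝ) → ℝ} (hg : Continuous g) :
    ContinuousOn (fun x => g (‖x‖, fun k => U k x)) (closure Ω) := by
  refine hg.comp_continuousOn (ContinuousOn.prodMk continuous_norm.continuousOn ?_)
  exact continuousOn_pi.2 fun k => S.U_cont k

lemma bdd_meas (hΩ : IsBallOrAnnulus Ω) {D : Set (EuclN N)} (hD : IsOpen D) (hs : D ⊆ Ω)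
    {g : EuclN N → ℝ} (hg : ContinuousOn g (closure Ω)) :
    Measurable (D.indicator g) ∧ ∃ K, ∀ x, |D.indicator g x| ≤ K := by
  refine ⟨?_, ?_⟩
  · classical
    have : D.indicator g = D.piecewise g 0 := (piecewise_eq_indicator).symm
    rw [this]
    exact ContinuousOn.measurable_piecewise (hg.mono (hs.trans subset_closure))
      continuousOn_const hD.measurableSet
  · obtain ⟨K, hK⟩ := (dom_bdd hΩ).isCompact_closure.exists_bound_of_continuousOn hg
    refine ⟨max K 0, fun x => ?_⟩
    by_cases hx : x ∈ D
    · rw [indicator_of_mem hx]; exact (hK x (subset_closure (hs hx))).trans (le_max_left _ _)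
    · rw [indicator_of_notMem hx]; simp

lemma St.cc_meas (S : St Ω f U) (i j : Fin m) : Measurable (cc Ω f U i j) :=
  (bdd_meas S.hΩ (dom_open S.hΩ) Subset.rfl (S.comp_cont (pd_cont (S.hf i) j))).1

lemma St.cc_bdd (S : St Ω f U) : ∃ C, ∀ i j x, |cc Ω f U i j x| ≤ C := by
  have := fun i j => (bdd_meas S.hΩ (dom_open S.hΩ) Subset.rfl (S.comp_cont (pd_cont (S.hf i) j))).2
  choose K hK using this
  refine ⟨∑ i, ∑ j, |K i j|, fun i j x => (hK i j x).trans ((le_abs_self _).trans ?_)⟩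
  refine le_trans ?_ (Finset.single_le_sum (f := fun i => ∑ j, |K i j|)
    (fun i _ => Finset.sum_nonneg fun j _ => abs_nonneg _) (Finset.mem_univ i))
  exact Finset.single_le_sum (f := fun j => |K i j|) (fun j _ => abs_nonneg _) (Finset.mem_univ j)

lemma St.cc_cont (S : St Ω f U) (i j : Fin m) : ContinuousOn (cc Ω f U i j) Ω := by
  refine ((S.comp_cont (pd_cont (S.hf i) j)).mono subset_closure).congr fun x hx => cc_apply hx i j

lemma Q_eq {D : Set (EuclN N)} (hD : D ⊆ Ω) {Ψ : Fin m → EuclN N → ℝ} (hΨ : IsTestFun D Ψ) :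
    Qform f U D Ψ = QQ (cc Ω f U) Ψ := by
  unfold Qform QQ
  rw [setIntegral_eq_integral_of_forall_compl_eq_zero]
  · congr 1
    ext x
    congr 1
    · exact Finset.sum_congr rfl fun i _ => norm_grad_sq _ _
    · by_cases hx : x ∈ D
      · refine Finset.sum_congr rfl fun i _ => Finset.sum_congr rfl fun j _ => ?_
        rw [cc_apply (hD hx)]
      · refine Finset.sum_congr rfl fun i _ => Finset.sum_congr rfl fun j _ => ?_
        rw [zero_of_notMem (hΨ i).2.2 hx]; simp
  · intro x hx
    have h1 : ∀ i, ‖gradient (Ψ i) x‖ ^ 2 = 0 := fun i => by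
      rw [norm_grad_sq]
      exact Finset.sum_eq_zero fun k _ => by rw [DD_zero_of_notMem (hΨ i).2.2 hx]; simp
    have h2 : ∀ i, Ψ i x = 0 := fun i => zero_of_notMem (hΨ i).2.2 hx
    simp [h1, h2]

end
end
end SC

namespace SC
open Topology Filter

noncomputable section

variable {N m : ℕ}
section
variable {Ω : Set (EuclN N)} {f : Fin m → ℝ → (Fin m → ℝ) → ℝ} {U : Fin m → EuclN N → ℝ}

lemma St.QQ_int (S : St Ω f U) {Ψ : Fin m → EuclN N → ℝ} (hΨ : IsTestFun Ω Ψ) :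
    Integrable (fun x => (∑ i, ∑ k, DD (bv k) (Ψ i) x ^ 2) -
      ∑ i, ∑ j, cc Ω f U i j x * Ψ i x * Ψ j x) := by
  obtain ⟨C, hC⟩ := S.cc_bdd
  refine Integrable.sub ?_ ?_
  · refine integrable_finsetSum _ fun i _ => integrable_finsetSum _ fun k _ => ?_
    refine Continuous.integrable_of_hasCompactSupport ((DD_continuous (hΨ i).1 _).pow 2) ?_
    refine hcs_of_zero (dom_bdd S.hΩ) fun x hx => ?_
    rw [DD_zero_of_notMem (hΨ i).2.2 hx]; simp
  · refine integrable_finsetSum _ fun i _ => integrable_finsetSum _ fun j _ => ?_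
    obtain ⟨K, hK⟩ : UB (fun (_ : Unit) x => cc Ω f U i j x * Ψ i x * Ψ j x) :=
      UB.mul (UB.mul ⟨C, fun _ x => hC i j x⟩ (UB.of_hcs (hΨ i).1.continuous (hΨ i).2.1))
        (UB.of_hcs (hΨ j).1.continuous (hΨ j).2.1)
    refine integrable_of_bdd (dom_bdd S.hΩ) ?_ (hK ()) fun x hx => by
      rw [zero_of_notMem (hΨ j).2.2 hx, mul_zero]
    exact ((S.cc_meas i j).mul (hΨ i).1.continuous.measurable).mul (hΨ j).1.continuous.measurable

lemma test_mono {D D' : Set (EuclN N)} (h : D ⊆ D') {Ψ : Fin m → EuclN N → ℝ}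
    (hΨ : IsTestFun D Ψ) : IsTestFun D' Ψ := fun i => ⟨(hΨ i).1, (hΨ i).2.1, (hΨ i).2.2.trans h⟩

lemma St.morse (S : St Ω f U) (e : EuclN N) :
    (∀ Ψ, IsTestFun (halfDom Ω e) Ψ → 0 ≤ QQ (cc Ω f U) Ψ) ∨
    (∀ Ψ, IsTestFun (halfDom Ω (-e)) Ψ → 0 ≤ QQ (cc Ω f U) Ψ) := by
  by_contra hcon
  push Not at hcon
  obtain ⟨⟨Ψ, hΨ, hQ1⟩, Θ, hΘ, hQ2⟩ := hcon
  have hΨ' := test_mono (half_sub Ω e) hΨ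
  have hΘ' := test_mono (half_sub Ω (-e)) hΘ
  apply S.hM
  refine ⟨![Ψ, Θ], ?_, ?_⟩
  · intro l; fin_cases l
    · exact hΨ'
    · exact hΘ'
  intro c hc
  have e1 : (fun i x => ∑ l, c l * (![Ψ, Θ] : Fin 2 → Fin m → EuclN N → ℝ) l i x) =
      fun i x => c 0 * Ψ i x + c 1 * Θ i x := by
    ext i x; simp [Fin.sum_univ_two]
  rw [e1]
  have ht : IsTestFun Ω (fun i x => c 0 * Ψ i x + c 1 * Θ i x) := by
    intro i
    refine ⟨(contDiff_const.mul (hΨ i).1).add (contDiff_const.mul (hΘ i).1),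
      ((hΨ i).2.1.mul_left).add ((hΘ i).2.1.mul_left), ?_⟩
    refine (tsupport_add (fun x => c 0 * Ψ i x) (fun x => c 1 * Θ i x)).trans (union_subset ?_ ?_)
    · exact (tsupport_mul_subset_right (f := fun _ => c 0) (g := Ψ i)).trans (hΨ' i).2.2
    · exact (tsupport_mul_subset_right (f := fun _ => c 1) (g := Θ i)).trans (hΘ' i).2.2
  rw [Q_eq Subset.rfl ht]
  have hDD : ∀ i a x, DD a (fun x => c 0 * Ψ i x + c 1 * Θ i x) x =
      c 0 * DD a (Ψ i) x + c 1 * DD a (Θ i) x := by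
    intro i a x
    have d1 : DifferentiableAt ℝ (Ψ i) x := (hΨ i).1.differentiable (by norm_num) x
    have d2 : DifferentiableAt ℝ (Θ i) x := (hΘ i).1.differentiable (by norm_num) x
    unfold DD
    rw [fderiv_fun_add (d1.const_mul _) (d2.const_mul _), fderiv_const_mul d1, fderiv_const_mul d2]
    simp
  have key : QQ (cc Ω f U) (fun i x => c 0 * Ψ i x + c 1 * Θ i x) =
      c 0 ^ 2 * QQ (cc Ω f U) Ψ + c 1 ^ 2 * QQ (cc Ω f U) Θ := by
    unfold QQ
    rw [← integral_const_mul, ← integral_const_mul,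
      ← integral_add ((S.QQ_int hΨ').const_mul _) ((S.QQ_int hΘ').const_mul _)]
    congr 1
    ext x
    simp only [hDD]
    by_cases hx : x ∈ halfDom Ω e
    · have hx2 : x ∉ halfDom Ω (-e) := fun h => by
        have h1 := hx.2; have h2 := h.2; rw [inner_neg_right] at h2; linarith
      have a1 : ∀ i, Θ i x = 0 := fun i => zero_of_notMem (hΘ i).2.2 hx2
      have a2 : ∀ i a, DD a (Θ i) x = 0 := fun i a => DD_zero_of_notMem (hΘ i).2.2 hx2 a
      simp only [a1, a2, mul_zero, add_zero, mul_sub, Finset.mul_sum]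
      simp only [ne_eq, OfNat.ofNat_ne_zero, not_false_eq_true, zero_pow, Finset.sum_const_zero,
        mul_zero, sub_zero, add_zero]
      congr 1
      · refine Finset.sum_congr rfl fun i _ => Finset.sum_congr rfl fun j _ => by ring
      · refine Finset.sum_congr rfl fun i _ => Finset.sum_congr rfl fun j _ => by ring
    · have a1 : ∀ i, Ψ i x = 0 := fun i => zero_of_notMem (hΨ i).2.2 hx
      have a2 : ∀ i a, DD a (Ψ i) x = 0 := fun i a => DD_zero_of_notMem (hΨ i).2.2 hx a
      simp only [a1, a2, mul_zero, zero_add, mul_sub, Finset.mul_sum]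
      simp only [ne_eq, OfNat.ofNat_ne_zero, not_false_eq_true, zero_pow, Finset.sum_const_zero,
        mul_zero, sub_zero, zero_add]
      congr 1
      · refine Finset.sum_congr rfl fun i _ => Finset.sum_congr rfl fun j _ => by ring
      · refine Finset.sum_congr rfl fun i _ => Finset.sum_congr rfl fun j _ => by ring
  rw [key]
  have hcne : c 0 ≠ 0 ∨ c 1 ≠ 0 := by
    by_contra h
    push Not at h
    apply hc
    ext l; fin_cases l
    · exact h.1
    · exact h.2
  rcases hcne with h | h
  · have := mul_neg_of_pos_of_neg (show 0 < c 0 ^ 2 by positivity) hQ1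
    have := mul_nonpos_of_nonneg_of_nonpos (sq_nonneg (c 1)) hQ2.le
    linarith
  · have := mul_neg_of_pos_of_neg (show 0 < c 1 ^ 2 by positivity) hQ2
    have := mul_nonpos_of_nonneg_of_nonpos (sq_nonneg (c 0)) hQ1.le
    linarith

/-- coupling in usable form -/
lemma St.off (S : St Ω f U) {e : EuclN N} (he : ‖e‖ = 1) : ∀ i j, i ≠ j → ∀ x ∈ halfDom Ω e,
    0 ≤ cc Ω f U i j x := fun i j hij x hx => by
  rw [cc_apply hx.1]; exact (S.hcoup e he).1 i j hij x hx _

lemma St.full (S : St Ω f U) {e : EuclN N} (he : ‖e‖ = 1) (I J : Finset (Fin m)) (hI : I.Nonempty)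
    (hJ : J.Nonempty) (hd : Disjoint I J) (hu : I ∪ J = Finset.univ) :
    ∃ i₀ ∈ I, ∃ j₀ ∈ J, ∃ x ∈ halfDom Ω e, 0 < cc Ω f U i₀ j₀ x := by
  obtain ⟨i, hi, j, hj, h⟩ := (S.hcoup e he).2 I J hI hJ hd hu
  obtain ⟨x, hx⟩ := nonempty_of_measure_ne_zero h.ne'
  exact ⟨i, hi, j, hj, x, hx.1, by rw [cc_apply hx.1.1]; exact hx.2⟩

end
end
end SC

namespace SC
open Topology Filter

noncomputable section

variable {N m : ℕ}
section
variable {Ω : Set (EuclN N)} {f : Fin m → ℝ → (Fin m → ℝ) → ℝ} {U : Fin m → EuclN N → ℝ}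

lemma St.apply_core (S : St Ω f U) {e : EuclN N} (he : ‖e‖ = 1)
    (hQ : ∀ Ψ, IsTestFun (halfDom Ω e) Ψ → 0 ≤ QQ (cc Ω f U) Ψ)
    {w h : Fin m → EuclN N → ℝ} (hw : ∀ i, Continuous (w i))
    (hw0 : ∀ i x, x ∉ halfDom Ω e → w i x = 0)
    (hw2 : ∀ i, ContDiffOn ℝ 2 (w i) (halfDom Ω e)) (hhm : ∀ i, Measurable (h i))
    (hK : ∀ i, ∃ K, ∀ x, |h i x| ≤ K)
    (hlap : ∀ i, ∀ x ∈ halfDom Ω e, - lap (w i) x = h i x)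
    (hineq : ∀ x ∈ halfDom Ω e, ∑ i, max (w i x) 0 * h i x ≤
      ∑ i, ∑ j, cc Ω f U i j x * max (w i x) 0 * max (w j x) 0) :
    (∀ i, ∀ φ : EuclN N → ℝ, ContDiff ℝ 2 φ → HasCompactSupport φ → tsupport φ ⊆ halfDom Ω e →
      ∫ x, (2 * (max (w i x) 0 * (- lap φ x)) -
        (∑ j, (cc Ω f U i j x + cc Ω f U j i x) * max (w j x) 0) * φ x) = 0) ∧
    ((∀ i, ∀ x ∈ halfDom Ω e, max (w i x) 0 = 0) ∨
      ∀ i, ∀ O : Set (EuclN N), IsOpen O → O ⊆ halfDom Ω e → O.Nonempty →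
      ∃ x ∈ O, max (w i x) 0 ≠ 0) := by
  obtain ⟨C, hC⟩ := S.cc_bdd
  choose K hK using hK
  have hK' : ∀ i x, |h i x| ≤ ∑ i, |K i| := fun i x => ((hK i x).trans (le_abs_self _)).trans
    (Finset.single_le_sum (f := fun i => |K i|) (fun j _ => abs_nonneg _) (Finset.mem_univ i))
  have hD := half_open S.hΩ e
  have hb : Bornology.IsBounded (halfDom Ω e) := (dom_bdd S.hΩ).subset (half_sub Ω e)
  have hid : ∀ i, ∀ φ : EuclN N → ℝ, ContDiff ℝ 2 φ → HasCompactSupport φ →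
      tsupport φ ⊆ halfDom Ω e →
      ∫ x, (2 * (max (w i x) 0 * (- lap φ x)) -
        (∑ j, (cc Ω f U i j x + cc Ω f U j i x) * max (w j x) 0) * φ x) = 0 := by
    intro i φ h2 hc hs
    exact core_single (W := fun i x => max (w i x) 0) (fun Φ a b c =>
      core hD hb S.cc_meas hC hQ hw hw0 hw2 hhm hK' hlap hineq a b c) i h2 hc hs
  refine ⟨hid, ?_⟩
  exact dichotomy (W := fun i x => max (w i x) 0) hD hb (half_conn S.hΩ e) S.cc_meas hC
    (fun i j => (S.cc_cont i j).mono (half_sub Ω e)) (S.off he) (S.full he)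
    (fun i => (hw i).max continuous_const) (fun i x => le_max_right _ _)
    (fun i x hx => by rw [hw0 i x hx, max_self]) hid

lemma sum_pd (g : ℝ → (Fin m → ℝ) → ℝ) (r : ℝ) (s v : Fin m → ℝ) :
    fderiv ℝ (g r) s v = ∑ j, pd g j r s * v j := by
  conv_lhs => rw [pi_eq_sum_univ' v]
  rw [map_sum]
  refine Finset.sum_congr rfl fun j _ => ?_
  rw [map_smul, smul_eq_mul, mul_comm]
  congr 1

lemma mvt (S : St Ω f U) (i : Fin m) (r : ℝ) (s t : Fin m → ℝ) : ∃ z ∈ segment ℝ s t,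
    f i r t - f i r s = ∑ j, pd (f i) j r z * (t j - s j) := by
  have hd : Differentiable ℝ (f i r) := by
    have : Differentiable ℝ (fun q : ℝ × (Fin m → ℝ) => f i q.1 q.2) :=
      (S.hf i).differentiable (by norm_num)
    exact this.comp (f := fun s : Fin m → ℝ => (r, s)) (by fun_prop)
  obtain ⟨z, hz, h⟩ := domain_mvt (f := f i r) (s := univ) (x := s) (y := t)
    (f' := fun z => fderiv ℝ (f i r) z)
    (fun x _ => (hd x).hasFDerivAt.hasFDerivWithinAt) convex_univ (mem_univ _) (mem_univ _)
  refine ⟨z, hz, ?_⟩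
  rw [h, sum_pd]
  simp

lemma seg_le {s t z : Fin m → ℝ} (h : ∀ k, s k ≤ t k) (hz : z ∈ segment ℝ s t) (k : Fin m) :
    z k ≤ t k := by
  obtain ⟨a, b, ha, hb, hab, rfl⟩ := hz
  simp only [Pi.add_apply, Pi.smul_apply, smul_eq_mul]
  have h1 : a * s k ≤ a * t k := mul_le_mul_of_nonneg_left (h k) ha
  calc a * s k + b * t k ≤ a * t k + b * t k := by linarith
    _ = t k := by rw [← add_mul, hab, one_mul]

lemma coop_diff (S : St Ω f U) (i : Fin m) (r : ℝ)
    (hc : ∀ j, i ≠ j → ∀ s : Fin m → ℝ, 0 ≤ pd (f i) j r s) (s t : Fin m → ℝ) (hi : t i < s i) :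
    f i r s - f i r t ≤ ∑ j, pd (f i) j r s * max (s j - t j) 0 := by
  set M : Fin m → ℝ := fun k => min (s k) (t k)
  obtain ⟨z, hz, h1⟩ := mvt S i r M s
  obtain ⟨z', hz', h2⟩ := mvt S i r M t
  have h3 : 0 ≤ f i r t - f i r M := by
    rw [h2]
    refine Finset.sum_nonneg fun j _ => ?_
    by_cases hj : i = j
    · subst hj
      have : M i = t i := min_eq_right hi.le
      rw [this]; simp
    · exact mul_nonneg (hc j hj _) (sub_nonneg.2 (min_le_right _ _))
  have h4 : f i r s - f i r M ≤ ∑ j, pd (f i) j r s * max (s j - t j) 0 := by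
    rw [h1]
    refine Finset.sum_le_sum fun j _ => ?_
    have e : s j - M j = max (s j - t j) 0 := by
      simp only [M]
      rcases le_total (s j) (t j) with h | h
      · rw [min_eq_left h, max_eq_right (by linarith), sub_self]
      · rw [min_eq_right h, max_eq_left (by linarith)]
    rw [e]
    refine mul_le_mul_of_nonneg_right (S.hmono i j r z s fun k => ?_) (le_max_right _ _)
    exact seg_le (fun k => min_le_left _ _) hz k
  linarith

lemma St.UU_eq {x : EuclN N} (hx : x ∈ Ω) (i : Fin m) : UU Ω U i x = U i x := indicator_of_mem hx _

lemma St.stepA (S : St Ω f U) {e : EuclN N} (he : ‖e‖ = 1)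
    (hQ : ∀ Ψ, IsTestFun (halfDom Ω e) Ψ → 0 ≤ QQ (cc Ω f U) Ψ) :
    (∀ i, ∀ x ∈ halfDom Ω e, U i x ≤ U i (refl e x)) ∨
    (∀ i, ∀ x ∈ halfDom Ω e, U i (refl e x) ≤ U i x) := by
  set σ := refl e with hσ
  set D := halfDom Ω e with hDdef
  have hΩo := dom_open S.hΩ
  have hD : IsOpen D := half_open S.hΩ e
  have hσΩ : ∀ x, x ∈ Ω → σ x ∈ Ω := fun x hx => dom_norm S.hΩ (σ.norm_map x).symm hx
  set w : Fin m → EuclN N → ℝ := fun i => {x : EuclN N | 0 < ⟪x, e⟫}.indicator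
    (fun x => UU Ω U i x - UU Ω U i (σ x)) with hw
  have hwD : ∀ i, ∀ x ∈ D, w i x = U i x - U i (σ x) := by
    intro i x hx
    simp only [hw]
    rw [indicator_of_mem (show x ∈ {x : EuclN N | 0 < ⟪x, e⟫} from hx.2), St.UU_eq hx.1,
      St.UU_eq (hσΩ x hx.1)]
  have hUo : ∀ i, ContDiffOn ℝ 2 (U i) Ω := fun i =>
    ((S.hU i).mono subset_closure).of_le (by norm_num)
  have hUσ : ∀ i, ContDiffOn ℝ 2 (fun x => U i (σ x)) Ω := fun i =>
    (hUo i).comp σ.contDiff.contDiffOn hσΩ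
  set h : Fin m → EuclN N → ℝ := fun i => D.indicator (fun x =>
    f i ‖x‖ (fun k => UU Ω U k x) - f i ‖x‖ (fun k => UU Ω U k (σ x))) with hh
  have hhc : ∀ i, Continuous (fun x =>
    f i ‖x‖ (fun k => UU Ω U k x) - f i ‖x‖ (fun k => UU Ω U k (σ x))) := by
    intro i
    have hfc := (S.hf i).continuous
    refine Continuous.sub ?_ ?_
    · exact hfc.comp (continuous_norm.prodMk (continuous_pi fun k => S.UU_cont k))
    · exact hfc.comp (continuous_norm.prodMk
        (continuous_pi fun k => (S.UU_cont k).comp σ.continuous))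
  have hhD : ∀ i, ∀ x ∈ D, h i x = f i ‖x‖ (fun k => U k x) - f i ‖x‖ (fun k => U k (σ x)) := by
    intro i x hx
    simp only [hh]
    rw [indicator_of_mem hx]
    simp only [St.UU_eq hx.1, St.UU_eq (hσΩ x hx.1)]
  have hic : Continuous (fun x : EuclN N => ⟪x, e⟫) := by fun_prop
  have hfr : frontier {x : EuclN N | 0 < ⟪x, e⟫} ⊆ {x | 0 = ⟪x, e⟫} :=
    frontier_lt_subset_eq continuous_const hic
  have hwc : ∀ i, Continuous (w i) := by
    intro i
    refine continuous_indicator (fun x hx => ?_)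
      ((S.UU_cont i).sub ((S.UU_cont i).comp σ.continuous)).continuousOn
    have : (0:ℝ) = ⟪x, e⟫ := hfr hx
    rw [hσ, refl_apply he, ← this]; simp
  obtain ⟨-, hdich⟩ := S.apply_core he hQ (w := w) (h := h) hwc
    (by
      intro i x hx
      simp only [hw]
      by_cases hx2 : x ∈ {x : EuclN N | 0 < ⟪x, e⟫}
      · have hxΩ : x ∉ Ω := fun h => hx ⟨h, hx2⟩
        have hxσ : σ x ∉ Ω := fun h => hxΩ (dom_norm S.hΩ (σ.norm_map x) h)
        rw [indicator_of_mem hx2]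
        simp [UU, hxΩ, hxσ]
      · exact indicator_of_notMem hx2 _)
    (fun i => (((hUo i).sub (hUσ i)).mono (half_sub Ω e)).congr (hwD i))
    (fun i => (bdd_meas S.hΩ hD (half_sub Ω e) (hhc i).continuousOn).1)
    (fun i => (bdd_meas S.hΩ hD (half_sub Ω e) (hhc i).continuousOn).2)
    (by
      intro i x hx
      have h1 : w i =ᶠ[𝓝 x] fun x => U i x - U i (σ x) := by
        filter_upwards [hD.mem_nhds hx] with y hy using hwD i y hy
      rw [lap_congr h1, lap_sub ((hUo i).contDiffAt (hΩo.mem_nhds hx.1))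
        ((hUσ i).contDiffAt (hΩo.mem_nhds hx.1)), lap_comp σ (U i), hhD i x hx]
      have a1 := S.hsol.1 i x hx.1
      have a2 := S.hsol.1 i (σ x) (hσΩ x hx.1)
      rw [σ.norm_map] at a2
      linarith)
    (by
      intro x hx
      refine Finset.sum_le_sum fun i _ => ?_
      rcases le_or_gt (w i x) 0 with h0 | h0
      · rw [max_eq_right h0]; simp
      · have hcd := coop_diff S i ‖x‖ (fun j hij s => (S.hcoup e he).1 i j hij x hx s)
          (fun k => U k x) (fun k => U k (σ x)) (by have := hwD i x hx; linarith)
        rw [← hhD i x hx] at hcd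
        have := mul_le_mul_of_nonneg_left hcd (le_max_right (w i x) 0)
        refine this.trans (le_of_eq ?_)
        rw [Finset.mul_sum]
        refine Finset.sum_congr rfl fun j _ => ?_
        rw [cc_apply hx.1, ← hwD j x hx]; ring)
  rcases hdich with hd | hd
  · left
    intro i x hx
    have := hd i x hx
    have h2 := le_max_left (w i x) 0
    rw [this, hwD i x hx] at h2
    linarith
  · right
    intro i x hx
    by_contra hlt
    push Not at hlt
    obtain ⟨y, hy, hy2⟩ := hd i (D ∩ w i ⁻¹' Iio 0) (hD.inter (isOpen_Iio.preimage (hwc i)))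
      inter_subset_left ⟨x, hx, by show w i x < 0; rw [hwD i x hx]; linarith⟩
    exact hy2 (max_eq_right (le_of_lt hy.2))

lemma refl_neg (e : EuclN N) : refl (-e) = refl e := by
  rw [← neg_one_smul ℝ, refl_smul _ (by norm_num)]

lemma St.dich (S : St Ω f U) {e : EuclN N} (he : ‖e‖ = 1) :
    (∀ i, ∀ x ∈ halfDom Ω e, U i x ≤ U i (refl e x)) ∨
    (∀ i, ∀ x ∈ halfDom Ω e, U i (refl e x) ≤ U i x) := by
  rcases S.morse e with h | h
  · exact S.stepA he h
  · have key : ∀ x ∈ halfDom Ω e, refl e x ∈ halfDom Ω (-e) := by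
      intro x hx
      refine ⟨dom_norm S.hΩ ((refl e).norm_map x).symm hx.1, ?_⟩
      rw [inner_neg_right, refl_inner he, neg_neg]; exact hx.2
    rcases S.stepA (by rwa [norm_neg]) h with h | h
    · right; intro i x hx
      have := h i _ (key x hx)
      rwa [refl_neg, refl_refl] at this
    · left; intro i x hx
      have := h i _ (key x hx)
      rwa [refl_neg, refl_refl] at this

end
end
end SC

namespace SC
open Topology Filter

noncomputable section

variable {N m : ℕ}
section
variable {Ω : Set (EuclN N)} {f : Fin m → ℝ → (Fin m → ℝ) → ℝ} {U : Fin m → EuclN N → ℝ}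

/-- barycenter -/
def bary (Ω : Set (EuclN N)) (U : Fin m → EuclN N → ℝ) : EuclN N :=
  ∫ x, (∑ i, UU Ω U i x) • x

lemma smul_int {G : EuclN N → ℝ} (hG : Continuous G) (hs : HasCompactSupport G) :
    Integrable (fun x => G x • x) := by
  have h1 : Continuous (fun x => G x • x) := by fun_prop
  have h2 : HasCompactSupport (fun x => G x • x) := by
    refine HasCompactSupport.of_support_subset_isCompact hs ?_
    intro x hx
    refine subset_closure fun h => hx ?_
    simp [h]
  exact h1.integrable_of_hasCompactSupport h2

lemma sum_eq_aux (a b : Fin m → ℝ) (h : ∀ i, a i ≤ b i) (hs : ∑ i, a i = ∑ i, b i) (i : Fin m) :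
    a i = b i := by
  have h1 : ∑ i, (b i - a i) = 0 := by rw [Finset.sum_sub_distrib, hs, sub_self]
  have h2 := (Finset.sum_eq_zero_iff_of_nonneg (fun i _ => sub_nonneg.2 (h i))).1 h1 i
    (Finset.mem_univ i)
  linarith

lemma St.stepB (S : St Ω f U) {e : EuclN N} (he : ‖e‖ = 1) (hP : 0 ≤ ⟪e, bary Ω U⟫) :
    ∀ i, ∀ x ∈ halfDom Ω e, U i (refl e x) ≤ U i x := by
  rcases S.dich he with hle | hge
  swap
  · exact hge
  set σ := refl e with hσ
  set G : EuclN N → ℝ := fun x => ∑ i, UU Ω U i x with hG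
  have hGc : Continuous G := continuous_finsetSum _ fun i _ => S.UU_cont i
  have hG0 : ∀ x, x ∉ Ω → G x = 0 := fun x hx =>
    Finset.sum_eq_zero fun i _ => indicator_of_notMem hx _
  have hσΩ : ∀ x, x ∈ Ω → σ x ∈ Ω := fun x hx => dom_norm S.hΩ (σ.norm_map x).symm hx
  have hσΩ' : ∀ x, x ∉ Ω → σ x ∉ Ω := fun x hx h => hx (dom_norm S.hΩ (σ.norm_map x) h)
  have hGs : HasCompactSupport G := hcs_of_zero (dom_bdd S.hΩ) hG0
  have i0 : Integrable (fun x => G x • x) := smul_int hGc hGs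
  have hI : ⟪e, bary Ω U⟫ = ∫ x, G x * ⟪x, e⟫ := by
    unfold bary
    rw [← integral_inner i0]
    congr 1; ext x
    rw [real_inner_smul_right, real_inner_comm]
  have c1 : Continuous (fun x : EuclN N => G x * ⟪x, e⟫) := hGc.mul (by fun_prop)
  have c2 : Continuous (fun x : EuclN N => G (σ x) * ⟪x, e⟫) :=
    (hGc.comp σ.continuous).mul (by fun_prop)
  have i1 : Integrable (fun x => G x * ⟪x, e⟫) :=
    c1.integrable_of_hasCompactSupport
      (hcs_of_zero (dom_bdd S.hΩ) fun x hx => by rw [hG0 x hx, zero_mul])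
  have i2 : Integrable (fun x => G (σ x) * ⟪x, e⟫) :=
    c2.integrable_of_hasCompactSupport
      (hcs_of_zero (dom_bdd S.hΩ) fun x hx => by rw [hG0 _ (hσΩ' x hx), zero_mul])
  have hI2 : ∫ x, G x * ⟪x, e⟫ = - ∫ x, G (σ x) * ⟪x, e⟫ := by
    have := (σ.measurePreserving).integral_comp σ.toHomeomorph.measurableEmbedding
      (fun x => G x * ⟪x, e⟫)
    rw [← this, ← integral_neg]
    congr 1; ext x
    rw [hσ, refl_inner he]; ring
  have hGle : ∀ x ∈ halfDom Ω e, G x ≤ G (σ x) := fun x hx =>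
    Finset.sum_le_sum fun i _ => by
      rw [St.UU_eq hx.1, St.UU_eq (hσΩ x hx.1)]; exact hle i x hx
  have hpt : ∀ x, 0 ≤ (G (σ x) - G x) * ⟪x, e⟫ := by
    intro x
    by_cases hx : x ∈ Ω
    · rcases lt_trichotomy ⟪x, e⟫ (0:ℝ) with h | h | h
      · have : σ x ∈ halfDom Ω e := ⟨hσΩ x hx, by rw [hσ, refl_inner he]; linarith⟩
        have h2 := hGle _ this
        rw [hσ, refl_refl] at h2
        exact mul_nonneg_of_nonpos_of_nonpos (by rw [hσ]; linarith) h.le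
      · rw [h, mul_zero]
      · exact mul_nonneg (sub_nonneg.2 (hGle x ⟨hx, h⟩)) h.le
    · rw [hG0 _ (hσΩ' x hx), hG0 x hx]; simp
  have i3 : Integrable (fun x => (G (σ x) - G x) * ⟪x, e⟫) := by
    simp only [sub_mul]; exact i2.sub i1
  have h0 : ∫ x, (G (σ x) - G x) * ⟪x, e⟫ = 0 := by
    have h1 : ∫ x, (G (σ x) - G x) * ⟪x, e⟫ =
      (∫ x, G (σ x) * ⟪x, e⟫) - ∫ x, G x * ⟪x, e⟫ := by
      rw [← integral_sub i2 i1]; congr 1; ext x; ring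
    have h2 := integral_nonneg (μ := volume) (f := fun x => (G (σ x) - G x) * ⟪x, e⟫) hpt
    linarith
  rw [integral_eq_zero_iff_of_nonneg hpt i3] at h0
  have c3 : Continuous (fun x : EuclN N => (G (σ x) - G x) * ⟪x, e⟫) := by
    simp only [sub_mul]; exact c2.sub c1
  have h4 : (fun x : EuclN N => (G (σ x) - G x) * ⟪x, e⟫) = fun _ => 0 :=
    (c3.ae_eq_iff_eq volume continuous_const).1 h0
  intro i x hx
  have h5 := congrFun h4 x
  have h6 : G (σ x) - G x = 0 := (mul_eq_zero.1 h5).resolve_right hx.2.ne'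
  have h8 : UU Ω U i x = UU Ω U i (σ x) := by
    refine sum_eq_aux (fun i => UU Ω U i x) (fun i => UU Ω U i (σ x)) (fun i => ?_) ?_ i
    · show UU Ω U i x ≤ UU Ω U i (σ x)
      rw [St.UU_eq hx.1, St.UU_eq (hσΩ x hx.1)]; exact hle i x hx
    · exact (sub_eq_zero.1 h6).symm
  rw [St.UU_eq hx.1, St.UU_eq (hσΩ x hx.1)] at h8
  exact h8.ge

lemma St.ord (S : St Ω f U) (i : Fin m) {x y : EuclN N} (hx : x ∈ Ω) (hn : ‖x‖ = ‖y‖)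
    (h : ⟪y, bary Ω U⟫ ≤ ⟪x, bary Ω U⟫) : U i y ≤ U i x := by
  by_cases hxy : x = y
  · rw [hxy]
  have h0 : 0 < ‖x - y‖ := norm_pos_iff.2 (sub_ne_zero.2 hxy)
  set e := ‖x - y‖⁻¹ • (x - y) with he
  have he1 : ‖e‖ = 1 := by
    rw [he, norm_smul, norm_inv, norm_norm, inv_mul_cancel₀ h0.ne']
  have hr : refl e x = y := by
    rw [he, refl_smul _ (inv_ne_zero h0.ne'), refl_sub hn]
  have hxe : 0 < ⟪x, e⟫ := by
    rw [he, real_inner_smul_right]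
    refine mul_pos (inv_pos.2 h0) ?_
    rw [inner_sub_right, real_inner_self_eq_norm_sq]
    have := norm_sub_sq_real x y
    rw [← hn] at this
    nlinarith
  have := S.stepB he1 (by
    rw [he, real_inner_smul_left, inner_sub_left]
    exact mul_nonneg (inv_nonneg.2 h0.le) (by linarith)) i x ⟨hx, hxe⟩
  rwa [hr] at this

lemma St.fol (S : St Ω f U) (hr : ¬ IsRadial Ω U) : ∃ p, FoliatedSchwarzWith Ω U p := by
  by_cases hP : bary Ω U = 0
  · exfalso; apply hr
    intro i x hx y hy hn
    exact le_antisymm (S.ord i hy hn.symm (by simp [hP])) (S.ord i hx hn (by simp [hP]))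
  have h0 : 0 < ‖bary Ω U‖ := norm_pos_iff.2 hP
  refine ⟨‖bary Ω U‖⁻¹ • bary Ω U, ?_, ?_⟩
  · rw [norm_smul, norm_inv, norm_norm, inv_mul_cancel₀ h0.ne']
  · intro i x hx y hy hn h
    rw [real_inner_smul_right, real_inner_smul_right] at h
    exact S.ord i hx hn (le_of_mul_le_mul_left h (inv_pos.2 h0))

end
end
end SC

namespace SC
open Topology Filter

noncomputable section

variable {N m : ℕ}

/-- rotation curve -/
def gam (p e x : EuclN N) (t : ℝ) : EuclN N :=
  x + ((cos t - 1) * ⟪x, p⟫ - sin t * ⟪x, e⟫) • p + ((cos t - 1) * ⟪x, e⟫ + sin t * ⟪x, p⟫) • e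

/-- generator -/
def rotA (p e x : EuclN N) : EuclN N := ⟪x, p⟫ • e - ⟪x, e⟫ • p

lemma gam_zero (p e x : EuclN N) : gam p e x 0 = x := by simp [gam]

lemma gam_deriv (p e x : EuclN N) : HasDerivAt (gam p e x) (rotA p e x) 0 := by
  have h1 : HasDerivAt (fun t => (cos t - 1) * ⟪x, p⟫ - sin t * ⟪x, e⟫) (-⟪x, e⟫) 0 := by
    have := (((hasDerivAt_cos 0).sub_const 1).mul_const ⟪x, p⟫).fun_sub
      ((hasDerivAt_sin 0).mul_const ⟪x, e⟫)
    simpa using this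
  have h2 : HasDerivAt (fun t => (cos t - 1) * ⟪x, e⟫ + sin t * ⟪x, p⟫) ⟪x, p⟫ 0 := by
    have := (((hasDerivAt_cos 0).sub_const 1).mul_const ⟪x, e⟫).fun_add
      ((hasDerivAt_sin 0).mul_const ⟪x, p⟫)
    simpa using this
  have h3 := ((h1.smul_const p).const_add x).add (h2.smul_const e)
  have e : rotA p e x = -⟪x, e⟫ • p + ⟪x, p⟫ • e := by unfold rotA; rw [neg_smul]; abel
  rw [e]
  exact h3

lemma gam_inner_p {p e : EuclN N} (hp : ‖p‖ = 1) (hpe : ⟪e, p⟫ = 0) (x : EuclN N) (t : ℝ) :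
    ⟪gam p e x t, p⟫ = cos t * ⟪x, p⟫ - sin t * ⟪x, e⟫ := by
  unfold gam
  rw [inner_add_left, inner_add_left, real_inner_smul_left, real_inner_smul_left, hpe,
    real_inner_self_eq_norm_sq, hp]; ring

lemma gam_norm {p e : EuclN N} (hp : ‖p‖ = 1) (he : ‖e‖ = 1) (hpe : ⟪e, p⟫ = 0) (x : EuclN N)
    (t : ℝ) : ‖gam p e x t‖ = ‖x‖ := by
  have h : ‖gam p e x t‖ ^ 2 = ‖x‖ ^ 2 := by
    unfold gam
    have hep : ⟪p, e⟫ = 0 := by rw [real_inner_comm]; exact hpe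
    set α := (cos t - 1) * ⟪x, p⟫ - sin t * ⟪x, e⟫ with hα
    set β := (cos t - 1) * ⟪x, e⟫ + sin t * ⟪x, p⟫ with hβ
    rw [← real_inner_self_eq_norm_sq, ← real_inner_self_eq_norm_sq]
    simp only [inner_add_left, inner_add_right, real_inner_smul_left, real_inner_smul_right, hpe,
      hep, real_inner_comm x p, real_inner_comm x e]
    rw [real_inner_self_eq_norm_sq p, real_inner_self_eq_norm_sq e, hp, he]
    rw [hα, hβ]
    linear_combination (⟪x, p⟫ ^ 2 + ⟪x, e⟫ ^ 2) * (cos_sq_add_sin_sq t)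
  exact (sq_eq_sq₀ (norm_nonneg _) (norm_nonneg _)).1 h

/-- angular derivative with a sign -/
def vf (p e : EuclN N) (u : EuclN N → ℝ) (x : EuclN N) : ℝ := ⟪x, e⟫ * DD p u x - ⟪x, p⟫ * DD e u x

lemma vf_eq (p e : EuclN N) (u : EuclN N → ℝ) (x : EuclN N) :
    vf p e u x = - fderiv ℝ u x (rotA p e x) := by
  unfold vf rotA DD
  rw [map_sub, map_smul, map_smul]; simp

lemma gam_comp (p e : EuclN N) {u : EuclN N → ℝ} {x : EuclN N} (hu : DifferentiableAt ℝ u x) :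
    HasDerivAt (fun t => u (gam p e x t)) (- vf p e u x) 0 := by
  rw [vf_eq, neg_neg]
  have hu' : HasFDerivAt u (fderiv ℝ u x) (gam p e x 0) := by
    rw [gam_zero]; exact hu.hasFDerivAt
  exact hu'.comp_hasDerivAt (0:ℝ) (gam_deriv p e x)

lemma sum_bv (a : EuclN N) : ∑ k, ⟪bv k, a⟫ • bv k = a := by
  have := (EuclideanSpace.basisFun (Fin N) ℝ).sum_repr' a
  simpa [bv] using this

lemma DD_lin (a b x : EuclN N) : DD b (fun x => ⟪x, a⟫) x = ⟪b, a⟫ := by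
  have : HasFDerivAt (fun x : EuclN N => ⟪x, a⟫) (innerSL ℝ a) x := by
    have e : (fun x : EuclN N => ⟪x, a⟫) = fun x => innerSL ℝ a x := by
      ext z; rw [innerSL_apply_apply, real_inner_comm z]
    rw [e]
    exact (innerSL ℝ a).hasFDerivAt
  unfold DD
  rw [this.fderiv, innerSL_apply_apply, real_inner_comm]

lemma lin_contDiff (a : EuclN N) : ContDiff ℝ 2 (fun x : EuclN N => ⟪x, a⟫) :=
  contDiff_id.inner ℝ contDiff_const

lemma DD_mul_lin (a b : EuclN N) {g : EuclN N → ℝ} {x : EuclN N} (hg : DifferentiableAt ℝ g x) :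
    DD b (fun x => ⟪x, a⟫ * g x) x = ⟪b, a⟫ * g x + ⟪x, a⟫ * DD b g x := by
  have hl : DifferentiableAt ℝ (fun x : EuclN N => ⟪x, a⟫) x :=
    (lin_contDiff a).differentiable (by norm_num) x
  have h1 := DD_lin a b x
  unfold DD at *
  rw [fderiv_fun_mul hl hg]
  simp only [_root_.add_apply, _root_.smul_apply, smul_eq_mul, h1]
  ring

lemma DD_add {u v : EuclN N → ℝ} {x : EuclN N} (hu : DifferentiableAt ℝ u x)
    (hv : DifferentiableAt ℝ v x) (a : EuclN N) :
    DD a (fun x => u x + v x) x = DD a u x + DD a v x := by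
  unfold DD; rw [fderiv_fun_add hu hv]; rfl

lemma DD_cmul {u : EuclN N → ℝ} {x : EuclN N} (hu : DifferentiableAt ℝ u x) (c : ℝ) (a : EuclN N) :
    DD a (fun x => c * u x) x = c * DD a u x := by
  unfold DD; rw [fderiv_const_mul hu]; rfl

lemma sum_DD (a : EuclN N) (u : EuclN N → ℝ) (x : EuclN N) :
    ∑ k, ⟪bv k, a⟫ * DD (bv k) u x = DD a u x := by
  unfold DD
  conv_rhs => rw [← sum_bv a]
  rw [map_sum]
  exact Finset.sum_congr rfl fun k _ => by rw [map_smul]; rfl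

lemma lap_mul_lin {D : Set (EuclN N)} (hD : IsOpen D) (a : EuclN N) {g : EuclN N → ℝ}
    (hg : ContDiffOn ℝ 2 g D) {x : EuclN N} (hx : x ∈ D) :
    lap (fun x => ⟪x, a⟫ * g x) x = 2 * DD a g x + ⟪x, a⟫ * lap g x := by
  have hlin : ContDiff ℝ 2 (fun x : EuclN N => ⟪x, a⟫) := lin_contDiff a
  have hgd : ∀ y ∈ D, DifferentiableAt ℝ g y := fun y hy =>
    (hg.contDiffAt (hD.mem_nhds hy)).differentiableAt (by norm_num)
  rw [lap_eq ((hlin.contDiffOn.mul hg).contDiffAt (hD.mem_nhds hx)),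
    lap_eq (hg.contDiffAt (hD.mem_nhds hx)), ← sum_DD, Finset.mul_sum, Finset.mul_sum,
    ← Finset.sum_add_distrib]
  refine Finset.sum_congr rfl fun k _ => ?_
  have h1 : DD (bv k) (fun x => ⟪x, a⟫ * g x) =ᶠ[𝓝 x]
      fun y => ⟪bv k, a⟫ * g y + ⟪y, a⟫ * DD (bv k) g y := by
    filter_upwards [hD.mem_nhds hx] with y hy using DD_mul_lin a _ (hgd y hy)
  have hg1 : DifferentiableAt ℝ (DD (bv k) g) x :=
    ((DD_contDiffOn hD (n := 1) (by simpa using hg) (bv k)).contDiffAt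
      (hD.mem_nhds hx)).differentiableAt (by norm_num)
  have hl : DifferentiableAt ℝ (fun x : EuclN N => ⟪x, a⟫) x :=
    (lin_contDiff a).differentiable (by norm_num) x
  rw [DD_congr h1, DD_add ((hgd x hx).const_mul _) (hl.fun_mul hg1), DD_cmul (hgd x hx),
    DD_mul_lin a _ hg1]
  ring

lemma lap_DD {D : Set (EuclN N)} (hD : IsOpen D) (a : EuclN N) {u : EuclN N → ℝ}
    (hu : ContDiffOn ℝ 3 u D) {x : EuclN N} (hx : x ∈ D) :
    lap (DD a u) x = DD a (lap u) x := by
  have hu2 : ∀ y ∈ D, ContDiffAt ℝ 2 u y := fun y hy =>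
    (hu.contDiffAt (hD.mem_nhds hy)).of_le (by norm_num)
  have hD2 : ∀ b, ContDiffOn ℝ 2 (DD b u) D := fun b =>
    DD_contDiffOn hD (n := 2) (by exact_mod_cast hu) b
  have hD1 : ∀ b b', ContDiffOn ℝ 1 (DD b' (DD b u)) D := fun b b' =>
    DD_contDiffOn hD (n := 1) (by exact_mod_cast hD2 b) b'
  have hl : lap u =ᶠ[𝓝 x] fun y => ∑ k, DD (bv k) (DD (bv k) u) y := by
    filter_upwards [hD.mem_nhds hx] with y hy using lap_eq (hu2 y hy)
  have hs : DD a (fun y => ∑ k, DD (bv k) (DD (bv k) u) y) x =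
      ∑ k, DD a (DD (bv k) (DD (bv k) u)) x := by
    have hd : ∀ k : Fin N, DifferentiableAt ℝ (DD (bv k) (DD (bv k) u)) x := fun k =>
      ((hD1 (bv k) (bv k)).contDiffAt (hD.mem_nhds hx)).differentiableAt (by norm_num)
    unfold DD at *
    rw [fderiv_fun_sum fun k _ => hd k]
    simp
  rw [DD_congr hl, hs, lap_eq ((hD2 a).contDiffAt (hD.mem_nhds hx))]
  refine Finset.sum_congr rfl fun k _ => ?_
  have h1 : DD (bv k) (DD a u) =ᶠ[𝓝 x] DD a (DD (bv k) u) := by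
    filter_upwards [hD.mem_nhds hx] with y hy using DD_comm (hu2 y hy) _ _
  rw [DD_congr h1]
  exact DD_comm ((hD2 (bv k)).contDiffAt (hD.mem_nhds hx)) _ _

lemma lap_vf {D : Set (EuclN N)} (hD : IsOpen D) (p e : EuclN N) {u : EuclN N → ℝ}
    (hu : ContDiffOn ℝ 3 u D) {x : EuclN N} (hx : x ∈ D) :
    lap (vf p e u) x = vf p e (lap u) x := by
  have hD2 : ∀ b, ContDiffOn ℝ 2 (DD b u) D := fun b =>
    DD_contDiffOn hD (n := 2) (by exact_mod_cast hu) b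
  have hlin : ∀ a : EuclN N, ContDiff ℝ 2 (fun x : EuclN N => ⟪x, a⟫) := lin_contDiff
  have h1 := lap_sub (((hlin e).contDiffOn.mul (hD2 p)).contDiffAt (hD.mem_nhds hx))
    (((hlin p).contDiffOn.mul (hD2 e)).contDiffAt (hD.mem_nhds hx))
  have h2 : lap (vf p e u) x = _ := h1
  rw [h2, lap_mul_lin hD e (hD2 p) hx, lap_mul_lin hD p (hD2 e) hx, lap_DD hD p hu hx,
    lap_DD hD e hu hx, DD_comm ((hu.contDiffAt (hD.mem_nhds hx)).of_le (by norm_num)) e p]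
  unfold vf
  ring

end
end SC

namespace SC
open Topology Filter

noncomputable section

variable {N m : ℕ}

lemma even_deriv {g : ℝ → ℝ} {d : ℝ} (h : HasDerivAt g d 0) (he : ∀ t, g (-t) = g t) : d = 0 := by
  have h0 : HasDerivAt g d (-(0:ℝ)) := by rwa [neg_zero]
  have h1 : HasDerivAt (fun t => g (-t)) (d * -1) 0 := h0.comp (0:ℝ) (hasDerivAt_neg (0:ℝ))
  have h2 : (fun t => g (-t)) = g := funext he
  rw [h2] at h1
  have := h1.unique h
  linarith

section
variable {Ω : Set (EuclN N)} {f : Fin m → ℝ → (Fin m → ℝ) → ℝ} {U : Fin m → EuclN N → ℝ}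

lemma St.U3 (S : St Ω f U) (i : Fin m) : ContDiffOn ℝ 3 (U i) Ω := (S.hU i).mono subset_closure

lemma St.Ud (S : St Ω f U) (i : Fin m) {x : EuclN N} (hx : x ∈ Ω) : DifferentiableAt ℝ (U i) x :=
  ((S.U3 i).contDiffAt ((dom_open S.hΩ).mem_nhds hx)).differentiableAt (by norm_num)

lemma fol_eq {p : EuclN N} (F : FoliatedSchwarzWith Ω U p) (i : Fin m) {x y : EuclN N} (hx : x ∈ Ω)
    (hy : y ∈ Ω) (h : ‖x‖ = ‖y‖) (h2 : ⟪x, p⟫ = ⟪y, p⟫) : U i x = U i y :=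
  le_antisymm (F.2 i y hy x hx h.symm h2.le) (F.2 i x hx y hy h h2.ge)

lemma St.vf_nonneg (S : St Ω f U) {p e : EuclN N} (F : FoliatedSchwarzWith Ω U p) (he : ‖e‖ = 1)
    (hpe : ⟪e, p⟫ = 0) (i : Fin m) {x : EuclN N} (hx : x ∈ Ω) (hxe : 0 < ⟪x, e⟫) :
    0 ≤ vf p e (U i) x := by
  have h1 := gam_comp p e (S.Ud i hx)
  have h2 : HasDerivAt (fun t => ⟪gam p e x t, p⟫) (-⟪x, e⟫) 0 := by
    have := (((hasDerivAt_cos 0)).mul_const ⟪x, p⟫).fun_sub ((hasDerivAt_sin 0).mul_const ⟪x, e⟫)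
    simp only [gam_inner_p F.1 hpe]
    simpa using this
  have h3 := (hasDerivAt_iff_tendsto_slope.1 h1).mul (hasDerivAt_iff_tendsto_slope.1 h2)
  have h4 : 0 ≤ - vf p e (U i) x * -⟪x, e⟫ := by
    refine ge_of_tendsto' h3 fun t => ?_
    simp only [slope_def_field, gam_zero]
    have hn := gam_norm F.1 he hpe x t
    have hm := dom_norm S.hΩ hn.symm hx
    rw [div_mul_div_comm]
    refine div_nonneg ?_ (mul_self_nonneg _)
    rcases le_total ⟪x, p⟫ ⟪gam p e x t, p⟫ with h | h
    · exact mul_nonneg (sub_nonneg.2 (F.2 i _ hm _ hx hn h)) (sub_nonneg.2 h)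
    · exact mul_nonneg_of_nonpos_of_nonpos (sub_nonpos.2 (F.2 i _ hx _ hm hn.symm h)) (sub_nonpos.2 h)
  rw [neg_mul_neg] at h4
  exact nonneg_of_mul_nonneg_left h4 hxe

lemma St.vf_zero (S : St Ω f U) {p e : EuclN N} (F : FoliatedSchwarzWith Ω U p) (he : ‖e‖ = 1)
    (hpe : ⟪e, p⟫ = 0) (i : Fin m) {x : EuclN N} (hx : x ∈ Ω) (hxe : ⟪x, e⟫ = 0) :
    vf p e (U i) x = 0 := by
  have h1 := gam_comp p e (S.Ud i hx)
  have := even_deriv h1 (fun t => by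
    have hn := gam_norm F.1 he hpe x
    refine fol_eq F i (dom_norm S.hΩ (hn _).symm hx) (dom_norm S.hΩ (hn _).symm hx)
      ((hn _).trans (hn _).symm) ?_
    rw [gam_inner_p F.1 hpe, gam_inner_p F.1 hpe, hxe]; simp)
  linarith

lemma rotA_cont (p e : EuclN N) : Continuous (rotA p e) := by
  have : ∀ a : EuclN N, Continuous (fun x : EuclN N => ⟪x, a⟫) := fun a =>
    (lin_contDiff a).continuous
  exact ((this p).smul continuous_const).sub ((this e).smul continuous_const)

lemma gam_cont (p e x : EuclN N) : Continuous (gam p e x) := by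
  unfold gam
  have h1 : Continuous (fun t => (cos t - 1) * ⟪x, p⟫ - sin t * ⟪x, e⟫) := by fun_prop
  have h2 : Continuous (fun t => (cos t - 1) * ⟪x, e⟫ + sin t * ⟪x, p⟫) := by fun_prop
  fun_prop

lemma St.vf_bdry (S : St Ω f U) {p e : EuclN N} (hp : ‖p‖ = 1) (he : ‖e‖ = 1)
    (hpe : ⟪e, p⟫ = 0) (i : Fin m) {x : EuclN N} (hx : x ∈ frontier Ω) :
    Tendsto (vf p e (U i)) (𝓝[Ω] x) (𝓝 0) := by
  have hxc : x ∈ closure Ω := frontier_subset_closure hx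
  have hΩo := dom_open S.hΩ
  have h1 : ContDiffWithinAt ℝ (0 + 1) (U i) (closure Ω) x := (S.hU i x hxc).of_le (by norm_num)
  obtain ⟨u, hu, -, f', hf', hc⟩ := (contDiffWithinAt_succ_iff_hasFDerivWithinAt (by simp)).1 h1
  rw [insert_eq_of_mem hxc] at hu
  have hxu : x ∈ u := mem_of_mem_nhdsWithin hxc hu
  have hgm : ∀ t, gam p e x t ∈ frontier Ω := fun t =>
    frontier_norm S.hΩ (gam_norm hp he hpe x t).symm hx
  have hz : f' x (rotA p e x) = 0 := by
    have hgt : Tendsto (gam p e x) (𝓝 0) (𝓝[closure Ω] x) := by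
      refine tendsto_nhdsWithin_iff.2 ⟨?_, Eventually.of_forall fun t =>
        frontier_subset_closure (hgm t)⟩
      have := (gam_cont p e x).tendsto 0
      rwa [gam_zero] at this
    have hpre : gam p e x ⁻¹' u ∈ 𝓝 (0:ℝ) := hgt hu
    have hfx : HasFDerivWithinAt (U i) (f' x) u (gam p e x 0) := by
      rw [gam_zero]; exact hf' x hxu
    have := (hfx.comp_hasDerivWithinAt (s := gam p e x ⁻¹' u) (0:ℝ)
      (gam_deriv p e x).hasDerivWithinAt (fun t ht => ht)).hasDerivAt hpre
    have e0 : U i ∘ gam p e x = fun _ => 0 := funext fun t => S.hsol.2 i _ (hgm t)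
    rw [e0] at this
    exact this.unique (hasDerivAt_const _ _)
  have hfc : Tendsto f' (𝓝[Ω] x) (𝓝 (f' x)) := by
    have := hc.continuousWithinAt.tendsto
    exact this.mono_left ((nhdsWithin_mono x subset_closure).trans (nhdsWithin_le_of_mem hu))
  have hr : Tendsto (rotA p e) (𝓝[Ω] x) (𝓝 (rotA p e x)) :=
    ((rotA_cont p e).tendsto x).mono_left nhdsWithin_le_nhds
  have hlim : Tendsto (fun y => - f' y (rotA p e y)) (𝓝[Ω] x) (𝓝 0) := by
    have : Tendsto (fun y => - f' y (rotA p e y)) (𝓝[Ω] x) (𝓝 (- f' x (rotA p e x))) :=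
      (ContinuousWithinAt.clm_apply (s := Ω) (x := x) hfc hr).neg.tendsto
    rwa [hz, neg_zero] at this
  refine hlim.congr' ?_
  obtain ⟨O, hO, hxO, hOu⟩ := mem_nhdsWithin.1 hu
  filter_upwards [self_mem_nhdsWithin, nhdsWithin_le_nhds (hO.mem_nhds hxO)] with y hy hyO
  have hyu : u ∈ 𝓝 y := by
    filter_upwards [hO.mem_nhds hyO, hΩo.mem_nhds hy] with z hz1 hz2 using hOu ⟨hz1, subset_closure hz2⟩
  rw [vf_eq, ((hf' y (mem_of_mem_nhds hyu)).hasFDerivAt hyu).fderiv]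

lemma St.vf_C2 (S : St Ω f U) (p e : EuclN N) (i : Fin m) : ContDiffOn ℝ 2 (vf p e (U i)) Ω := by
  have hD2 : ∀ b, ContDiffOn ℝ 2 (DD b (U i)) Ω := fun b =>
    DD_contDiffOn (dom_open S.hΩ) (n := 2) (by exact_mod_cast S.U3 i) b
  exact ((lin_contDiff e).contDiffOn.mul (hD2 p)).sub ((lin_contDiff p).contDiffOn.mul (hD2 e))

lemma St.ind_cont (S : St Ω f U) {p e : EuclN N} (hp : ‖p‖ = 1) (he : ‖e‖ = 1)
    (hpe : ⟪e, p⟫ = 0) (i : Fin m) : Continuous (Ω.indicator (vf p e (U i))) := by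
  have hΩo := dom_open S.hΩ
  rw [continuous_iff_continuousAt]
  intro x
  by_cases hx : x ∈ Ω
  · have h1 : ContinuousAt (vf p e (U i)) x :=
      (S.vf_C2 p e i).continuousOn.continuousAt (hΩo.mem_nhds hx)
    refine h1.congr ?_
    filter_upwards [hΩo.mem_nhds hx] with y hy using (indicator_of_mem hy _).symm
  · have h0 : Ω.indicator (vf p e (U i)) x = 0 := indicator_of_notMem hx _
    have h1 : Tendsto (vf p e (U i)) (𝓝[Ω] x) (𝓝 0) := by
      by_cases hc : x ∈ closure Ω
      · exact S.vf_bdry hp he hpe i ⟨hc, by rwa [hΩo.interior_eq]⟩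
      · rw [notMem_closure_iff_nhdsWithin_eq_bot.1 hc]; exact tendsto_bot
    unfold ContinuousAt
    rw [h0, ← nhdsWithin_univ, ← union_compl_self Ω, nhdsWithin_union, tendsto_sup]
    constructor
    · refine h1.congr' ?_
      filter_upwards [self_mem_nhdsWithin] with y hy using (indicator_of_mem hy _).symm
    · refine tendsto_const_nhds.congr' ?_
      filter_upwards [self_mem_nhdsWithin] with y hy using (indicator_of_notMem hy _).symm

lemma St.vf_eqn (S : St Ω f U) {p e : EuclN N} (hp : ‖p‖ = 1) (he : ‖e‖ = 1)
    (hpe : ⟪e, p⟫ = 0) (i : Fin m) {x : EuclN N} (hx : x ∈ Ω) :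
    - lap (vf p e (U i)) x = ∑ j, cc Ω f U i j x * vf p e (U j) x := by
  have hΩo := dom_open S.hΩ
  rw [lap_vf hΩo p e (S.U3 i) hx]
  have hld : DifferentiableAt ℝ (lap (U i)) x := by
    have hD1 : ∀ b b', ContDiffOn ℝ 1 (DD b' (DD b (U i))) Ω := fun b b' =>
      DD_contDiffOn hΩo (n := 1) (by
        have := DD_contDiffOn hΩo (n := 2) (by exact_mod_cast S.U3 i) b
        exact_mod_cast this) b'
    have h1 : ContDiffOn ℝ 1 (fun y => ∑ k, DD (bv k) (DD (bv k) (U i)) y) Ω :=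
      ContDiffOn.sum fun k _ => hD1 _ _
    have h2 := (h1.contDiffAt (hΩo.mem_nhds hx)).differentiableAt (by norm_num)
    refine h2.congr_of_eventuallyEq ?_
    filter_upwards [hΩo.mem_nhds hx] with y hy
    exact lap_eq (((S.U3 i).contDiffAt (hΩo.mem_nhds hy)).of_le (by norm_num))
  have h1 := gam_comp p e hld
  have h2 : HasDerivAt (fun t => fun k => U k (gam p e x t)) (fun k => - vf p e (U k) x) 0 :=
    hasDerivAt_pi.2 fun k => gam_comp p e (S.Ud k hx)
  have hfd : DifferentiableAt ℝ (f i ‖x‖) (fun k => U k x) := by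
    have := ((S.hf i).comp (contDiff_prodMk_right ‖x‖)).differentiable (by norm_num)
    exact this _
  have h3 : HasDerivAt (fun t => f i ‖x‖ (fun k => U k (gam p e x t)))
      (fderiv ℝ (f i ‖x‖) (fun k => U k x) (fun k => - vf p e (U k) x)) 0 := by
    have h4 : HasFDerivAt (f i ‖x‖) (fderiv ℝ (f i ‖x‖) (fun k => U k x))
        ((fun t => fun k => U k (gam p e x t)) 0) := by
      simp only [gam_zero]; exact hfd.hasFDerivAt
    exact h4.comp_hasDerivAt (0:ℝ) h2
  have he2 : (fun t => lap (U i) (gam p e x t)) =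
      fun t => - f i ‖x‖ (fun k => U k (gam p e x t)) := by
    funext t
    have hn := gam_norm hp he hpe x t
    have := S.hsol.1 i _ (dom_norm S.hΩ hn.symm hx)
    rw [hn] at this; linarith
  rw [he2] at h1
  have h5 := h1.unique h3.fun_neg
  rw [h5, sum_pd, ← Finset.sum_neg_distrib]
  refine Finset.sum_congr rfl fun j _ => ?_
  rw [cc_apply hx]; ring

end

lemma green2 {D : Set (EuclN N)} (hD : IsOpen D) {φ g : EuclN N → ℝ}
    (hφ : ContDiff ℝ 2 φ) (hc : HasCompactSupport φ) (hs : tsupport φ ⊆ D)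
    (hg : ContDiffOn ℝ 2 g D) :
    Integrable (fun x => g x * (- lap φ x)) ∧ Integrable (fun x => φ x * (- lap g x)) ∧
    ∫ x, g x * (- lap φ x) = ∫ x, φ x * (- lap g x) := by
  obtain ⟨-, i2, h⟩ := green hD (hφ.of_le (by norm_num)) hc hs hg
  have hφ1 : ∀ k : Fin N, ContDiff ℝ 1 (DD (bv k) φ) := fun k => by
    rw [← contDiffOn_univ]
    exact DD_contDiffOn isOpen_univ (n := 1) (by simpa using hφ.contDiffOn) _
  have H : ∀ k : Fin N, _ := fun k =>
    ibp hD (hφ1 k) (DD_hcs hc (bv k)) ((tsupport_DD φ (bv k)).trans hs)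
      (hg.of_le (by norm_num)) (bv k)
  have e1 : (fun x => g x * (- lap φ x)) = fun x => ∑ k, - (DD (bv k) (DD (bv k) φ) x * g x) := by
    funext x
    rw [lap_eq hφ.contDiffAt, Finset.sum_neg_distrib, ← Finset.sum_mul]; ring
  refine ⟨?_, i2, ?_⟩
  · rw [e1]; exact integrable_finsetSum _ fun k _ => (H k).2.1.neg
  · have hn : ∀ k : Fin N, Integrable (fun x => - (DD (bv k) (DD (bv k) φ) x * g x)) :=
      fun k => (H k).2.1.neg
    rw [← h, e1, integral_finsetSum _ fun k _ => hn k,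
      integral_finsetSum _ fun k _ => (H k).1]
    refine Finset.sum_congr rfl fun k _ => ?_
    rw [integral_neg, (H k).2.2]

end
end SC

namespace SC
open Topology Filter

noncomputable section

variable {N m : ℕ}

section
variable {Ω : Set (EuclN N)} {f : Fin m → ℝ → (Fin m → ℝ) → ℝ} {U : Fin m → EuclN N → ℝ}

lemma St.stepC (S : St Ω f U) {p e : EuclN N} (F : FoliatedSchwarzWith Ω U p) (he : ‖e‖ = 1)
    (hpe : ⟪e, p⟫ = 0) (hQ : ∀ Ψ, IsTestFun (halfDom Ω e) Ψ → 0 ≤ QQ (cc Ω f U) Ψ) :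
    (∀ i, ∀ x ∈ halfDom Ω e, ∑ j, (cc Ω f U i j x - cc Ω f U j i x) * vf p e (U j) x = 0) ∧
    ((∀ i, ∀ x ∈ halfDom Ω e, vf p e (U i) x = 0) ∨
      ∀ i, ∀ O : Set (EuclN N), IsOpen O → O ⊆ halfDom Ω e → O.Nonempty →
      ∃ x ∈ O, vf p e (U i) x ≠ 0) := by
  have hp := F.1
  set D := halfDom Ω e with hDdef
  have hD : IsOpen D := half_open S.hΩ e
  have hb : Bornology.IsBounded D := (dom_bdd S.hΩ).subset (half_sub Ω e)
  set v : Fin m → EuclN N → ℝ := fun i => {x : EuclN N | 0 < ⟪x, e⟫}.indicator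
    (Ω.indicator (vf p e (U i))) with hv
  have hvD : ∀ i, ∀ x ∈ D, v i x = vf p e (U i) x := by
    intro i x hx
    simp only [hv]
    rw [indicator_of_mem (show x ∈ {x : EuclN N | 0 < ⟪x, e⟫} from hx.2), indicator_of_mem hx.1]
  have hv0 : ∀ i x, x ∉ D → v i x = 0 := by
    intro i x hx
    simp only [hv]
    by_cases hx2 : x ∈ {x : EuclN N | 0 < ⟪x, e⟫}
    · rw [indicator_of_mem hx2, indicator_of_notMem fun h => hx ⟨h, hx2⟩]
    · exact indicator_of_notMem hx2 _
  have hvn : ∀ i x, max (v i x) 0 = v i x := by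
    intro i x
    refine max_eq_left ?_
    by_cases hx : x ∈ D
    · rw [hvD i x hx]; exact S.vf_nonneg F he hpe i hx.1 hx.2
    · exact (hv0 i x hx).ge
  have hic : Continuous (fun x : EuclN N => ⟪x, e⟫) := (lin_contDiff e).continuous
  have hfr : frontier {x : EuclN N | 0 < ⟪x, e⟫} ⊆ {x | 0 = ⟪x, e⟫} :=
    frontier_lt_subset_eq continuous_const hic
  have hvc : ∀ i, Continuous (v i) := by
    intro i
    refine continuous_indicator (fun x hx => ?_) (S.ind_cont hp he hpe i).continuousOn
    have h0 : (0:ℝ) = ⟪x, e⟫ := hfr hx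
    by_cases hxΩ : x ∈ Ω
    · rw [indicator_of_mem hxΩ]; exact S.vf_zero F he hpe i hxΩ h0.symm
    · exact indicator_of_notMem hxΩ _
  have hv2 : ∀ i, ContDiffOn ℝ 2 (v i) D := fun i =>
    ((S.vf_C2 p e i).mono (half_sub Ω e)).congr (hvD i)
  have hvb : ∀ i, ∃ K, ∀ x, |v i x| ≤ K := by
    intro i
    have hcs : HasCompactSupport (v i) := hcs_of_zero hb (hv0 i)
    obtain ⟨K, hK⟩ := hcs.exists_bound_of_continuous (hvc i)
    exact ⟨K, fun x => by simpa using hK x⟩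
  choose K hK using hvb
  obtain ⟨C, hC⟩ := S.cc_bdd
  set h : Fin m → EuclN N → ℝ := fun i x => ∑ j, cc Ω f U i j x * v j x with hh
  have hhm : ∀ i, Measurable (h i) := fun i =>
    Finset.measurable_fun_sum _ fun j _ => (S.cc_meas i j).mul (hvc j).measurable
  have hhb : ∀ i, ∃ K, ∀ x, |h i x| ≤ K := by
    intro i
    refine ⟨∑ j, C * K j, fun x => (Finset.abs_sum_le_sum_abs _ _).trans
      (Finset.sum_le_sum fun j _ => ?_)⟩
    rw [abs_mul]
    exact mul_le_mul (hC i j x) (hK j x) (abs_nonneg _) ((abs_nonneg _).trans (hC i j x))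
  have hlap : ∀ i, ∀ x ∈ D, - lap (v i) x = h i x := by
    intro i x hx
    have h1 : v i =ᶠ[𝓝 x] vf p e (U i) := by
      filter_upwards [hD.mem_nhds hx] with y hy using hvD i y hy
    rw [lap_congr h1, S.vf_eqn hp he hpe i hx.1]
    exact Finset.sum_congr rfl fun j _ => by rw [hvD j x hx]
  obtain ⟨hid, hdich⟩ := S.apply_core he hQ hvc hv0 hv2 hhm hhb hlap (by
    intro x _
    simp only [hvn, hh, Finset.mul_sum]
    refine le_of_eq (Finset.sum_congr rfl fun i _ => Finset.sum_congr rfl fun j _ => ?_)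
    ring)
  simp only [hvn] at hid hdich
  constructor
  · intro i
    set G : EuclN N → ℝ := fun x => ∑ j, (cc Ω f U i j x - cc Ω f U j i x) * v j x with hG
    have hGc : ContinuousOn G D := by
      refine continuousOn_finsetSum _ fun j _ => ContinuousOn.mul ?_ (hvc j).continuousOn
      exact ((S.cc_cont i j).sub (S.cc_cont j i)).mono (half_sub Ω e)
    have hae : ∀ᵐ x, x ∈ D → G x = 0 := by
      refine hD.ae_eq_zero_of_integral_contDiff_smul_eq_zero (hGc.locallyIntegrableOn hD.measurableSet) ?_
      intro φ hφ hc hs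
      have hφ2 : ContDiff ℝ 2 φ := contDiff_infty.1 hφ 2
      obtain ⟨i1, i2, h3⟩ := green2 hD hφ2 hc hs (hv2 i)
      have h4 := hid i φ hφ2 hc hs
      have e1 : (fun x => φ x * (- lap (v i) x)) = fun x => φ x * h i x := by
        funext x
        by_cases hx : x ∈ D
        · rw [hlap i x hx]
        · rw [zero_of_notMem hs hx]; ring
      rw [e1] at i2 h3
      obtain ⟨Kφ, hKφ⟩ := hc.exists_bound_of_continuous hφ.continuous
      have i5 : Integrable (fun x => φ x * (∑ j, cc Ω f U j i x * v j x)) := by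
        refine integrable_of_bdd hb (K := Kφ * ∑ j, C * K j) ?_ ?_ ?_
        · exact hφ.continuous.measurable.mul
            (Finset.measurable_fun_sum _ fun j _ => (S.cc_meas j i).mul (hvc j).measurable)
        · intro x
          rw [abs_mul]
          refine mul_le_mul (by simpa using hKφ x) ?_ (abs_nonneg _)
            ((norm_nonneg _).trans (hKφ x))
          refine (Finset.abs_sum_le_sum_abs _ _).trans (Finset.sum_le_sum fun j _ => ?_)
          rw [abs_mul]
          exact mul_le_mul (hC j i x) (hK j x) (abs_nonneg _) ((abs_nonneg _).trans (hC j i x))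
        · intro x hx
          rw [zero_of_notMem hs hx, zero_mul]
      have e2 : (fun x => 2 * (v i x * (- lap φ x)) -
          (∑ j, (cc Ω f U i j x + cc Ω f U j i x) * v j x) * φ x) = fun x =>
          2 * (v i x * (- lap φ x)) - (φ x * h i x + φ x * (∑ j, cc Ω f U j i x * v j x)) := by
        funext x
        simp only [hh, add_mul, Finset.sum_add_distrib]; ring
      have i6 : Integrable (fun x => φ x * h i x + φ x * (∑ j, cc Ω f U j i x * v j x)) := i2.add i5
      rw [e2, integral_sub (i1.const_mul 2) i6, integral_const_mul, h3,
        integral_add i2 i5] at h4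
      have e3 : (fun x => φ x • G x) = fun x =>
          φ x * h i x - φ x * (∑ j, cc Ω f U j i x * v j x) := by
        funext x
        simp only [hG, hh, sub_mul, Finset.sum_sub_distrib, smul_eq_mul]; ring
      rw [e3, integral_sub i2 i5]
      linarith
    have heq : EqOn G (fun _ => 0) D := by
      refine Measure.eqOn_open_of_ae_eq (μ := volume) ?_ hD hGc continuousOn_const
      rw [Filter.EventuallyEq, ae_restrict_iff' hD.measurableSet]
      exact hae
    intro x hx
    have := heq hx
    simp only [hG] at this
    rw [← this]
    exact Finset.sum_congr rfl fun j _ => by rw [hvD j x hx]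
  · rcases hdich with h1 | h1
    · exact Or.inl fun i x hx => by rw [← hvD i x hx]; exact h1 i x hx
    · refine Or.inr fun i O hO hOD hne => ?_
      obtain ⟨x, hx, hx2⟩ := h1 i O hO hOD hne
      exact ⟨x, hx, by rwa [← hvD i x (hOD hx)]⟩

end

end
end SC

namespace SC
open Topology Filter

noncomputable section

variable {N m : ℕ}

lemma exists_perp (hN : 2 ≤ N) (p : EuclN N) : ∃ e : EuclN N, ‖e‖ = 1 ∧ ⟪e, p⟫ = 0 := by
  have h : (ℝ ∙ p)ᗮ ≠ ⊥ := by
    intro h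
    rw [Submodule.orthogonal_eq_bot_iff] at h
    have h1 : Module.finrank ℝ (ℝ ∙ p) = N := by
      rw [h, finrank_top]; exact finrank_euclideanSpace_fin
    have h2 : Module.finrank ℝ (ℝ ∙ p) ≤ 1 := by
      have := finrank_span_le_card (R := ℝ) ({p} : Set (EuclN N))
      simpa using this
    omega
  obtain ⟨v, hv, hv0⟩ := Submodule.exists_mem_ne_zero_of_ne_bot h
  refine ⟨‖v‖⁻¹ • v, norm_smul_inv_norm hv0, ?_⟩
  rw [real_inner_smul_left, Submodule.mem_orthogonal_singleton_iff_inner_left.1 hv, mul_zero]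

/-- polar curve -/
def PP (p e : EuclN N) (r t : ℝ) : EuclN N := r • (cos t • p + sin t • e)

section
variable {p e : EuclN N}

lemma PP_p (hp : ‖p‖ = 1) (hpe : ⟪e, p⟫ = 0) (r t : ℝ) : ⟪PP p e r t, p⟫ = r * cos t := by
  unfold PP
  rw [real_inner_smul_left, inner_add_left, real_inner_smul_left, real_inner_smul_left, hpe,
    real_inner_self_eq_norm_sq, hp]; ring

lemma PP_e (he : ‖e‖ = 1) (hpe : ⟪e, p⟫ = 0) (r t : ℝ) : ⟪PP p e r t, e⟫ = r * sin t := by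
  unfold PP
  rw [real_inner_smul_left, inner_add_left, real_inner_smul_left, real_inner_smul_left,
    real_inner_comm e p, hpe, real_inner_self_eq_norm_sq, he]; ring

lemma PP_gam (hp : ‖p‖ = 1) (he : ‖e‖ = 1) (hpe : ⟪e, p⟫ = 0) (r t s : ℝ) :
    gam p e (PP p e r t) s = PP p e r (t + s) := by
  unfold gam
  rw [PP_p hp hpe, PP_e he hpe]
  unfold PP
  rw [cos_add, sin_add]
  module

lemma PP_norm (hp : ‖p‖ = 1) (he : ‖e‖ = 1) (hpe : ⟪e, p⟫ = 0) {r : ℝ} (hr : 0 ≤ r) (t : ℝ) :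
    ‖PP p e r t‖ = r := by
  have h := gam_norm hp he hpe (PP p e r 0) t
  rw [PP_gam hp he hpe, zero_add] at h
  rw [h]
  unfold PP
  simp [norm_smul, hp, abs_of_nonneg hr]

end

section
variable {Ω : Set (EuclN N)} {f : Fin m → ℝ → (Fin m → ℝ) → ℝ} {U : Fin m → EuclN N → ℝ}
  {p e : EuclN N}

lemma cos_ang (hp : ‖p‖ = 1) (x : EuclN N) :
    ‖x‖ * cos (arccos (⟪x, p⟫ / ‖x‖)) = ⟪x, p⟫ := by
  have h : |⟪x, p⟫ / ‖x‖| ≤ 1 := by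
    have := abs_real_inner_div_norm_mul_norm_le_one x p
    rwa [hp, mul_one] at this
  rw [cos_arccos (abs_le.1 h).1 (abs_le.1 h).2]
  by_cases hx : ‖x‖ = 0
  · rw [norm_eq_zero] at hx; simp [hx]
  · field_simp

lemma St.PP_mem (S : St Ω f U) (hp : ‖p‖ = 1) (he : ‖e‖ = 1) (hpe : ⟪e, p⟫ = 0) {x : EuclN N}
    (hx : x ∈ Ω) (t : ℝ) : PP p e ‖x‖ t ∈ Ω :=
  dom_norm S.hΩ (PP_norm hp he hpe (norm_nonneg x) t).symm hx

lemma St.U_PP (S : St Ω f U) (F : FoliatedSchwarzWith Ω U p) (he : ‖e‖ = 1) (hpe : ⟪e, p⟫ = 0)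
    {x : EuclN N} (hx : x ∈ Ω) (i : Fin m) :
    U i x = U i (PP p e ‖x‖ (arccos (⟪x, p⟫ / ‖x‖))) := by
  refine fol_eq F i hx (S.PP_mem F.1 he hpe hx _)
    (PP_norm F.1 he hpe (norm_nonneg x) _).symm ?_
  rw [PP_p F.1 hpe, cos_ang F.1]

lemma St.PP_deriv (S : St Ω f U) (hp : ‖p‖ = 1) (he : ‖e‖ = 1) (hpe : ⟪e, p⟫ = 0)
    {r t : ℝ} (hx : PP p e r t ∈ Ω) (i : Fin m) :
    HasDerivAt (fun t => U i (PP p e r t)) (- vf p e (U i) (PP p e r t)) t := by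
  have h1 := gam_comp p e (S.Ud i hx)
  simp only [PP_gam hp he hpe] at h1
  rw [← sub_self t] at h1
  have h2 := h1.comp_sub_const t t
  simpa using h2

lemma PP_e_nonneg (he : ‖e‖ = 1) (hpe : ⟪e, p⟫ = 0) {r t : ℝ} (hr : 0 ≤ r) (h0 : 0 ≤ t)
    (h1 : t ≤ π) : 0 ≤ ⟪PP p e r t, e⟫ := by
  rw [PP_e he hpe]; exact mul_nonneg hr (sin_nonneg_of_nonneg_of_le_pi h0 h1)

lemma St.concl (S : St Ω f U) (F : FoliatedSchwarzWith Ω U p) (he : ‖e‖ = 1)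
    (hpe : ⟪e, p⟫ = 0) (hQ : ∀ Ψ, IsTestFun (halfDom Ω e) Ψ → 0 ≤ QQ (cc Ω f U) Ψ)
    (hr : ¬ IsRadial Ω U) :
    (∃ p : EuclN N, ‖p‖ = 1 ∧ FoliatedSchwarzWith Ω U p ∧
      ∃ V : Fin m → ℝ → ℝ → ℝ,
        (∀ i, ∀ x ∈ Ω, U i x = V i ‖x‖ (Real.arccos (⟪x, p⟫ / ‖x‖))) ∧
        ∀ i, ∀ x ∈ Ω,
          (∑ j, pd (f i) j ‖x‖ (fun k => V k ‖x‖ (Real.arccos (⟪x, p⟫ / ‖x‖))) *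
              deriv (fun t => V j ‖x‖ t) (Real.arccos (⟪x, p⟫ / ‖x‖))) =
          (∑ j, pd (f j) i ‖x‖ (fun k => V k ‖x‖ (Real.arccos (⟪x, p⟫ / ‖x‖))) *
              deriv (fun t => V j ‖x‖ t) (Real.arccos (⟪x, p⟫ / ‖x‖)))) ∧
    (m = 2 → ∀ x ∈ Ω, ∀ i j,
      pd (f i) j ‖x‖ (fun k => U k x) = pd (f j) i ‖x‖ (fun k => U k x)) := by
  have hp := F.1
  have hΩo := dom_open S.hΩ
  obtain ⟨hC, hdich⟩ := S.stepC F he hpe hQ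
  refine ⟨⟨p, hp, F, fun i r t => U i (PP p e r t), fun i x hx => S.U_PP F he hpe hx i, ?_⟩, ?_⟩
  · intro i x hx
    set θ := arccos (⟪x, p⟫ / ‖x‖) with hθ
    have hy := S.PP_mem hp he hpe hx θ
    have hyn := PP_norm hp he hpe (norm_nonneg x) θ
    have hye := PP_e_nonneg he hpe (norm_nonneg x) (arccos_nonneg (⟪x, p⟫ / ‖x‖)) (arccos_le_pi _)
    rw [← hθ] at hye
    set y := PP p e ‖x‖ θ with hydef
    have hd : ∀ j, deriv (fun t => U j (PP p e ‖x‖ t)) θ = - vf p e (U j) y := fun j =>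
      (S.PP_deriv hp he hpe hy j).deriv
    simp only [hd, ← hydef]
    rw [← hyn]
    have hcc : ∀ i j, pd (f i) j ‖y‖ (fun k => U k y) = cc Ω f U i j y := fun i j =>
      (cc_apply hy i j).symm
    simp only [hcc]
    rcases hye.eq_or_lt with h | h
    · simp [S.vf_zero F he hpe _ hy h.symm]
    · have := hC i y ⟨hy, h⟩
      simp only [sub_mul, Finset.sum_sub_distrib] at this
      simp only [mul_neg, Finset.sum_neg_distrib]
      linarith
  · intro hm2 x hx i j
    by_cases hij : i = j
    · rw [hij]
    have hd2 : ∀ i, ∀ O : Set (EuclN N), IsOpen O → O ⊆ halfDom Ω e → O.Nonempty →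
        ∃ x ∈ O, vf p e (U i) x ≠ 0 := by
      rcases hdich with h | h
      · exfalso
        apply hr
        have key : ∀ i, ∀ x ∈ Ω, U i x = U i (PP p e ‖x‖ 0) := by
          intro i x hx
          rw [S.U_PP F he hpe hx i]
          have hder := fun t => S.PP_deriv hp he hpe (S.PP_mem hp he hpe hx t) i
          refine constant_of_has_deriv_right_zero (a := 0) (b := π)
            (f := fun t => U i (PP p e ‖x‖ t))
            (fun t _ => (hder t).continuousAt.continuousWithinAt) ?_ _
            ⟨arccos_nonneg _, arccos_le_pi _⟩
          intro t ht
          have hm := S.PP_mem hp he hpe hx t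
          have h0 : vf p e (U i) (PP p e ‖x‖ t) = 0 := by
            rcases (PP_e_nonneg he hpe (norm_nonneg x) ht.1 ht.2.le).eq_or_lt with h' | h'
            · exact S.vf_zero F he hpe _ hm h'.symm
            · exact h i _ ⟨hm, h'⟩
          have := hder t
          rw [h0, neg_zero] at this
          exact this.hasDerivWithinAt
        intro i x hx y hy hxy
        rw [key i x hx, key i y hy, hxy]
      · exact h
    have hz : ∀ y ∈ Ω, 0 ≤ ⟪y, e⟫ → cc Ω f U i j y - cc Ω f U j i y = 0 := by
      intro y hy hye
      by_contra hne
      have hc : ContinuousOn (fun x => cc Ω f U i j x - cc Ω f U j i x) Ω :=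
        (S.cc_cont i j).sub (S.cc_cont j i)
      have hO : IsOpen (Ω ∩ (fun x => cc Ω f U i j x - cc Ω f U j i x) ⁻¹' {0}ᶜ) :=
        hc.isOpen_inter_preimage hΩo isOpen_compl_singleton
      set O := Ω ∩ (fun x => cc Ω f U i j x - cc Ω f U j i x) ⁻¹' {0}ᶜ with hOdef
      have hyO : y ∈ O := ⟨hy, hne⟩
      obtain ⟨z, ⟨hz1, hz2⟩, hz3⟩ := hd2 j (O ∩ halfDom Ω e) (hO.inter (half_open S.hΩ e))
        inter_subset_right (by
          have ht : Tendsto (fun s : ℝ => y + s • e) (𝓝[>] 0) (𝓝 y) := by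
            have : Continuous (fun s : ℝ => y + s • e) := by fun_prop
            have h' := this.tendsto 0
            simp only [zero_smul, add_zero] at h'
            exact h'.mono_left nhdsWithin_le_nhds
          obtain ⟨s, hs1, hs2⟩ := ((ht.eventually (hO.mem_nhds hyO)).and
            (self_mem_nhdsWithin : ∀ᶠ s in 𝓝[>] (0:ℝ), s ∈ Ioi (0:ℝ))).exists
          have hs1' : y + s • e ∈ O := hs1
          have hs2' : 0 < s := hs2
          refine ⟨y + s • e, hs1', hs1'.1, ?_⟩
          rw [inner_add_left, real_inner_smul_left, real_inner_self_eq_norm_sq, he]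
          nlinarith)
      have h5 := hC i z hz2
      subst hm2
      rw [Finset.sum_eq_single j] at h5
      · rcases mul_eq_zero.1 h5 with h6 | h6
        · exact hz1.2 h6
        · exact hz3 h6
      · intro k _ hk
        have : k = i := by omega
        rw [this, sub_self, zero_mul]
      · intro h; exact absurd (Finset.mem_univ _) h
    have hy := S.PP_mem hp he hpe hx (arccos (⟪x, p⟫ / ‖x‖))
    have hyn := PP_norm hp he hpe (norm_nonneg x) (arccos (⟪x, p⟫ / ‖x‖))
    have h7 := hz _ hy
      (PP_e_nonneg he hpe (norm_nonneg x) (arccos_nonneg _) (arccos_le_pi _))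
    rw [cc_apply hy, cc_apply hy, hyn] at h7
    have e1 : (fun k => U k x) = fun k => U k (PP p e ‖x‖ (arccos (⟪x, p⟫ / ‖x‖))) :=
      funext fun k => S.U_PP F he hpe hx k
    rw [e1]
    linarith

end

end
end SC

/-- **Corollary (extra coupling condition for nonradial Morse index one solutions).** -/
theorem statement2
    {N m : ℕ} (hN : 2 ≤ N) (hm : 2 ≤ m)
    (Ω : Set (EuclN N)) (hΩ : IsBallOrAnnulus Ω)
    (f : Fin m → ℝ → (Fin m → ℝ) → ℝ)
    (hf : ∀ i, ContDiff ℝ 1 (fun q : ℝ × (Fin m → ℝ) => f i q.1 q.2))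
    (U : Fin m → EuclN N → ℝ)
    (hUreg : ∀ i, ContDiffOn ℝ 3 (U i) (closure Ω))
    (hsol : IsSolution Ω f U)
    (hcoup : ∀ e : EuclN N, ‖e‖ = 1 → FullyCoupledAlong f U (halfDom Ω e))
    (hmono : ∀ i j (r : ℝ) (s t : Fin m → ℝ), (∀ k, s k ≤ t k) →
      pd (f i) j r s ≤ pd (f i) j r t)
    (hdecomp : 3 ≤ m → ∀ i, ∃ g : Fin m → ℝ → ℝ → ℝ → ℝ,
      (∀ k, ContDiff ℝ 1 (fun q : ℝ × ℝ × ℝ => g k q.1 q.2.1 q.2.2)) ∧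
      ∀ (r : ℝ) (s : Fin m → ℝ), f i r s = ∑ k ∈ Finset.univ.erase i, g k r (s i) (s k))
    (hMorse1 : (∃ Ψ : Fin m → EuclN N → ℝ, IsTestFun Ω Ψ ∧ Qform f U Ω Ψ < 0) ∧
      ¬ NegDefFamily f U Ω 2)
    (hnotrad : ¬ IsRadial Ω U) :
    (∃ p : EuclN N, ‖p‖ = 1 ∧ FoliatedSchwarzWith Ω U p ∧
      ∃ V : Fin m → ℝ → ℝ → ℝ,
        (∀ i, ∀ x ∈ Ω, U i x = V i ‖x‖ (Real.arccos (⟪x, p⟫ / ‖x‖))) ∧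
        ∀ i, ∀ x ∈ Ω,
          (∑ j, pd (f i) j ‖x‖ (fun k => V k ‖x‖ (Real.arccos (⟪x, p⟫ / ‖x‖))) *
              deriv (fun t => V j ‖x‖ t) (Real.arccos (⟪x, p⟫ / ‖x‖))) =
          (∑ j, pd (f j) i ‖x‖ (fun k => V k ‖x‖ (Real.arccos (⟪x, p⟫ / ‖x‖))) *
              deriv (fun t => V j ‖x‖ t) (Real.arccos (⟪x, p⟫ / ‖x‖)))) ∧
    (m = 2 → ∀ x ∈ Ω, ∀ i j,
      pd (f i) j ‖x‖ (fun k => U k x) = pd (f j) i ‖x‖ (fun k => U k x)) := by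
  have S : SC.St Ω f U := ⟨hΩ, hf, hUreg, hsol, hcoup, hmono, hMorse1.2⟩
  obtain ⟨p, F⟩ := S.fol hnotrad
  obtain ⟨e, he, hpe⟩ := SC.exists_perp hN p
  rcases S.morse e with hQ | hQ
  · exact S.concl F he hpe hQ hnotrad
  · exact S.concl F (e := -e) (by rw [norm_neg]; exact he) (by rw [inner_neg_left, hpe, neg_zero])
      hQ hnotrad
end

section
/- (Positive and negative parts of first eigenfunctions of cooperative symmetric systems.) Let Ω be a bounded open set in ℝ^N, N ≥ 2, and C = (c_ij) a symmetric matrix with c_ij ∈ L^∞(Ω), c_ij = c_ji a.e., and c_ij ≤ 0 a.e. for all i ≠ j (cooperative). Set λ_1 := inf{ R(V) : V ∈ C^1_c(Ω;ℝ^m), V ≠ 0 }, where R(V) = B(V,V)/∫_Ω |V|² dx and B(V,Φ) = ∫_Ω [Σ_i ∇v_i·∇φ_i + Σ_{i,j} c_ij v_i φ_j] dx. Let W = (w_1,…,w_m) ∈ C¹(Ω̄;ℝ^m), W = 0 on ∂Ω, be a first eigenfunction, i.e. W ≠ 0 and B(W,V) = λ_1 ∫_Ω W·V dx for every V ∈ C^1_c(Ω;ℝ^m).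 Then if W⁺ = (w_1⁺,…,w_m⁺) is not identically zero, R(W⁺) = λ_1 (so W⁺ is a first eigenfunction), and similarly for W⁻ = (w_1⁻,…,w_m⁻). -/
open MeasureTheory Real Set
open scoped RealInnerProductSpace ENNReal

open Filter Topology in
/-- Uniformly bounded, pointwise convergent sequences on `Ω`. -/
def GoodSeq {N : ℕ} (Ω : Set (EuclN N)) (F : ℕ → EuclN N → ℝ) (f : EuclN N → ℝ) : Prop :=
  (∀ n, AEStronglyMeasurable (F n) (volume.restrict Ω)) ∧
  (∃ K : ℝ, ∀ n, ∀ x ∈ Ω, |F n x| ≤ K) ∧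
  ∀ x ∈ Ω, Tendsto (fun n => F n x) atTop (𝓝 (f x))

section GoodSeqLemmas
open Filter Topology

theorem GoodSeq.add {N : ℕ} {Ω : Set (EuclN N)} {F G : ℕ → EuclN N → ℝ} {f g : EuclN N → ℝ}
    (hF : GoodSeq Ω F f) (hG : GoodSeq Ω G g) :
    GoodSeq Ω (fun n x => F n x + G n x) (fun x => f x + g x) := by
  obtain ⟨a1, ⟨K1, b1⟩, c1⟩ := hF
  obtain ⟨a2, ⟨K2, b2⟩, c2⟩ := hG
  exact ⟨fun n => (a1 n).add (a2 n),
    ⟨K1 + K2, fun n x hx => (abs_add_le _ _).trans (add_le_add (b1 n x hx) (b2 n x hx))⟩,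
    fun x hx => (c1 x hx).add (c2 x hx)⟩

theorem GoodSeq.mul {N : ℕ} {Ω : Set (EuclN N)} {F G : ℕ → EuclN N → ℝ} {f g : EuclN N → ℝ}
    (hF : GoodSeq Ω F f) (hG : GoodSeq Ω G g) :
    GoodSeq Ω (fun n x => F n x * G n x) (fun x => f x * g x) := by
  obtain ⟨a1, ⟨K1, b1⟩, c1⟩ := hF
  obtain ⟨a2, ⟨K2, b2⟩, c2⟩ := hG
  refine ⟨fun n => (a1 n).mul (a2 n),
    ⟨K1 * K2, fun n x hx => ?_⟩,
    fun x hx => (c1 x hx).mul (c2 x hx)⟩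
  rw [abs_mul]
  exact mul_le_mul (b1 n x hx) (b2 n x hx) (abs_nonneg _) ((abs_nonneg _).trans (b1 n x hx))

theorem GoodSeq.const {N : ℕ} {Ω : Set (EuclN N)} {f : EuclN N → ℝ}
    (h : AEStronglyMeasurable f (volume.restrict Ω)) (hb : ∃ K : ℝ, ∀ x ∈ Ω, |f x| ≤ K) :
    GoodSeq Ω (fun _ => f) f :=
  ⟨fun _ => h, hb.imp fun _ hK _ => hK, fun _ _ => tendsto_const_nhds⟩

theorem GoodSeq.sum {N : ℕ} {Ω : Set (EuclN N)} {ι : Type*} (s : Finset ι)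
    {F : ι → ℕ → EuclN N → ℝ} {f : ι → EuclN N → ℝ}
    (hF : ∀ i, GoodSeq Ω (F i) (f i)) :
    GoodSeq Ω (fun n x => ∑ i ∈ s, F i n x) (fun x => ∑ i ∈ s, f i x) := by
  classical
  induction s using Finset.induction_on with
  | empty =>
    simp only [Finset.sum_empty]
    exact GoodSeq.const aestronglyMeasurable_const ⟨0, by simp⟩
  | insert a s ha ih =>
    simp only [Finset.sum_insert ha]
    exact (hF a).add ih

theorem GoodSeq.tendsto {N : ℕ} {Ω : Set (EuclN N)} (hΩo : IsOpen Ω)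
    (hΩb : Bornology.IsBounded Ω) {F : ℕ → EuclN N → ℝ} {f : EuclN N → ℝ}
    (hF : GoodSeq Ω F f) :
    Tendsto (fun n => ∫ x in Ω, F n x) atTop (𝓝 (∫ x in Ω, f x)) := by
  obtain ⟨a1, ⟨K1, b1⟩, c1⟩ := hF
  have : IsFiniteMeasure (volume.restrict Ω) := ⟨by simpa using hΩb.measure_lt_top⟩
  refine tendsto_integral_of_dominated_convergence (fun _ => K1) a1 (integrable_const _) ?_ ?_
  · intro n
    exact (ae_restrict_iff' hΩo.measurableSet).2 (Eventually.of_forall fun x hx => b1 n x hx)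
  · exact (ae_restrict_iff' hΩo.measurableSet).2 (Eventually.of_forall fun x hx => c1 x hx)

theorem GoodSeq.integrable {N : ℕ} {Ω : Set (EuclN N)} (hΩo : IsOpen Ω)
    (hΩb : Bornology.IsBounded Ω) {F : ℕ → EuclN N → ℝ} {f : EuclN N → ℝ}
    (hF : GoodSeq Ω F f) (n : ℕ) : IntegrableOn (F n) Ω := by
  obtain ⟨a1, ⟨K1, b1⟩, c1⟩ := hF
  have : IsFiniteMeasure (volume.restrict Ω) := ⟨by simpa using hΩb.measure_lt_top⟩
  refine Integrable.of_bound (a1 n) K1 ?_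
  exact (ae_restrict_iff' hΩo.measurableSet).2 (Eventually.of_forall fun x hx => b1 n x hx)

theorem GoodSeq.lim {N : ℕ} {Ω : Set (EuclN N)} (hΩo : IsOpen Ω)
    {F : ℕ → EuclN N → ℝ} {f : EuclN N → ℝ}
    (hF : GoodSeq Ω F f) : GoodSeq Ω (fun _ => f) f := by
  obtain ⟨a1, ⟨K1, b1⟩, c1⟩ := hF
  refine GoodSeq.const (aestronglyMeasurable_of_tendsto_ae atTop a1 ?_) ⟨K1, fun x hx => ?_⟩
  · exact (ae_restrict_iff' hΩo.measurableSet).2 (Eventually.of_forall fun x hx => c1 x hx)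
  · exact le_of_tendsto (c1 x hx).abs (Eventually.of_forall fun n => b1 n x hx)

/-! Truncation -/

theorem exists_trunc : ∃ G : ℝ → ℝ, ContDiff ℝ 1 G ∧ (∀ u, |G u| ≤ |u|) ∧ (∀ u ≤ 1, G u = 0) ∧
    (∀ u, 2 ≤ u → G u = u) ∧ (∃ K, ∀ u, |deriv G u| ≤ K) ∧ (∀ u < 1, deriv G u = 0) ∧
    (∀ u, 2 < u → deriv G u = 1) := by
  have hG : ContDiff ℝ 1 (fun u : ℝ => u * Real.smoothTransition (u - 1)) :=
    contDiff_id.mul (Real.smoothTransition.contDiff.comp (contDiff_id.sub contDiff_const))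
  have h0 : ∀ u : ℝ, u ≤ 1 → u * Real.smoothTransition (u - 1) = 0 := fun u hu => by
    rw [Real.smoothTransition.zero_of_nonpos (by linarith), mul_zero]
  have h1 : ∀ u : ℝ, 2 ≤ u → u * Real.smoothTransition (u - 1) = u := fun u hu => by
    rw [Real.smoothTransition.one_of_one_le (by linarith), mul_one]
  have d0 : ∀ u : ℝ, u < 1 → deriv (fun u : ℝ => u * Real.smoothTransition (u - 1)) u = 0 := by
    intro u hu
    have : (fun u : ℝ => u * Real.smoothTransition (u - 1)) =ᶠ[𝓝 u] fun _ => 0 := by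
      filter_upwards [Iio_mem_nhds hu] with v hv using h0 v (le_of_lt hv)
    rw [this.deriv_eq]; simp
  have d1 : ∀ u : ℝ, 2 < u → deriv (fun u : ℝ => u * Real.smoothTransition (u - 1)) u = 1 := by
    intro u hu
    have : (fun u : ℝ => u * Real.smoothTransition (u - 1)) =ᶠ[𝓝 u] fun v => v := by
      filter_upwards [Ioi_mem_nhds hu] with v hv using h1 v (le_of_lt hv)
    rw [this.deriv_eq]; simp
  refine ⟨_, hG, fun u => ?_, h0, h1, ?_, d0, d1⟩
  · rw [abs_mul]
    refine mul_le_of_le_one_right (abs_nonneg _) ?_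
    rw [abs_of_nonneg (Real.smoothTransition.nonneg _)]
    exact Real.smoothTransition.le_one _
  · have hc := hG.continuous_deriv le_rfl
    obtain ⟨K, hK⟩ := (isCompact_Icc (a := (1:ℝ)) (b := 2)).exists_bound_of_continuousOn
      hc.continuousOn
    refine ⟨max K 1, fun u => ?_⟩
    rcases lt_or_ge u 1 with h | h
    · rw [d0 u h]; simp
    · rcases lt_or_ge 2 u with h' | h'
      · rw [d1 u h']; simp
      · exact (hK u ⟨h, h'⟩).trans (le_max_left _ _)

theorem bounded_grad {N : ℕ} {Ω : Set (EuclN N)} (hΩo : IsOpen Ω)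
    (hΩb : Bornology.IsBounded Ω) {w : EuclN N → ℝ} (hw : ContDiffOn ℝ 1 w (closure Ω)) :
    ∃ K : ℝ, ∀ x ∈ Ω, ‖gradient w x‖ ≤ K := by
  have hc : IsCompact (closure Ω) := hΩb.isCompact_closure
  have key : ∃ K : ℝ, ∀ x ∈ closure Ω, x ∈ Ω → ‖fderiv ℝ w x‖ ≤ K := by
    refine hc.induction_on (p := fun s => ∃ K : ℝ, ∀ x ∈ s, x ∈ Ω → ‖fderiv ℝ w x‖ ≤ K)
      ⟨0, by simp⟩ ?_ ?_ ?_
    · rintro s t hst ⟨K, hK⟩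
      exact ⟨K, fun x hx => hK x (hst hx)⟩
    · rintro s t ⟨K, hK⟩ ⟨L, hL⟩
      refine ⟨max K L, fun x hx hxΩ => ?_⟩
      rcases hx with hx | hx
      · exact (hK x hx hxΩ).trans (le_max_left _ _)
      · exact (hL x hx hxΩ).trans (le_max_right _ _)
    · intro x hx
      have h := hw x hx
      rw [show (1 : WithTop ℕ∞) = 0 + 1 by simp,
        contDiffWithinAt_succ_iff_hasFDerivWithinAt (by simp)] at h
      obtain ⟨u, hu, -, f', hf', hcf⟩ := h
      rw [insert_eq_of_mem hx] at hu
      have hev : ∀ᶠ y in 𝓝[u] x, ‖f' y‖ < ‖f' x‖ + 1 :=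
        hcf.continuousWithinAt.norm.eventually (Iio_mem_nhds (by linarith))
      have hev' : {y | ‖f' y‖ < ‖f' x‖ + 1} ∈ 𝓝[closure Ω] x :=
        nhdsWithin_le_of_mem hu hev
      obtain ⟨O, hO, hxO, hOu⟩ := mem_nhdsWithin.1 hu
      refine ⟨O ∩ {y | ‖f' y‖ < ‖f' x‖ + 1}, inter_mem (mem_nhdsWithin_of_mem_nhds
        (hO.mem_nhds hxO)) hev', ‖f' x‖ + 1, ?_⟩
      rintro y ⟨hyO, hy⟩ hyΩ
      have hyu : u ∈ 𝓝 y := by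
        filter_upwards [hO.mem_nhds hyO, hΩo.mem_nhds hyΩ] with z hz hz'
          using hOu ⟨hz, subset_closure hz'⟩
      rw [((hf' y (mem_of_mem_nhds hyu)).hasFDerivAt hyu).fderiv]
      exact le_of_lt hy
  obtain ⟨K, hK⟩ := key
  refine ⟨K, fun x hx => ?_⟩
  have := hK x (subset_closure hx) hx
  simpa [gradient] using this

theorem rayleigh_le {N m : ℕ} {Ω : Set (EuclN N)} (hΩo : IsOpen Ω)
    (hΩb : Bornology.IsBounded Ω)
    (C : Fin m → Fin m → EuclN N → ℝ)
    (hmeas : ∀ i j, Measurable (C i j))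
    (hbdd : ∀ i j, ∃ M : ℝ, ∀ x ∈ Ω, |C i j x| ≤ M)
    (V : Fin m → EuclN N → ℝ) (hV : IsTestFun Ω V) :
    lamOneSym Ω C * ∫ x in Ω, ∑ i, (V i x) ^ 2 ≤ BformL Ω C V V := by
  choose M hM using hbdd
  set K : ℝ := ∑ i, ∑ j, |M i j| with hK
  have hK0 : 0 ≤ K := Finset.sum_nonneg fun i _ => Finset.sum_nonneg fun j _ => abs_nonneg _
  have lower : ∀ Ψ : Fin m → EuclN N → ℝ, IsTestFun Ω Ψ →
      -K * ∫ x in Ω, ∑ i, (Ψ i x) ^ 2 ≤ BformL Ω C Ψ Ψ := by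
    intro Ψ hΨ
    have gΨ : ∀ i, GoodSeq Ω (fun _ => Ψ i) (Ψ i) := fun i => by
      refine GoodSeq.const (hΨ i).1.continuous.aestronglyMeasurable ?_
      obtain ⟨B, hB⟩ := (hΨ i).2.1.exists_bound_of_continuous (hΨ i).1.continuous
      exact ⟨B, fun x _ => hB x⟩
    have gC : ∀ i j, GoodSeq Ω (fun _ => C i j) (C i j) := fun i j =>
      GoodSeq.const (hmeas i j).aestronglyMeasurable ⟨M i j, hM i j⟩
    have hgc : ∀ i, Continuous (gradient (Ψ i)) := fun i =>
      (InnerProductSpace.toDual ℝ (EuclN N)).symm.continuous.comp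
        ((hΨ i).1.continuous_fderiv one_ne_zero)
    have gD : ∀ i, GoodSeq Ω (fun _ x => ⟪gradient (Ψ i) x, gradient (Ψ i) x⟫)
        (fun x => ⟪gradient (Ψ i) x, gradient (Ψ i) x⟫) := fun i => by
      have hcont : Continuous fun x => ⟪gradient (Ψ i) x, gradient (Ψ i) x⟫ :=
        (hgc i).inner (hgc i)
      refine GoodSeq.const hcont.aestronglyMeasurable ?_
      obtain ⟨B, hB⟩ := hΩb.isCompact_closure.exists_bound_of_continuousOn hcont.continuousOn
      exact ⟨B, fun x hx => hB x (subset_closure hx)⟩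
    have int1 := ((GoodSeq.sum Finset.univ fun i => (gΨ i).mul (gΨ i))).integrable hΩo hΩb 0
    have int2 := ((GoodSeq.sum Finset.univ gD).add (GoodSeq.sum Finset.univ fun i =>
      GoodSeq.sum Finset.univ fun j => ((gC i j).mul (gΨ i)).mul (gΨ j))).integrable hΩo hΩb 0
    rw [← integral_const_mul]
    simp only [← sq] at int1
    refine setIntegral_mono_on (int1.const_mul _) int2 hΩo.measurableSet fun x hx => ?_
    have h1 : 0 ≤ ∑ i, ⟪gradient (Ψ i) x, gradient (Ψ i) x⟫ :=
      Finset.sum_nonneg fun i _ => real_inner_self_nonneg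
    set S := ∑ i, (Ψ i x) ^ 2 with hS
    have hSi : ∀ i, (Ψ i x) ^ 2 ≤ S := fun i =>
      Finset.single_le_sum (f := fun i => (Ψ i x) ^ 2) (fun i _ => sq_nonneg _)
        (Finset.mem_univ i)
    have h2 : -K * S ≤ ∑ i, ∑ j, C i j x * Ψ i x * Ψ j x := by
      rw [hK, ← Finset.sum_neg_distrib, Finset.sum_mul]
      refine Finset.sum_le_sum fun i _ => ?_
      rw [← Finset.sum_neg_distrib, Finset.sum_mul]
      refine Finset.sum_le_sum fun j _ => ?_
      have hm : |C i j x| ≤ |M i j| := (hM i j x hx).trans (le_abs_self _)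
      have hp : |Ψ i x * Ψ j x| ≤ S := by
        rw [abs_le]
        constructor <;> nlinarith [hSi i, hSi j, sq_nonneg (Ψ i x - Ψ j x),
          sq_nonneg (Ψ i x + Ψ j x)]
      have : |C i j x * Ψ i x * Ψ j x| ≤ |M i j| * S := by
        rw [mul_assoc, abs_mul]
        exact mul_le_mul hm hp (abs_nonneg _) (abs_nonneg _)
      linarith [neg_abs_le (C i j x * Ψ i x * Ψ j x)]
    linarith
  have hI0 : ∀ Ψ : Fin m → EuclN N → ℝ, 0 ≤ ∫ x in Ω, ∑ i, (Ψ i x) ^ 2 := fun Ψ =>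
    integral_nonneg fun x => Finset.sum_nonneg fun i _ => sq_nonneg _
  rcases (hI0 V).eq_or_lt with h | h
  · have := lower V hV
    rw [← h] at this ⊢
    simpa using this
  · rw [← le_div_iff₀ h]
    refine csInf_le ⟨-K, ?_⟩ ⟨V, hV, ?_, rfl⟩
    · rintro r ⟨Ψ, hΨ, -, rfl⟩
      rcases (hI0 Ψ).eq_or_lt with h' | h'
      · rw [← h']; simpa using hK0
      · rw [le_div_iff₀ h']; exact lower Ψ hΨ
    · by_contra! hne
      simp [hne] at h

theorem main_pos {N m : ℕ}
    (Ω : Set (EuclN N)) (hΩo : IsOpen Ω) (hΩb : Bornology.IsBounded Ω)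
    (C : Fin m → Fin m → EuclN N → ℝ)
    (hmeas : ∀ i j, Measurable (C i j))
    (hbdd : ∀ i j, ∃ M : ℝ, ∀ x ∈ Ω, |C i j x| ≤ M)
    (hcoop : ∀ i j, i ≠ j → ∀ᵐ x ∂(volume : Measure (EuclN N)), x ∈ Ω → C i j x ≤ 0)
    (W : Fin m → EuclN N → ℝ)
    (hWreg : ∀ i, ContDiffOn ℝ 1 (W i) (closure Ω))
    (hWbd : ∀ i, ∀ x ∈ frontier Ω, W i x = 0)
    (heig : ∀ V : Fin m → EuclN N → ℝ, IsTestFun Ω V →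
      BformL Ω C W V = lamOneSym Ω C * ∫ x in Ω, ∑ i, W i x * V i x) :
      (∫ x in Ω, ((∑ i, if 0 < W i x then ‖gradient (W i) x‖ ^ 2 else 0) +
          ∑ i, ∑ j, C i j x * max (W i x) 0 * max (W j x) 0)) =
        lamOneSym Ω C * ∫ x in Ω, ∑ i, (max (W i x) 0) ^ 2 := by
  obtain ⟨G, hG, hGle, hG0, hG2, ⟨K, hK⟩, hd0, hd2⟩ := exists_trunc
  let a : ℕ → ℝ := fun n => (n : ℝ) + 1
  have ha : ∀ n, 0 < a n := fun n => by positivity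
  have haT : Tendsto a atTop atTop := tendsto_natCast_atTop_atTop.atTop_add tendsto_const_nhds
  let V : ℕ → Fin m → EuclN N → ℝ := fun n i =>
    Ω.indicator (fun x => G (a n * W i x) / a n)
  let D : ℕ → Fin m → EuclN N → ℝ := fun n i x => deriv G (a n * W i x)
  have hWat : ∀ i, ∀ x ∈ Ω, ContDiffAt ℝ 1 (W i) x := fun i x hx =>
    (hWreg i).contDiffAt (Filter.mem_of_superset (hΩo.mem_nhds hx) subset_closure)
  have hVx : ∀ n i, ∀ x ∈ Ω, V n i x = G (a n * W i x) / a n := fun n i x hx =>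
    indicator_of_mem hx _
  have hVev : ∀ n i, ∀ x ∈ Ω, V n i =ᶠ[𝓝 x] fun x => G (a n * W i x) / a n := fun n i x hx => by
    filter_upwards [hΩo.mem_nhds hx] with y hy using hVx n i y hy
  have hWm : ∀ i, AEStronglyMeasurable (W i) (volume.restrict Ω) := fun i =>
    ((hWreg i).continuousOn.mono subset_closure).aestronglyMeasurable hΩo.measurableSet
  -- test functions
  have hVtest : ∀ n, IsTestFun Ω (V n) := by
    intro n i
    let S : Set (EuclN N) := closure Ω ∩ W i ⁻¹' Ici (1 / a n)
    have hSc : IsClosed S :=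
      (hWreg i).continuousOn.preimage_isClosed_of_isClosed isClosed_closure isClosed_Ici
    have hSΩ : S ⊆ Ω := by
      rintro x ⟨hx, hx'⟩
      by_contra hn
      have : x ∈ frontier Ω := by rw [frontier, hΩo.interior_eq]; exact ⟨hx, hn⟩
      have h0 := hWbd i x this
      have : 1 / a n ≤ W i x := hx'
      have : 0 < 1 / a n := by have := ha n; positivity
      linarith
    have hV0 : ∀ x, x ∉ S → V n i x = 0 := by
      intro x hx
      by_cases hxΩ : x ∈ Ω
      · rw [hVx n i x hxΩ, hG0, zero_div]
        have : ¬ (1 / a n ≤ W i x) := fun h => hx ⟨subset_closure hxΩ, h⟩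
        rw [not_le, lt_div_iff₀ (ha n)] at this
        linarith
      · exact indicator_of_notMem hxΩ _
    have hts : tsupport (V n i) ⊆ S :=
      closure_minimal (fun x hx => by by_contra h; exact hx (hV0 x h)) hSc
    refine ⟨contDiff_iff_contDiffAt.2 fun x => ?_, ?_, hts.trans hSΩ⟩
    · by_cases hxΩ : x ∈ Ω
      · refine ContDiffAt.congr_of_eventuallyEq ?_ (hVev n i x hxΩ)
        exact (hG.contDiffAt.comp x (contDiffAt_const.mul (hWat i x hxΩ))).div_const _
      · have hxS : x ∉ S := fun h => hxΩ (hSΩ h)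
        have : V n i =ᶠ[𝓝 x] fun _ => 0 := by
          filter_upwards [hSc.isOpen_compl.mem_nhds hxS] with y hy using hV0 y hy
        exact contDiffAt_const.congr_of_eventuallyEq this
    · exact (hΩb.isCompact_closure.of_isClosed_subset hSc inter_subset_left).of_isClosed_subset
        (isClosed_tsupport _) hts
  -- gradients
  have hVgrad : ∀ n i, ∀ x ∈ Ω, gradient (V n i) x = D n i x • gradient (W i) x := by
    intro n i x hx
    have hW := ((hWat i x hx).differentiableAt one_ne_zero).hasFDerivAt
    have hGd : HasDerivAt G (deriv G (a n * W i x)) (a n * W i x) :=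
      (hG.differentiable one_ne_zero _).hasDerivAt
    have h1 := (hGd.comp_hasFDerivAt x (hW.const_mul (a n))).mul_const ((a n)⁻¹)
    have h2 : fderiv ℝ (V n i) x = D n i x • fderiv ℝ (W i) x := by
      rw [(hVev n i x hx).fderiv_eq]
      simp only [div_eq_mul_inv]
      refine h1.fderiv.trans ?_
      rw [smul_comm, smul_smul, smul_smul, mul_assoc, inv_mul_cancel₀ (ha n).ne', mul_one]
    simp [gradient, h2]
  -- good sequences
  have gC : ∀ i j, GoodSeq Ω (fun _ => C i j) (C i j) := fun i j =>
    GoodSeq.const (hmeas i j).aestronglyMeasurable (hbdd i j)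
  have gW : ∀ i, GoodSeq Ω (fun _ => W i) (W i) := fun i => by
    refine GoodSeq.const (hWm i) ?_
    obtain ⟨B, hB⟩ := hΩb.isCompact_closure.exists_bound_of_continuousOn (hWreg i).continuousOn
    exact ⟨B, fun x hx => hB x (subset_closure hx)⟩
  have gQ : ∀ i, GoodSeq Ω (fun _ x => ‖gradient (W i) x‖ ^ 2)
      (fun x => ‖gradient (W i) x‖ ^ 2) := fun i => by
    refine GoodSeq.const ?_ ?_
    · have : Measurable (gradient (W i)) :=
        (InnerProductSpace.toDual ℝ (EuclN N)).symm.continuous.measurable.comp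
          (measurable_fderiv ℝ (W i))
      exact (this.norm.pow_const 2).aestronglyMeasurable
    · obtain ⟨B, hB⟩ := bounded_grad hΩo hΩb (hWreg i)
      refine ⟨B ^ 2, fun x hx => ?_⟩
      rw [abs_of_nonneg (by positivity)]
      exact pow_le_pow_left₀ (norm_nonneg _) (hB x hx) 2
  have gV : ∀ i, GoodSeq Ω (fun n => V n i) (fun x => max (W i x) 0) := fun i => by
    obtain ⟨-, ⟨B, hB⟩, -⟩ := gW i
    refine ⟨fun n => (hVtest n i).1.continuous.aestronglyMeasurable, ⟨B, fun n x hx => ?_⟩,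
      fun x hx => ?_⟩
    · show |V n i x| ≤ B
      rw [hVx n i x hx, abs_div, abs_of_pos (ha n), div_le_iff₀ (ha n)]
      refine (hGle _).trans ?_
      rw [abs_mul, abs_of_pos (ha n), mul_comm]
      exact mul_le_mul_of_nonneg_right (hB 0 x hx) (ha n).le
    · refine tendsto_const_nhds.congr' ?_
      rcases le_or_gt (W i x) 0 with h | h
      · refine Eventually.of_forall fun n => ?_
        show max (W i x) 0 = V n i x
        rw [hVx n i x hx, max_eq_right h, hG0, zero_div]
        nlinarith [ha n]
      · filter_upwards [(haT.atTop_mul_const h).eventually_ge_atTop 2] with n hn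
        rw [hVx n i x hx, max_eq_left h.le, hG2 _ hn, mul_div_cancel_left₀ _ (ha n).ne']
  have gD : ∀ i, GoodSeq Ω (fun n => D n i) (fun x => if 0 < W i x then 1 else 0) := fun i => by
    refine ⟨fun n => ?_, ⟨K, fun n x _ => hK _⟩, fun x hx => ?_⟩
    · exact (hG.continuous_deriv le_rfl).comp_aestronglyMeasurable ((hWm i).const_mul (a n))
    · refine tendsto_const_nhds.congr' ?_
      rcases le_or_gt (W i x) 0 with h | h
      · refine Eventually.of_forall fun n => ?_
        simp only [D]
        rw [hd0 _ (by nlinarith [ha n]), if_neg h.not_gt]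
      · filter_upwards [(haT.atTop_mul_const h).eventually_gt_atTop 2] with n hn
        simp only [D]
        rw [hd2 _ hn, if_pos h]
  set lam := lamOneSym Ω C with hlam
  -- limits
  have gWV := (GoodSeq.sum Finset.univ fun i => (gD i).mul (gQ i)).add
    (GoodSeq.sum Finset.univ fun i => GoodSeq.sum Finset.univ fun j =>
      ((gC i j).mul (gW i)).mul (gV j))
  have gVV := (GoodSeq.sum Finset.univ fun i => ((gD i).mul (gD i)).mul (gQ i)).add
    (GoodSeq.sum Finset.univ fun i => GoodSeq.sum Finset.univ fun j =>
      ((gC i j).mul (gV i)).mul (gV j))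
  have g1 := GoodSeq.sum Finset.univ fun i => (gW i).mul (gV i)
  have g2 := GoodSeq.sum Finset.univ fun i => (gV i).mul (gV i)
  have t1 := tendsto_nhds_unique ((gWV.tendsto hΩo hΩb).congr fun n => by
      rw [← heig (V n) (hVtest n), BformL]
      refine (setIntegral_congr_fun hΩo.measurableSet fun x hx => ?_)
      simp only [hVgrad n _ x hx, real_inner_smul_right, real_inner_self_eq_norm_sq])
    ((g1.tendsto hΩo hΩb).const_mul lam)
  have t2 := le_of_tendsto_of_tendsto' ((g2.tendsto hΩo hΩb).const_mul lam)
    (gVV.tendsto hΩo hΩb) fun n => by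
      have := rayleigh_le hΩo hΩb C hmeas hbdd (V n) (hVtest n)
      simp only [← sq]
      refine this.trans_eq ?_
      rw [BformL]
      refine (setIntegral_congr_fun hΩo.measurableSet fun x hx => ?_)
      simp only [hVgrad n _ x hx, real_inner_smul_right, real_inner_smul_left]
      simp only [real_inner_self_eq_norm_sq, sq, mul_assoc]
  have e1 : ∀ i x, W i x * max (W i x) 0 = max (W i x) 0 * max (W i x) 0 := fun i x => by
    rcases le_total (W i x) 0 with h | h
    · simp [h]
    · simp [h]
  have t3 := setIntegral_mono_ae_restrict (μ := volume) (s := Ω)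
    ((gVV.lim hΩo).integrable hΩo hΩb 0) ((gWV.lim hΩo).integrable hΩo hΩb 0) (by
      have hc : ∀ᵐ x ∂(volume : Measure (EuclN N)), ∀ i j, i ≠ j → x ∈ Ω → C i j x ≤ 0 := by
        simp only [ae_all_iff]
        exact hcoop
      refine (ae_restrict_iff' hΩo.measurableSet).2 ?_
      filter_upwards [hc] with x hx hxΩ
      refine add_le_add (le_of_eq (Finset.sum_congr rfl fun i _ => ?_))
        (Finset.sum_le_sum fun i _ => Finset.sum_le_sum fun j _ => ?_)
      · split_ifs <;> simp
      · by_cases hij : i = j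
        · subst hij
          rw [mul_assoc, mul_assoc, e1]
        · have h1 := hx i j hij hxΩ
          have h2 : W i x ≤ max (W i x) 0 := le_max_left _ _
          have h3 : 0 ≤ max (W j x) 0 := le_max_right _ _
          exact mul_le_mul_of_nonneg_right (mul_le_mul_of_nonpos_left h2 h1) h3)
  simp only [e1] at t1
  have t4 := le_antisymm (t3.trans_eq t1) t2
  simp only [← sq] at t4
  rw [← t4]
  refine integral_congr_ae (Eventually.of_forall fun x => ?_)
  simp only
  congr 1
  refine Finset.sum_congr rfl fun i _ => ?_
  split_ifs <;> simp

end GoodSeqLemmas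

/-- **Positive and negative parts of first eigenfunctions of cooperative symmetric systems
are themselves first eigenfunctions** (their Rayleigh quotient equals `λ₁`, with the
a.e. convention `∇w⁺ = ∇w · 1_{w>0}`). -/
theorem statement10
    {N m : ℕ} (hN : 2 ≤ N)
    (Ω : Set (EuclN N)) (hΩo : IsOpen Ω) (hΩb : Bornology.IsBounded Ω)
    (C : Fin m → Fin m → EuclN N → ℝ)
    (hmeas : ∀ i j, Measurable (C i j))
    (hbdd : ∀ i j, ∃ M : ℝ, ∀ x ∈ Ω, |C i j x| ≤ M)
    (hsymm : ∀ i j, ∀ᵐ x ∂(volume : Measure (EuclN N)), x ∈ Ω → C i j x = C j i x)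
    (hcoop : ∀ i j, i ≠ j → ∀ᵐ x ∂(volume : Measure (EuclN N)), x ∈ Ω → C i j x ≤ 0)
    (W : Fin m → EuclN N → ℝ)
    (hWreg : ∀ i, ContDiffOn ℝ 1 (W i) (closure Ω))
    (hWbd : ∀ i, ∀ x ∈ frontier Ω, W i x = 0)
    (hWne : ∃ i, ∃ x ∈ Ω, W i x ≠ 0)
    (heig : ∀ V : Fin m → EuclN N → ℝ, IsTestFun Ω V →
      BformL Ω C W V = lamOneSym Ω C * ∫ x in Ω, ∑ i, W i x * V i x) :
    ((∃ i, ∃ x ∈ Ω, 0 < W i x) →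
      (∫ x in Ω, ((∑ i, if 0 < W i x then ‖gradient (W i) x‖ ^ 2 else 0) +
          ∑ i, ∑ j, C i j x * max (W i x) 0 * max (W j x) 0)) =
        lamOneSym Ω C * ∫ x in Ω, ∑ i, (max (W i x) 0) ^ 2) ∧
    ((∃ i, ∃ x ∈ Ω, W i x < 0) →
      (∫ x in Ω, ((∑ i, if W i x < 0 then ‖gradient (W i) x‖ ^ 2 else 0) +
          ∑ i, ∑ j, C i j x * max (-W i x) 0 * max (-W j x) 0)) =
        lamOneSym Ω C * ∫ x in Ω, ∑ i, (max (-W i x) 0) ^ 2) := by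
  refine ⟨fun _ => main_pos Ω hΩo hΩb C hmeas hbdd hcoop W hWreg hWbd heig, fun _ => ?_⟩
  have hg : ∀ i x, gradient (fun y => -W i y) x = -gradient (W i) x := fun i x => by
    have : fderiv ℝ (fun y => -W i y) x = -fderiv ℝ (W i) x := fderiv_fun_neg
    simp [gradient, this]
  have h := main_pos Ω hΩo hΩb C hmeas hbdd hcoop (fun i x => -W i x)
    (fun i => (hWreg i).neg) (fun i x hx => by simp [hWbd i x hx]) (fun V hV => by
      have h1 : BformL Ω C (fun i x => -W i x) V = -BformL Ω C W V := by
        rw [BformL, BformL, ← integral_neg]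
        congr 1
        funext x
        simp only [hg, inner_neg_left, mul_neg, neg_mul, Finset.sum_neg_distrib]
        ring
      rw [h1, heig V hV, ← mul_neg, ← integral_neg]
      simp only [neg_mul, Finset.sum_neg_distrib])
  simpa only [hg, norm_neg, neg_pos] using h
end
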